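/- arXiv:1306.0748 — 3 statements merged into one kernel-verified Lean document; each statement's English description precedes it below -/
import Mathlib

section
/- Assume (H1) (for each θ∈Θ, A_θ = σ_θσ_θ^T where σ_θ: 𝕋^N → M_N(ℝ) is Lipschitz with |σ_θ| ≤ C and Lipschitz constant ≤ C, uniformly in θ), that Σ ≠ ∅, and (inver_dege): for every δ>0 there exists ν_δ>0 such that A_θ(x) ≥ ν_δ I (in the sense of symmetric matrices) for all θ∈Θ and all x with dist(x,Σ) > δ. Then, for any constant C>0, condition (sur-sol-stricte) holds: for every δ>0 there exist ψ_δ ∈ C²(ℝ^N) and a bounded open set Ω_δ ⊂ ℝ^N with [0,1]^N ⊂ Ω_δ such that ψ_δ ≤ 0 on Ω_δ, ψ_δ ≥ 0 on the complement of Ω_δ, and inf_{θ∈Θ}{−trace(Ã_θ(x̃)D²ψ_δ(x̃))} − C|Dψ_δ(x̃)| > 0 for every x̃ ∈ Ω_δ with dist(x̃, Σ̃) > δ, where Ã_θ and Σ̃ denote the ℤ^N-periodic lifts of A_θ and Σ to ℝ^N. -/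
open Filter
open scoped RealInnerProductSpace Matrix

noncomputable section

namespace LargeTimeBehavior

/-- Euclidean space ℝ^N; ℤ^N-periodic functions on it represent functions on the torus 𝕋^N. -/
abbrev E (N : ℕ) := EuclideanSpace ℝ (Fin N)

variable {N : ℕ} {Θ : Type*}

/-- `f` is ℤ^N-periodic. -/
def ZPeriodic {α : Type*} (f : E N → α) : Prop :=
  ∀ (x : E N) (k : Fin N → ℤ), f (x + (WithLp.equiv 2 (Fin N → ℝ)).symm fun i => (k i : ℝ)) = f x

/-- Hessian matrix of a real function on ℝ^N. -/
def hessMatrix (φ : E N → ℝ) (x : E N) : Matrix (Fin N) (Fin N) ℝ :=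
  Matrix.of fun i j =>
    fderiv ℝ (fun y => fderiv ℝ φ y (EuclideanSpace.single j 1)) x (EuclideanSpace.single i 1)

/-- The totally degenerate set Σ = {x : A_θ(x) = 0 for all θ}. -/
def degenSet (A : Θ → E N → Matrix (Fin N) (Fin N) ℝ) : Set (E N) :=
  {x | ∀ θ, A θ x = 0}

/-- Value of the operator −trace(A_θ(x)D²φ) + H_θ(x,Dφ) on a C² test function φ at x. -/
def opVal (A : Θ → E N → Matrix (Fin N) (Fin N) ℝ) (H : Θ → E N → E N → ℝ)
    (θ : Θ) (x : E N) (φ : E N → ℝ) : ℝ :=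
  -Matrix.trace (A θ x * hessMatrix φ x) + H θ x (gradient φ x)

/-- Viscosity subsolution of ∂u/∂t + sup_θ{−tr(A_θD²u)+H_θ(x,Du)} = 0 on ℝ^N×(0,∞). -/
def IsSubSolCP (A : Θ → E N → Matrix (Fin N) (Fin N) ℝ) (H : Θ → E N → E N → ℝ)
    (u : E N → ℝ → ℝ) : Prop :=
  ∀ φ : E N → ℝ → ℝ, ContDiff ℝ 2 (fun q : E N × ℝ => φ q.1 q.2) →
    ∀ (x₀ : E N) (t₀ : ℝ), 0 < t₀ →
      IsLocalMax (fun q : E N × ℝ => u q.1 q.2 - φ q.1 q.2) (x₀, t₀) →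
      deriv (φ x₀) t₀ + (⨆ θ, opVal A H θ x₀ fun y => φ y t₀) ≤ 0

/-- Viscosity supersolution of the Cauchy problem. -/
def IsSuperSolCP (A : Θ → E N → Matrix (Fin N) (Fin N) ℝ) (H : Θ → E N → E N → ℝ)
    (u : E N → ℝ → ℝ) : Prop :=
  ∀ φ : E N → ℝ → ℝ, ContDiff ℝ 2 (fun q : E N × ℝ => φ q.1 q.2) →
    ∀ (x₀ : E N) (t₀ : ℝ), 0 < t₀ →
      IsLocalMin (fun q : E N × ℝ => u q.1 q.2 - φ q.1 q.2) (x₀, t₀) →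
      0 ≤ deriv (φ x₀) t₀ + (⨆ θ, opVal A H θ x₀ fun y => φ y t₀)

/-- Viscosity solution of the Cauchy problem. -/
def IsSolCP (A : Θ → E N → Matrix (Fin N) (Fin N) ℝ) (H : Θ → E N → E N → ℝ)
    (u : E N → ℝ → ℝ) : Prop :=
  IsSubSolCP A H u ∧ IsSuperSolCP A H u

/-- Viscosity subsolution of the ergodic problem sup_θ{−tr(A_θD²v)+H_θ(x,Dv)} = c. -/
def IsSubSolErg (A : Θ → E N → Matrix (Fin N) (Fin N) ℝ) (H : Θ → E N → E N → ℝ)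
    (c : ℝ) (v : E N → ℝ) : Prop :=
  ∀ φ : E N → ℝ, ContDiff ℝ 2 φ → ∀ x₀ : E N,
    IsLocalMax (fun x => v x - φ x) x₀ → (⨆ θ, opVal A H θ x₀ φ) ≤ c

/-- Viscosity supersolution of the ergodic problem. -/
def IsSuperSolErg (A : Θ → E N → Matrix (Fin N) (Fin N) ℝ) (H : Θ → E N → E N → ℝ)
    (c : ℝ) (v : E N → ℝ) : Prop :=
  ∀ φ : E N → ℝ, ContDiff ℝ 2 φ → ∀ x₀ : E N,
    IsLocalMin (fun x => v x - φ x) x₀ → c ≤ (⨆ θ, opVal A H θ x₀ φ)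

/-- Viscosity solution of the ergodic problem. -/
def IsSolErg (A : Θ → E N → Matrix (Fin N) (Fin N) ℝ) (H : Θ → E N → E N → ℝ)
    (c : ℝ) (v : E N → ℝ) : Prop :=
  IsSubSolErg A H c v ∧ IsSuperSolErg A H c v

/-- Viscosity subsolution of the discounted equation λw + sup_θ{−tr(A_θD²w)+H_θ(x,Dw)} = 0. -/
def IsSubSolDisc (A : Θ → E N → Matrix (Fin N) (Fin N) ℝ) (H : Θ → E N → E N → ℝ)
    (lam : ℝ) (w : E N → ℝ) : Prop :=
  ∀ φ : E N → ℝ, ContDiff ℝ 2 φ → ∀ x₀ : E N,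
    IsLocalMax (fun x => w x - φ x) x₀ → lam * w x₀ + (⨆ θ, opVal A H θ x₀ φ) ≤ 0

/-- Viscosity supersolution of the discounted equation. -/
def IsSuperSolDisc (A : Θ → E N → Matrix (Fin N) (Fin N) ℝ) (H : Θ → E N → E N → ℝ)
    (lam : ℝ) (w : E N → ℝ) : Prop :=
  ∀ φ : E N → ℝ, ContDiff ℝ 2 φ → ∀ x₀ : E N,
    IsLocalMin (fun x => w x - φ x) x₀ → 0 ≤ lam * w x₀ + (⨆ θ, opVal A H θ x₀ φ)

/-- Viscosity solution of the discounted equation. -/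
def IsSolDisc (A : Θ → E N → Matrix (Fin N) (Fin N) ℝ) (H : Θ → E N → E N → ℝ)
    (lam : ℝ) (w : E N → ℝ) : Prop :=
  IsSubSolDisc A H lam w ∧ IsSuperSolDisc A H lam w

/-- P_{ημ}[u](x,t) = sup_{s ≥ t} { u(x,t) − v(x) − μ(u(x,s) − v(x)) − μη(s−t) }. -/
def Pfun (u : E N → ℝ → ℝ) (v : E N → ℝ) (η μ : ℝ) (x : E N) (t : ℝ) : ℝ :=
  sSup ((fun s => u x t - v x - μ * (u x s - v x) - μ * η * (s - t)) '' Set.Ici t)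

/-- M_{ημ}[u](t) = sup_x P_{ημ}[u](x,t). -/
def Mfun (u : E N → ℝ → ℝ) (v : E N → ℝ) (η μ : ℝ) (t : ℝ) : ℝ :=
  sSup (Set.range fun x : E N => Pfun u v η μ x t)

/-- Viscosity subsolution of
  min{ U , ∂U/∂t + inf_θ{−tr(A_θ(x)D²U)} − C₀|DU| } ≤ 0 on ℝ^N×(0,∞). -/
def IsSubSolMinIneq (A : Θ → E N → Matrix (Fin N) (Fin N) ℝ) (C₀ : ℝ)
    (U : E N → ℝ → ℝ) : Prop :=
  ∀ φ : E N → ℝ → ℝ, ContDiff ℝ 2 (fun q : E N × ℝ => φ q.1 q.2) →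
    ∀ (x₀ : E N) (t₀ : ℝ), 0 < t₀ →
      IsLocalMax (fun q : E N × ℝ => U q.1 q.2 - φ q.1 q.2) (x₀, t₀) →
      U x₀ t₀ ≤ 0 ∨
        deriv (φ x₀) t₀ + (⨅ θ, -Matrix.trace (A θ x₀ * hessMatrix (fun y => φ y t₀) x₀))
          - C₀ * ‖gradient (fun y => φ y t₀) x₀‖ ≤ 0

/-- The unit cube [0,1]^N. -/
def cube (N : ℕ) : Set (E N) := {x | ∀ i, x i ∈ Set.Icc (0:ℝ) 1}

/-- Assumption (sur-sol-stricte) with constant C. -/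
def SurSolStricte (A : Θ → E N → Matrix (Fin N) (Fin N) ℝ) (C : ℝ) : Prop :=
  ∀ δ > (0:ℝ), ∃ ψ : E N → ℝ, ContDiff ℝ 2 ψ ∧
    ∃ Ω : Set (E N), IsOpen Ω ∧ Bornology.IsBounded Ω ∧ cube N ⊆ Ω ∧
      (∀ x ∈ Ω, ψ x ≤ 0) ∧ (∀ x ∉ Ω, 0 ≤ ψ x) ∧
      ∀ x ∈ Ω, (∀ y ∈ degenSet A, δ < dist x y) →
        0 < (⨅ θ, -Matrix.trace (A θ x * hessMatrix ψ x)) - C * ‖gradient ψ x‖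

/-- Assumption (inver_dege): uniform ellipticity at distance > δ from Σ. -/
def InverDege (A : Θ → E N → Matrix (Fin N) (Fin N) ℝ) : Prop :=
  ∀ δ > (0:ℝ), ∃ ν > (0:ℝ), ∀ (θ : Θ) (x : E N),
    (∀ y ∈ degenSet A, δ < dist x y) →
    (A θ x - ν • (1 : Matrix (Fin N) (Fin N) ℝ)).PosSemidef

/-- Frobenius norm of a matrix. -/
def mnorm (M : Matrix (Fin N) (Fin N) ℝ) : ℝ := Real.sqrt (∑ i, ∑ j, (M i j)^2)

/-- Exponential weight. -/
def wexp (l : ℝ) (x₀ y : E N) : ℝ := Real.exp (-l * ‖y - x₀‖ ^ 2)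

theorem wexp_hasFDerivAt (l : ℝ) (x₀ y : E N) :
    HasFDerivAt (wexp l x₀) ((-(2 * l) * wexp l x₀ y) • innerSL ℝ (y - x₀)) y := by
  have h1 : HasFDerivAt (fun y : E N => y - x₀) (ContinuousLinearMap.id ℝ (E N)) y :=
    (hasFDerivAt_id y).sub_const x₀
  have h2 := ((h1.norm_sq).const_mul (-l)).exp
  refine h2.congr_fderiv ?_
  ext v
  simp [wexp]
  ring

theorem wexp_contDiff (l : ℝ) (x₀ : E N) : ContDiff ℝ 2 (wexp l x₀) := by
  unfold wexp
  exact (contDiff_const.mul ((contDiff_id.sub contDiff_const).norm_sq ℝ)).exp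

/-- The barrier. -/
def barr (l R : ℝ) (x₀ y : E N) : ℝ := Real.exp (-l * R ^ 2) - wexp l x₀ y

theorem barr_hasFDerivAt (l R : ℝ) (x₀ y : E N) :
    HasFDerivAt (barr l R x₀) ((2 * l * wexp l x₀ y) • innerSL ℝ (y - x₀)) y := by
  refine ((wexp_hasFDerivAt l x₀ y).const_sub (Real.exp (-l * R ^ 2))).congr_fderiv ?_
  ext v
  simp

theorem barr_gradient (l R : ℝ) (x₀ y : E N) :
    gradient (barr l R x₀) y = (2 * l * wexp l x₀ y) • (y - x₀) := by
  apply HasGradientAt.gradient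
  rw [hasGradientAt_iff_hasFDerivAt]
  refine (barr_hasFDerivAt l R x₀ y).congr_fderiv ?_
  ext v
  simp

theorem barr_hess (l R : ℝ) (x₀ x : E N) (i j : Fin N) :
    hessMatrix (barr l R x₀) x i j =
      2 * l * wexp l x₀ x * ((1 : Matrix (Fin N) (Fin N) ℝ) i j
        - 2 * l * ((x i - x₀ i) * (x j - x₀ j))) := by
  have h0 : (fun y => fderiv ℝ (barr l R x₀) y (EuclideanSpace.single j 1))
      = fun y => (2 * l * wexp l x₀ y) * (EuclideanSpace.proj (𝕜 := ℝ) j (y - x₀)) := by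
    funext y
    rw [(barr_hasFDerivAt l R x₀ y).fderiv]
    simp [EuclideanSpace.inner_single_right]
  have h1 : HasFDerivAt (fun y : E N => (EuclideanSpace.proj (𝕜 := ℝ) j : E N →L[ℝ] ℝ) (y - x₀))
      (EuclideanSpace.proj (𝕜 := ℝ) j) x :=
    (EuclideanSpace.proj (𝕜 := ℝ) j : E N →L[ℝ] ℝ).hasFDerivAt.comp x
      ((hasFDerivAt_id x).sub_const x₀)
  have h2 := ((wexp_hasFDerivAt l x₀ x).const_mul (2 * l)).mul h1
  simp only [hessMatrix, Matrix.of_apply]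
  rw [h0, HasFDerivAt.fderiv (f := fun y => (2 * l * wexp l x₀ y) * (EuclideanSpace.proj (𝕜 := ℝ) j (y - x₀))) h2]
  simp [EuclideanSpace.inner_single_right, Matrix.one_apply, Pi.single_apply, eq_comm]
  split_ifs <;> ring

theorem barr_trace (M : Matrix (Fin N) (Fin N) ℝ) (l R : ℝ) (x₀ x : E N) :
    Matrix.trace (M * hessMatrix (barr l R x₀) x) =
      2 * l * wexp l x₀ x * (M.trace -
        2 * l * ((fun i => x i - x₀ i) ⬝ᵥ (M *ᵥ fun i => x i - x₀ i))) := by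
  have h : hessMatrix (barr l R x₀) x = (2 * l * wexp l x₀ x) •
      ((1 : Matrix (Fin N) (Fin N) ℝ) - (2 * l) •
        Matrix.vecMulVec (fun i => x i - x₀ i) (fun i => x i - x₀ i)) := by
    ext i j
    rw [barr_hess]
    simp [Matrix.vecMulVec_apply]
  rw [h]
  simp [Matrix.mul_sub, Matrix.trace_sub, Matrix.mul_vecMulVec, Matrix.trace_vecMulVec]
  left; left
  exact dotProduct_comm _ _

theorem statement4
    {N : ℕ} {Θ : Type*} [MetricSpace Θ] [Nonempty Θ]
    (C : ℝ) (hC : 0 < C)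
    (σm : Θ → E N → Matrix (Fin N) (Fin N) ℝ)
    (A : Θ → E N → Matrix (Fin N) (Fin N) ℝ)
    -- (H1)
    (hA : ∀ (θ : Θ) (x : E N), A θ x = σm θ x * (σm θ x)ᵀ)
    (hσper : ∀ θ : Θ, ZPeriodic (σm θ))
    (hσbd : ∀ (θ : Θ) (x : E N) (i j : Fin N), |σm θ x i j| ≤ C)
    (hσlip : ∀ (θ : Θ) (i j : Fin N), LipschitzWith C.toNNReal fun x : E N => σm θ x i j)
    (H : Θ → E N → E N → ℝ)
    -- (H2)
    (hHper : ∀ (θ : Θ) (p : E N), ZPeriodic fun x => H θ x p)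
    (hH0 : ∀ (θ : Θ) (x : E N), |H θ x 0| ≤ C)
    (hHlip : ∀ R > (0:ℝ), ∃ CR > (0:ℝ), ∀ (θ : Θ) (x y p q : E N),
      ‖p‖ ≤ R → ‖q‖ ≤ R → |H θ x p - H θ y q| ≤ CR * (‖x - y‖ + ‖p - q‖))
    -- Σ nonempty
    (hne : (degenSet A).Nonempty)
    -- (inver_dege)
    (hell : InverDege A) :
    ∀ C' > (0:ℝ), SurSolStricte A C' := by
  intro C' hC' δ hδ
  obtain ⟨x₀, hx₀⟩ := hne
  obtain ⟨ν, hν, hνA⟩ := hell δ hδ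
  set T : ℝ := N * (N * C ^ 2) with hT
  have hT0 : 0 ≤ T := by positivity
  have htr : ∀ θ x, (A θ x).trace ≤ T := by
    intro θ x
    have : ∀ i, A θ x i i ≤ N * C ^ 2 := by
      intro i
      rw [hA, Matrix.mul_apply]
      calc _ ≤ ∑ j : Fin N, C ^ 2 := by
            apply Finset.sum_le_sum
            intro j _
            have h := hσbd θ x i j
            rw [Matrix.transpose_apply, ← pow_two]
            exact sq_le_sq' (abs_le.1 h).1 (abs_le.1 h).2
        _ = _ := by simp
    calc (A θ x).trace = ∑ i, A θ x i i := rfl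
      _ ≤ ∑ i : Fin N, (N * C ^ 2 : ℝ) := Finset.sum_le_sum fun i _ => this i
      _ = T := by simp [hT]
  obtain ⟨l, hl, hl1, hl2⟩ : ∃ l : ℝ, 0 < l ∧ T < l * ν * δ ^ 2 ∧ C' ≤ l * ν * δ := by
    refine ⟨(T + 1) / (ν * δ ^ 2) + C' / (ν * δ), by positivity, ?_, ?_⟩
    · have : ((T + 1) / (ν * δ ^ 2) + C' / (ν * δ)) * ν * δ ^ 2 = T + 1 + C' * δ := by
        field_simp
      rw [this]
      have := mul_pos hC' hδ
      linarith
    · have : ((T + 1) / (ν * δ ^ 2) + C' / (ν * δ)) * ν * δ = (T + 1) / δ + C' := by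
        field_simp
      rw [this]
      have : 0 ≤ (T + 1) / δ := by positivity
      linarith
  have hcb : Bornology.IsBounded (cube N) := by
    have hb : Bornology.IsBounded (Set.Icc (0 : Fin N → ℝ) 1) := Metric.isBounded_Icc _ _
    have := (PiLp.antilipschitzWith_ofLp 2 (fun _ : Fin N => ℝ)).isBounded_preimage hb
    refine this.subset ?_
    intro x hx
    exact ⟨fun i => (hx i).1, fun i => (hx i).2⟩
  obtain ⟨R, hR, hcR⟩ := hcb.subset_ball_lt 0 x₀
  refine ⟨barr l R x₀, contDiff_const.sub (wexp_contDiff l x₀), Metric.ball x₀ R,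
    Metric.isOpen_ball, Metric.isBounded_ball, hcR, ?_, ?_, ?_⟩
  · intro x hx
    rw [mem_ball_iff_norm] at hx
    have : ‖x - x₀‖ ^ 2 ≤ R ^ 2 := by gcongr
    unfold barr wexp
    rw [sub_nonpos]
    apply Real.exp_le_exp.2
    nlinarith
  · intro x hx
    rw [mem_ball_iff_norm, not_lt] at hx
    have : R ^ 2 ≤ ‖x - x₀‖ ^ 2 := by gcongr
    unfold barr wexp
    rw [sub_nonneg]
    apply Real.exp_le_exp.2
    nlinarith
  · intro x _ hx
    have hr : δ < ‖x - x₀‖ := by rw [← dist_eq_norm]; exact hx x₀ hx₀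
    set r := ‖x - x₀‖ with hrdef
    have hr0 : 0 < r := hδ.trans hr
    have he : 0 < wexp l x₀ x := Real.exp_pos _
    have hk : 0 < 2 * l * wexp l x₀ x := by positivity
    rw [barr_gradient, norm_smul, Real.norm_of_nonneg hk.le]
    have hlow : 2 * l * wexp l x₀ x * (2 * l * ν * r ^ 2 - T) ≤
        ⨅ θ, -Matrix.trace (A θ x * hessMatrix (barr l R x₀) x) := by
      apply le_ciInf
      intro θ
      rw [barr_trace, ← mul_neg]
      apply mul_le_mul_of_nonneg_left _ hk.le
      have hp := (hνA θ x hx).dotProduct_mulVec_nonneg (fun i => x i - x₀ i)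
      have hn : (fun i => x i - x₀ i) ⬝ᵥ (fun i => x i - x₀ i) = r ^ 2 := by
        rw [hrdef, EuclideanSpace.real_norm_sq_eq]
        simp [dotProduct, pow_two]
      rw [Matrix.sub_mulVec, dotProduct_sub, Matrix.smul_mulVec, Matrix.one_mulVec,
        star_trivial, dotProduct_smul, hn, smul_eq_mul] at hp
      have := htr θ x
      nlinarith
    have h1 : C' * r < 2 * l * ν * r ^ 2 - T := by
      have a1 : l * ν * δ ^ 2 ≤ l * ν * r ^ 2 := by gcongr
      have a2 : C' * r ≤ (l * ν * δ) * r := by gcongr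
      have a3 : (l * ν * δ) * r ≤ (l * ν * r) * r := by gcongr
      nlinarith
    have h2 := mul_lt_mul_of_pos_left h1 hk
    have h3 : C' * (2 * l * wexp l x₀ x * r) = 2 * l * wexp l x₀ x * (C' * r) := by ring
    rw [← hrdef, h3]
    linarith

end LargeTimeBehavior
end
end

section
/- Under the steady assumptions (H1)–(H3) with each H_θ(x,·) convex on ℝ^N for every x, normalized so that the ergodic constant is c=0, let u be the bounded solution of the Cauchy problem (CP) (Lipschitz in x with constant C uniformly in t) and let v be a bounded Lipschitz viscosity solution of the ergodic equation sup_θ{−trace(A_θD²v)+H_θ(x,Dv)} = 0. For η>0 and μ>1, the function P_{ημ}[u](x,t) := sup_{s≥t}{u(x,t)−v(x)−μ(u(x,s)−v(x))−μη(s−t)} is a viscosity subsolution of min{ U(x,t), ∂U/∂t + inf_{θ∈Θ}{−trace(A_θ(x)D²U)} − C₀|DU| } ≤ 0 on 𝕋^N×(0,∞), where C₀ = sup_{θ∈Θ} ||D_pH_θ||_{L^∞(𝕋^N×B(0,R))} with R = sup_{t≥0} Lip(u(·,t)) + Lip(v). -/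
open Filter
open scoped RealInnerProductSpace Matrix

noncomputable section

namespace LargeTimeBehavior

variable {N : ℕ} {Θ : Type*}

section Walk

open Metric Topology MeasureTheory
open scoped ContDiff Convolution

variable {F : Type*} [NormedAddCommGroup F] [NormedSpace ℝ F] {ι : Type*} [Fintype ι]

/-- Second-order constant coefficient operator. -/
def Lop (e : ι → F) (b : F) (h : F → ℝ) (y : F) : ℝ :=
  ∑ i, fderiv ℝ (fderiv ℝ h) y (e i) (e i) + fderiv ℝ h y b

/-- One step of the random walk. -/
def Top (e : ι → F) (b : F) (s : ℝ) (h : F → ℝ) (y : F) : ℝ :=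
  (h (y + (s ^ 2 * (Fintype.card ι + 1)) • b)
    + ∑ i, (h (y + (s * √(2 * (Fintype.card ι + 1))) • e i)
      + h (y + (-(s * √(2 * (Fintype.card ι + 1)))) • e i)) / 2) / (Fintype.card ι + 1)

lemma lineDeriv' {h : F → ℝ} (hd0 : Differentiable ℝ h) (y a : F) (s : ℝ) :
      HasDerivAt (fun s : ℝ => h (y + s • a)) (fderiv ℝ h (y + s • a) a) s := by
  have hline : HasDerivAt (fun s : ℝ => y + s • a) a s := by
    simpa using ((hasDerivAt_id s).smul_const a).const_add y
  exact (hd0 (y + s • a)).hasFDerivAt.comp_hasDerivAt s hline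

lemma tay1 {h : F → ℝ} (hd1 : Differentiable ℝ (fderiv ℝ h)) (K2 : NNReal)
   (hK2 : LipschitzWith K2 (fderiv ℝ (fderiv ℝ h))) (y a : F) : ‖fderiv ℝ h (y + a) - fderiv ℝ h y - fderiv ℝ (fderiv ℝ h) y a‖
      ≤ K2 * ‖a‖ * ‖a‖ := by
    have := (convex_closedBall y ‖a‖).norm_image_sub_le_of_norm_fderiv_le' (𝕜 := ℝ)
      (f := fderiv ℝ h) (φ := fderiv ℝ (fderiv ℝ h) y) (C := K2 * ‖a‖) (x := y) (y := y + a)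
      (fun x _ => hd1 x) (fun x hx => by
        have := hK2.dist_le_mul x y
        rw [dist_eq_norm] at this
        refine this.trans ?_
        have : dist x y ≤ ‖a‖ := by simpa using hx
        gcongr) (by simp) (by simp)
    simpa using this

lemma tay2 {h : F → ℝ} (hh : ContDiff ℝ ∞ h) (hc : HasCompactSupport h) : 
   (∃ K1, LipschitzWith K1 (fderiv ℝ h)) ∧ ∃ K1, LipschitzWith K1 (fderiv ℝ (fderiv ℝ h)) := by 
  have h1 : ContDiff ℝ ∞ (fderiv ℝ h) := hh.fderiv_right (by simp)
  have h2 : ContDiff ℝ ∞ (fderiv ℝ (fderiv ℝ h)) := h1.fderiv_right (by simp)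
  exact ⟨ContDiff.lipschitzWith_of_hasCompactSupport (hc.fderiv ℝ) h1 (by simp), ContDiff.lipschitzWith_of_hasCompactSupport
    ((hc.fderiv ℝ).fderiv ℝ) h2 (by simp)⟩

lemma tay3 {h : F → ℝ} (hd0 : Differentiable ℝ h) (K1 : NNReal)
    (hK1 : LipschitzWith K1 (fderiv ℝ h)) (y a : F) :
    |h (y + a) - h y - fderiv ℝ h y a| ≤ K1 * ‖a‖ ^ 2 := by
  have hder : ∀ s : ℝ, HasDerivAt (fun s : ℝ => h (y + s • a) - s * fderiv ℝ h y a)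
      (fderiv ℝ h (y + s • a) a - fderiv ℝ h y a) s := by
    intro s
    have h2 : HasDerivAt (fun s : ℝ => s * fderiv ℝ h y a) (fderiv ℝ h y a) s := by
      simpa using (hasDerivAt_id s).mul_const (fderiv ℝ h y a)
    exact (lineDeriv' hd0 y a s).sub h2
  have hb : ∀ s ∈ Set.Ico (0:ℝ) 1, ‖fderiv ℝ h (y + s • a) a - fderiv ℝ h y a‖
      ≤ K1 * ‖a‖ ^ 2 := by
    intro s hs
    rw [← sub_apply]
    refine (ContinuousLinearMap.le_opNorm _ _).trans ?_
    have := hK1.dist_le_mul (y + s • a) y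
    rw [dist_eq_norm, dist_eq_norm, add_sub_cancel_left, norm_smul, Real.norm_of_nonneg hs.1]
      at this
    have h3 : s * ‖a‖ ≤ ‖a‖ := mul_le_of_le_one_left (norm_nonneg a) hs.2.le
    calc _ ≤ K1 * (s * ‖a‖) * ‖a‖ := by gcongr
      _ ≤ K1 * ‖a‖ * ‖a‖ := by gcongr
      _ = _ := by ring
  have := norm_image_sub_le_of_norm_deriv_le_segment_01'
    (fun s _ => (hder s).hasDerivWithinAt) hb
  simp only [one_smul, one_mul, zero_smul, zero_mul, add_zero, sub_zero] at this
  rw [Real.norm_eq_abs] at this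
  refine le_trans (le_of_eq ?_) this
  congr 1; ring

lemma tay4 {h : F → ℝ} (hd0 : Differentiable ℝ h) (hd1 : Differentiable ℝ (fderiv ℝ h))
    (K2 : NNReal) (hK2 : LipschitzWith K2 (fderiv ℝ (fderiv ℝ h))) (y a : F) :
    |h (y + a) - h y - fderiv ℝ h y a - fderiv ℝ (fderiv ℝ h) y a a / 2| ≤ K2 * ‖a‖ ^ 3 := by
  generalize hQ : fderiv ℝ (fderiv ℝ h) y a a = Q
  have hder : ∀ s : ℝ, HasDerivAt (fun s : ℝ => h (y + s • a) - s * fderiv ℝ h y a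
      - s ^ 2 * (Q / 2))
      (fderiv ℝ h (y + s • a) a - fderiv ℝ h y a - s * Q) s := by
    intro s
    have h2 : HasDerivAt (fun s : ℝ => s * fderiv ℝ h y a) (fderiv ℝ h y a) s := by
      simpa using (hasDerivAt_id s).mul_const (fderiv ℝ h y a)
    have h3 : HasDerivAt (fun s : ℝ => s ^ 2 * (Q / 2)) (s * Q) s := by
      have := (hasDerivAt_pow 2 s).mul_const (Q / 2)
      refine this.congr_deriv ?_
      push_cast
      ring
    exact ((lineDeriv' hd0 y a s).sub h2).sub h3
  have hb : ∀ s ∈ Set.Ico (0:ℝ) 1, ‖fderiv ℝ h (y + s • a) a - fderiv ℝ h y a - s * Q‖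
      ≤ K2 * ‖a‖ ^ 3 := by
    intro s hs
    have h5 : fderiv ℝ h (y + s • a) a - fderiv ℝ h y a - s * Q
        = (fderiv ℝ h (y + s • a) - fderiv ℝ h y - fderiv ℝ (fderiv ℝ h) y (s • a)) a := by
      rw [map_smul, sub_apply, sub_apply, smul_apply, hQ, smul_eq_mul]
    rw [h5]
    refine (ContinuousLinearMap.le_opNorm _ _).trans ?_
    have := tay1 hd1 K2 hK2 y (s • a)
    rw [norm_smul s, Real.norm_of_nonneg hs.1] at this
    have h3 : s * ‖a‖ ≤ ‖a‖ := mul_le_of_le_one_left (norm_nonneg a) hs.2.le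
    have h4 := mul_nonneg hs.1 (norm_nonneg a)
    calc _ ≤ K2 * (s * ‖a‖) * (s * ‖a‖) * ‖a‖ := by gcongr
      _ ≤ K2 * ‖a‖ * ‖a‖ * ‖a‖ := by gcongr
      _ = _ := by ring
  have := norm_image_sub_le_of_norm_deriv_le_segment_01'
    (fun s _ => (hder s).hasDerivWithinAt) hb
  simp only [one_smul, one_mul, zero_smul, zero_mul, add_zero, sub_zero, one_pow, ne_eq,
    OfNat.ofNat_ne_zero, not_false_eq_true, zero_pow] at this
  rw [Real.norm_eq_abs] at this
  refine le_trans (le_of_eq ?_) this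
  congr 1; ring

lemma taylor_bounds {h : F → ℝ} (hh : ContDiff ℝ ∞ h) (hc : HasCompactSupport h) :
    ∃ K : ℝ, 0 ≤ K ∧ ∀ y a : F, |h (y + a) - h y - fderiv ℝ h y a| ≤ K * ‖a‖ ^ 2 ∧
      |h (y + a) - h y - fderiv ℝ h y a - fderiv ℝ (fderiv ℝ h) y a a / 2| ≤ K * ‖a‖ ^ 3 := by
  have h1 : ContDiff ℝ ∞ (fderiv ℝ h) := hh.fderiv_right (by simp)
  have hd0 : Differentiable ℝ h := hh.differentiable (by simp)
  have hd1 : Differentiable ℝ (fderiv ℝ h) := h1.differentiable (by simp)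
  obtain ⟨⟨K1, hK1⟩, K2, hK2⟩ := tay2 hh hc
  have p1 : (0:ℝ) ≤ K1 := K1.2
  have p2 : (0:ℝ) ≤ K2 := K2.2
  refine ⟨K1 + K2, by positivity, fun y a => ⟨(tay3 hd0 K1 hK1 y a).trans ?_,
    (tay4 hd0 hd1 K2 hK2 y a).trans ?_⟩⟩
  · have := pow_nonneg (norm_nonneg a) 2
    nlinarith
  · have := pow_nonneg (norm_nonneg a) 3
    nlinarith

lemma Top_add (e : ι → F) (b : F) (s : ℝ) (f g : F → ℝ) :
    Top e b s (fun y => f y + g y) = fun y => Top e b s f y + Top e b s g y := by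
  ext y
  simp only [Top]
  rw [← add_div]
  congr 1
  rw [add_add_add_comm, ← Finset.sum_add_distrib]
  congr 1
  exact Finset.sum_congr rfl fun i _ => by ring

lemma Top_smul (e : ι → F) (b : F) (s c : ℝ) (f : F → ℝ) :
    Top e b s (fun y => c * f y) = fun y => c * Top e b s f y := by
  ext y
  simp only [Top]
  rw [← mul_div_assoc]
  congr 1
  rw [mul_add c, Finset.mul_sum]
  congr 1
  exact Finset.sum_congr rfl fun i _ => by ring

lemma Top_mono (e : ι → F) (b : F) (s : ℝ) {f g : F → ℝ} (h : ∀ y, f y ≤ g y) (y : F) :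
    Top e b s f y ≤ Top e b s g y := by
  simp only [Top]
  gcongr <;> exact h _

lemma Top_const (e : ι → F) (b : F) (s c : ℝ) : Top e b s (fun _ => c) = fun _ => c := by
  ext y
  simp only [Top]
  have : (Fintype.card ι + 1 : ℝ) ≠ 0 := by positivity
  simp
  field_simp
  ring

lemma Top_contDiff (e : ι → F) (b : F) (s : ℝ) {f : F → ℝ} {n : WithTop ℕ∞}
    (h : ContDiff ℝ n f) : ContDiff ℝ n (Top e b s f) := by
  unfold Top
  fun_prop

lemma Top_continuous (e : ι → F) (b : F) (s : ℝ) {f : F → ℝ}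
    (h : Continuous f) : Continuous (Top e b s f) := by
  unfold Top
  fun_prop

lemma fderiv_Top (e : ι → F) (b : F) (s : ℝ) {f : F → ℝ} (h : Differentiable ℝ f) (y v : F) :
    fderiv ℝ (Top e b s f) y v = Top e b s (fun z => fderiv ℝ f z v) y := by
  have hs : ∀ a : F, HasFDerivAt (fun z => f (z + a)) (fderiv ℝ f (y + a)) y := fun a => by
    have := (h (y + a)).hasFDerivAt.comp y ((hasFDerivAt_id y).add_const a)
    rw [ContinuousLinearMap.comp_id] at this
    exact this
  have := (((hs ((s ^ 2 * (Fintype.card ι + 1)) • b)).add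
    (HasFDerivAt.fun_sum (u := Finset.univ) fun i _ =>
      ((hs ((s * √(2 * (Fintype.card ι + 1))) • e i)).add
       (hs ((-(s * √(2 * (Fintype.card ι + 1)))) • e i))).mul_const (2:ℝ)⁻¹)).mul_const
        ((Fintype.card ι + 1 : ℝ)⁻¹))
  have h2 := HasFDerivAt.congr_of_eventuallyEq (f₁ := Top e b s f) this
    (Eventually.of_forall fun z => by simp only [Top, div_eq_mul_inv, Pi.add_apply])
  rw [h2.fderiv]
  simp only [Top, div_eq_mul_inv, smul_apply, add_apply, sum_apply, smul_eq_mul]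
  rw [mul_comm]
  congr 2
  exact Finset.sum_congr rfl fun i _ => by ring

lemma Lop_Top (e : ι → F) (b : F) (s : ℝ) {f : F → ℝ} (h : ContDiff ℝ 2 f) :
    Lop e b (Top e b s f) = Top e b s (Lop e b f) := by
  have hd : Differentiable ℝ f := h.differentiable (by norm_num)
  have h1 : ContDiff ℝ 1 (fderiv ℝ f) := h.fderiv_right (by norm_num)
  have hT : ContDiff ℝ 2 (Top e b s f) := Top_contDiff e b s h
  have hT1 : ContDiff ℝ 1 (fderiv ℝ (Top e b s f)) := hT.fderiv_right (by norm_num)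
  have sec : ∀ {g : F → ℝ}, ContDiff ℝ 1 (fderiv ℝ g) → ∀ y v w,
      fderiv ℝ (fderiv ℝ g) y v w = fderiv ℝ (fun z => fderiv ℝ g z w) y v := by
    intro g hg y v w
    have := ((hg.differentiable (by norm_num)) y).hasFDerivAt.clm_apply (hasFDerivAt_const w y)
    rw [this.fderiv]
    simp
  ext y
  have hsum : ∀ (S : Finset ι) (g : ι → F → ℝ), Top e b s (fun z => ∑ i ∈ S, g i z)
      = fun z => ∑ i ∈ S, Top e b s (g i) z := by
    intro S g
    classical
    induction S using Finset.induction_on with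
    | empty => simpa using Top_const e b s 0
    | insert a S ha ih => simp only [Finset.sum_insert ha]; rw [Top_add, ih]
  unfold Lop
  rw [Top_add, hsum]
  rw [fderiv_Top e b s hd]
  congr 1
  refine Finset.sum_congr rfl fun i _ => ?_
  rw [sec hT1]
  have : (fun z => fderiv ℝ (Top e b s f) z (e i)) = Top e b s (fun z => fderiv ℝ f z (e i)) := by
    ext z; exact fderiv_Top e b s hd z (e i)
  rw [this, fderiv_Top e b s ((h1.differentiable (by norm_num)).clm_apply (differentiable_const _))]
  congr 1
  ext z
  rw [sec h1]

lemma Top_expand (e : ι → F) (b : F) {h : F → ℝ} (hh : ContDiff ℝ ∞ h)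
    (hc : HasCompactSupport h) : ∃ K : ℝ, 0 ≤ K ∧ ∀ s : ℝ, 0 ≤ s → s ≤ 1 → ∀ y,
      |Top e b s h y - h y - s ^ 2 * Lop e b h y| ≤ K * s ^ 3 := by
  obtain ⟨K, hK0, hK⟩ := taylor_bounds hh hc
  set m : ℝ := Fintype.card ι + 1 with hm
  have hmpos : 0 < m := by positivity
  set r : ℝ := √(2 * m) with hr
  have hr2 : r ^ 2 = 2 * m := Real.sq_sqrt (by positivity)
  have hr0 : 0 ≤ r := Real.sqrt_nonneg _
  refine ⟨(K * (m * ‖b‖) ^ 2 + ∑ i, K * (r * ‖e i‖) ^ 3) / m, by positivity, ?_⟩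
  intro s hs0 hs1 y
  have hb := (hK y ((s ^ 2 * m) • b)).1
  have he1 := fun i => (hK y ((s * r) • e i)).2
  have he2 := fun i => (hK y ((-(s * r)) • e i)).2
  have eq : Top e b s h y - h y - s ^ 2 * Lop e b h y =
      ((h (y + (s ^ 2 * m) • b) - h y - fderiv ℝ h y ((s ^ 2 * m) • b)) +
       ∑ i, ((h (y + (s * r) • e i) - h y - fderiv ℝ h y ((s * r) • e i)
          - fderiv ℝ (fderiv ℝ h) y ((s * r) • e i) ((s * r) • e i) / 2) +
         (h (y + (-(s * r)) • e i) - h y - fderiv ℝ h y ((-(s * r)) • e i)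
          - fderiv ℝ (fderiv ℝ h) y ((-(s * r)) • e i) ((-(s * r)) • e i) / 2)) / 2) / m := by
    have e3 : ∀ i, ((h (y + (s * r) • e i) - h y - fderiv ℝ h y ((s * r) • e i)
          - fderiv ℝ (fderiv ℝ h) y ((s * r) • e i) ((s * r) • e i) / 2) +
         (h (y + (-(s * r)) • e i) - h y - fderiv ℝ h y ((-(s * r)) • e i)
          - fderiv ℝ (fderiv ℝ h) y ((-(s * r)) • e i) ((-(s * r)) • e i) / 2)) / 2
        = (h (y + (s * r) • e i) + h (y + (-(s * r)) • e i)) / 2 - h y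
          - s ^ 2 * m * fderiv ℝ (fderiv ℝ h) y (e i) (e i) := by
      intro i
      simp only [map_smul, smul_apply, smul_eq_mul]
      linear_combination (-(s ^ 2) / 2 * fderiv ℝ (fderiv ℝ h) y (e i) (e i)) * hr2
    rw [Finset.sum_congr rfl fun i _ => e3 i]
    rw [Finset.sum_sub_distrib, Finset.sum_sub_distrib, ← Finset.mul_sum]
    simp only [Top, Lop, ← hm, ← hr, map_smul, smul_eq_mul, Finset.sum_const, Finset.card_univ,
      nsmul_eq_mul]
    have hm' : (Fintype.card ι : ℝ) = m - 1 := by rw [hm]; ring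
    rw [hm']
    field_simp
    ring
  rw [eq, abs_div, abs_of_pos hmpos, div_mul_eq_mul_div]
  gcongr
  refine (abs_add_le _ _).trans ?_
  rw [add_mul, Finset.sum_mul]
  refine add_le_add (hb.trans ?_) ((Finset.abs_sum_le_sum_abs _ _).trans
    (Finset.sum_le_sum fun i _ => ?_))
  · rw [norm_smul, Real.norm_of_nonneg (by positivity)]
    have : s ^ 4 ≤ s ^ 3 := pow_le_pow_of_le_one hs0 hs1 (by norm_num)
    calc K * (s ^ 2 * m * ‖b‖) ^ 2 = K * (m * ‖b‖) ^ 2 * s ^ 4 := by ring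
      _ ≤ _ := by gcongr
  · have n1 : ‖(s * r) • e i‖ = s * r * ‖e i‖ := by
      rw [norm_smul, Real.norm_of_nonneg (by positivity)]
    have n2 : ‖(-(s * r)) • e i‖ = s * r * ‖e i‖ := by
      rw [neg_smul, norm_neg, n1]
    have a1 := he1 i
    have a2 := he2 i
    rw [n1] at a1
    rw [n2] at a2
    rw [abs_div, abs_of_pos (by norm_num : (0:ℝ) < 2)]
    rw [div_le_iff₀ (by norm_num)]
    refine (abs_add_le _ _).trans ((add_le_add a1 a2).trans (le_of_eq ?_))
    ring

end Walk

section Walk2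

open Metric Topology MeasureTheory
open scoped ContDiff Convolution

variable {F : Type*} [NormedAddCommGroup F] [NormedSpace ℝ F] {ι : Type*} [Fintype ι]

lemma Lop_contDiff (e : ι → F) (b : F) {h : F → ℝ} (hh : ContDiff ℝ ∞ h) :
    ContDiff ℝ ∞ (Lop e b h) := by
  have h1 : ContDiff ℝ ∞ (fderiv ℝ h) := hh.fderiv_right (by simp)
  have h2 : ContDiff ℝ ∞ (fderiv ℝ (fderiv ℝ h)) := h1.fderiv_right (by simp)
  unfold Lop
  refine ContDiff.add (ContDiff.sum fun i _ => ?_) ?_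
  · exact (h2.clm_apply contDiff_const).clm_apply contDiff_const
  · exact h1.clm_apply contDiff_const

lemma Lop_compact (e : ι → F) (b : F) {h : F → ℝ} (hc : HasCompactSupport h) :
    HasCompactSupport (Lop e b h) := by
  refine HasCompactSupport.intro hc fun x hx => ?_
  have h0 : h =ᶠ[𝓝 x] fun _ => 0 := notMem_tsupport_iff_eventuallyEq.1 hx
  have h1 : fderiv ℝ h =ᶠ[𝓝 x] fun _ => 0 := by
    have := h0.fderiv (𝕜 := ℝ)
    refine this.trans (Eventually.of_forall fun y => by simp)
  have h2 : fderiv ℝ (fderiv ℝ h) x = 0 := by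
    rw [h1.fderiv_eq]; simp
  simp [Lop, h2, h1.self_of_nhds]

lemma Lop_add (e : ι → F) (b : F) {f g : F → ℝ} (hf : ContDiff ℝ 2 f) (hg : ContDiff ℝ 2 g)
    (y : F) : Lop e b (fun z => f z + g z) y = Lop e b f y + Lop e b g y := by
  have hf0 : Differentiable ℝ f := hf.differentiable (by norm_num)
  have hg0 : Differentiable ℝ g := hg.differentiable (by norm_num)
  have hf1 : Differentiable ℝ (fderiv ℝ f) :=
    (hf.fderiv_right (m := 1) (by norm_num)).differentiable (by norm_num)
  have hg1 : Differentiable ℝ (fderiv ℝ g) :=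
    (hg.fderiv_right (m := 1) (by norm_num)).differentiable (by norm_num)
  have e1 : fderiv ℝ (fun z => f z + g z) = fun z => fderiv ℝ f z + fderiv ℝ g z := by
    ext1 z; exact fderiv_fun_add (hf0 z) (hg0 z)
  unfold Lop
  rw [e1, fderiv_fun_add (hf1 y) (hg1 y)]
  simp only [add_apply, Finset.sum_add_distrib]
  ring

lemma Lop_const (e : ι → F) (b : F) (c : ℝ) (y : F) : Lop e b (fun _ => c) y = 0 := by
  simp [Lop]

lemma Lop_smul (e : ι → F) (b : F) (c : ℝ) {f : F → ℝ} (hf : ContDiff ℝ 2 f) (y : F) :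
    Lop e b (fun z => c * f z) y = c * Lop e b f y := by
  have hf0 : Differentiable ℝ f := hf.differentiable (by norm_num)
  have hf1 : Differentiable ℝ (fderiv ℝ f) :=
    (hf.fderiv_right (m := 1) (by norm_num)).differentiable (by norm_num)
  have e1 : fderiv ℝ (fun z => c * f z) = fun z => c • fderiv ℝ f z := by
    ext1 z; exact fderiv_const_mul (hf0 z) c
  unfold Lop
  rw [e1, fderiv_fun_const_smul (hf1 y)]
  simp only [smul_apply, smul_eq_mul, mul_add, Finset.mul_sum]

/-- Uniform estimates for the walk. -/
def Est (e : ι → F) (b : F) (K : ℝ) (f : F → ℝ) : Prop :=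
  ∀ s : ℝ, 0 ≤ s → s ≤ 1 → ∀ y, |Top e b s f y - f y - s ^ 2 * Lop e b f y| ≤ K * s ^ 3 ∧
    |Top e b s (Lop e b f) y - Lop e b f y| ≤ K * s ^ 2 ∧ |Top e b s f y - f y| ≤ K * s ^ 2

lemma est_compact (e : ι → F) (b : F) {h : F → ℝ} (hh : ContDiff ℝ ∞ h)
    (hc : HasCompactSupport h) : ∃ K : ℝ, 0 ≤ K ∧ Est e b K h := by
  obtain ⟨K1, hK1, h1⟩ := Top_expand e b hh hc
  obtain ⟨K2, hK2, h2⟩ := Top_expand e b (Lop_contDiff e b hh) (Lop_compact e b hc)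
  obtain ⟨B1, hB1⟩ := (Lop_compact e b hc).exists_bound_of_continuous
    (Lop_contDiff e b hh).continuous
  obtain ⟨B2, hB2⟩ := (Lop_compact e b (Lop_compact e b hc)).exists_bound_of_continuous
    (Lop_contDiff e b (Lop_contDiff e b hh)).continuous
  have p1 : 0 ≤ B1 := (norm_nonneg _).trans (hB1 0)
  have p2 : 0 ≤ B2 := (norm_nonneg _).trans (hB2 0)
  refine ⟨K1 + K2 + B1 + B2, by positivity, fun s hs0 hs1 y => ?_⟩
  have a1 := abs_le.1 (h1 s hs0 hs1 y)
  have a2 := abs_le.1 (h2 s hs0 hs1 y)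
  have b1 := abs_le.1 ((Real.norm_eq_abs _).symm.le.trans (hB1 y))
  have b2 := abs_le.1 ((Real.norm_eq_abs _).symm.le.trans (hB2 y))
  have hs2 : 0 ≤ s ^ 2 := by positivity
  have hs3 : 0 ≤ s ^ 3 := by positivity
  have hs32 : s ^ 3 ≤ s ^ 2 := pow_le_pow_of_le_one hs0 hs1 (by norm_num)
  have c1 : K1 * s ^ 3 ≤ K1 * s ^ 2 := by gcongr
  have c2 : K2 * s ^ 3 ≤ K2 * s ^ 2 := by gcongr
  have q1 := mul_nonneg hK1 hs3
  have q2 := mul_nonneg hK2 hs3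
  have q3 := mul_nonneg p1 hs3
  have q4 := mul_nonneg p2 hs3
  have q5 := mul_nonneg hK1 hs2
  have q6 := mul_nonneg hK2 hs2
  have q7 := mul_nonneg p1 hs2
  have q8 := mul_nonneg p2 hs2
  refine ⟨abs_le.2 ⟨by nlinarith, by nlinarith⟩, abs_le.2 ⟨?_, ?_⟩, abs_le.2 ⟨?_, ?_⟩⟩
  · nlinarith [mul_le_mul_of_nonneg_left b2.1 hs2]
  · nlinarith [mul_le_mul_of_nonneg_left b2.2 hs2]
  · nlinarith [mul_le_mul_of_nonneg_left b1.1 hs2]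
  · nlinarith [mul_le_mul_of_nonneg_left b1.2 hs2]

lemma est_const_add (e : ι → F) (b : F) {f : F → ℝ} (hf : ContDiff ℝ 2 f) (c K : ℝ)
    (h : Est e b K f) : Est e b K (fun y => c + f y) := by
  intro s h0 h1 y
  have e1 : Lop e b (fun y => c + f y) = Lop e b f := by
    ext z
    rw [Lop_add e b contDiff_const hf, Lop_const, zero_add]
  rw [e1, Top_add, Top_const]
  obtain ⟨a1, a2, a3⟩ := h s h0 h1 y
  refine ⟨?_, a2, ?_⟩
  · convert a1 using 2; ring
  · convert a3 using 2; ring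

lemma Top_abs (e : ι → F) (b : F) (s : ℝ) {f : F → ℝ} {c : ℝ} (h : ∀ y, |f y| ≤ c) (y : F) :
    |Top e b s f y| ≤ c := by
  have h1 := Top_mono e b s (fun y => (abs_le.1 (h y)).2) y
  have h2 := Top_mono e b s (fun y => (abs_le.1 (h y)).1) y
  rw [Top_const] at h1 h2
  exact abs_le.2 ⟨h2, h1⟩

/-- The comparison sequence. -/
def hseq (e : ι → F) (b : F) (s : ℝ) (w g : F → ℝ) : ℕ → F → ℝ
  | 0 => w
  | n + 1 => fun y => Top e b s (hseq e b s w g n) y + s ^ 2 * g y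

lemma hseq_contDiff (e : ι → F) (b : F) (s : ℝ) {w g : F → ℝ} (hw : ContDiff ℝ ∞ w)
    (hg : ContDiff ℝ ∞ g) (n : ℕ) : ContDiff ℝ ∞ (hseq e b s w g n) := by
  induction n with
  | zero => exact hw
  | succ n ih => exact (Top_contDiff e b s ih).add (contDiff_const.mul hg)

lemma hseq_bound (e : ι → F) (b : F) (s : ℝ) {w g : F → ℝ} {B G : ℝ} (hw : ∀ y, |w y| ≤ B)
    (hg : ∀ y, |g y| ≤ G) (n : ℕ) (y : F) : |hseq e b s w g n y| ≤ B + n * s ^ 2 * G := by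
  induction n generalizing y with
  | zero => simpa [hseq] using hw y
  | succ n ih =>
    have h1 := Top_abs e b s ih y
    have h2 : |s ^ 2 * g y| ≤ s ^ 2 * G := by
      rw [abs_mul, abs_of_nonneg (sq_nonneg s)]
      exact mul_le_mul_of_nonneg_left (hg y) (sq_nonneg s)
    refine (abs_add_le _ _).trans ((add_le_add h1 h2).trans (le_of_eq ?_))
    push_cast; ring

lemma Top_lin (e : ι → F) (b : F) (s : ℝ) (f g : F → ℝ) (c : ℝ) (y : F) :
    Top e b s (fun z => f z + c * g z) y = Top e b s f y + c * Top e b s g y := by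
  rw [Top_add, Top_smul]

lemma hseq_err1 (e : ι → F) (b : F) {s : ℝ} (h0 : 0 ≤ s) (h1 : s ≤ 1) {w g : F → ℝ}
    (hw : ContDiff ℝ ∞ w) (hg : ContDiff ℝ ∞ g) {K1 K2 : ℝ} (ew : Est e b K1 w)
    (eg : Est e b K2 g) (n : ℕ) (y : F) :
    |Top e b s (hseq e b s w g n) y - hseq e b s w g n y - s ^ 2 * Lop e b (hseq e b s w g n) y|
      ≤ (K1 + n * s ^ 2 * K2) * s ^ 3 := by
  induction n generalizing y with
  | zero => simpa [hseq] using (ew s h0 h1 y).1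
  | succ n ih =>
    set h := hseq e b s w g n with hh
    have hC : ContDiff ℝ 2 h := (hseq_contDiff e b s hw hg n).of_le (by norm_cast)
    have hg2 : ContDiff ℝ 2 g := hg.of_le (by norm_cast)
    have e1 : hseq e b s w g (n + 1) = fun z => Top e b s h z + s ^ 2 * g z := rfl
    rw [e1, Top_lin, Lop_add e b (Top_contDiff e b s hC) (contDiff_const.mul hg2),
      Lop_smul e b _ hg2, Lop_Top e b s hC]
    have a1 := Top_abs e b s ih y
    have e2 : Top e b s (fun y => Top e b s h y - h y - s ^ 2 * Lop e b h y) y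
        = Top e b s (Top e b s h) y - Top e b s h y - s ^ 2 * Top e b s (Lop e b h) y := by
      have : (fun y => Top e b s h y - h y - s ^ 2 * Lop e b h y)
          = fun y => (Top e b s h y + (-1) * h y) + (-(s ^ 2)) * Lop e b h y := by
        ext z; ring
      rw [this, Top_lin, Top_lin]; ring
    rw [e2] at a1
    have a2 := (eg s h0 h1 y).1
    have a3 : |s ^ 2 * (Top e b s g y - g y - s ^ 2 * Lop e b g y)| ≤ s ^ 2 * (K2 * s ^ 3) := by
      rw [abs_mul, abs_of_nonneg (sq_nonneg s)]
      exact mul_le_mul_of_nonneg_left a2 (sq_nonneg s)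
    refine le_trans (le_of_eq ?_) ((abs_add_le _ _).trans ((add_le_add a1 a3).trans (le_of_eq ?_)))
    · congr 1; ring
    · push_cast; ring

lemma hseq_err2 (e : ι → F) (b : F) {s : ℝ} (h0 : 0 ≤ s) (h1 : s ≤ 1) {w g : F → ℝ}
    (hw : ContDiff ℝ ∞ w) (hg : ContDiff ℝ ∞ g) {K1 K2 : ℝ} (ew : Est e b K1 w)
    (eg : Est e b K2 g) (n : ℕ) (y : F) :
    |Top e b s (Lop e b (hseq e b s w g n)) y - Lop e b (hseq e b s w g n) y|
      ≤ (K1 + n * s ^ 2 * K2) * s ^ 2 := by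
  induction n generalizing y with
  | zero => simpa [hseq] using (ew s h0 h1 y).2.1
  | succ n ih =>
    set h := hseq e b s w g n with hh
    have hC : ContDiff ℝ 2 h := (hseq_contDiff e b s hw hg n).of_le (by norm_cast)
    have hg2 : ContDiff ℝ 2 g := hg.of_le (by norm_cast)
    have e1 : hseq e b s w g (n + 1) = fun z => Top e b s h z + s ^ 2 * g z := rfl
    have e3 : Lop e b (hseq e b s w g (n + 1))
        = fun z => Top e b s (Lop e b h) z + s ^ 2 * Lop e b g z := by
      ext z
      rw [e1, Lop_add e b (Top_contDiff e b s hC) (contDiff_const.mul hg2),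
      Lop_smul e b _ hg2, Lop_Top e b s hC]
    rw [e3, Top_lin]
    have a1 := Top_abs e b s ih y
    have e2 : Top e b s (fun y => Top e b s (Lop e b h) y - Lop e b h y) y
        = Top e b s (Top e b s (Lop e b h)) y - Top e b s (Lop e b h) y := by
      have : (fun y => Top e b s (Lop e b h) y - Lop e b h y)
          = fun y => Top e b s (Lop e b h) y + (-1) * Lop e b h y := by
        ext z; ring
      rw [this, Top_lin]; ring
    rw [e2] at a1
    have a2 := (eg s h0 h1 y).2.1
    have a3 : |s ^ 2 * (Top e b s (Lop e b g) y - Lop e b g y)| ≤ s ^ 2 * (K2 * s ^ 2) := by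
      rw [abs_mul, abs_of_nonneg (sq_nonneg s)]
      exact mul_le_mul_of_nonneg_left a2 (sq_nonneg s)
    refine le_trans (le_of_eq ?_) ((abs_add_le _ _).trans ((add_le_add a1 a3).trans (le_of_eq ?_)))
    · congr 1; ring
    · push_cast; ring

lemma hseq_le (e : ι → F) (b : F) {s : ℝ} (h0 : 0 ≤ s) (h1 : s ≤ 1) {w g W : F → ℝ}
    {K om : ℝ} (hK : 0 ≤ K) (eg : Est e b K g) (hw : ∀ y, w y ≤ W y + om) (n : ℕ) (y : F) :
    hseq e b s w g n y ≤ (Top e b s)^[n] W y + om + n * s ^ 2 * g y + K * (n * s ^ 2) ^ 2 := by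
  induction n generalizing y with
  | zero => simpa [hseq] using hw y
  | succ n ih =>
    rw [Function.iterate_succ_apply']
    have a1 := Top_mono e b s ih y
    have e2 : Top e b s (fun y => (Top e b s)^[n] W y + om + n * s ^ 2 * g y
          + K * (n * s ^ 2) ^ 2) y
        = Top e b s ((Top e b s)^[n] W) y + om + n * s ^ 2 * Top e b s g y
          + K * (n * s ^ 2) ^ 2 := by
      rw [Top_add]; beta_reduce
      rw [Top_lin, Top_add, Top_const, Top_const]
    rw [e2] at a1
    have a2 := (abs_le.1 (eg s h0 h1 y).2.2).2
    have a3 : n * s ^ 2 * (Top e b s g y - g y) ≤ n * s ^ 2 * (K * s ^ 2) := by gcongr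
    change Top e b s (hseq e b s w g n) y + s ^ 2 * g y ≤ _
    have a4 : 0 ≤ K * s ^ 4 * (n + 1) := by positivity
    push_cast
    nlinarith

lemma iter_le (e : ι → F) (b : F) {s : ℝ} (h0 : 0 ≤ s) (h1 : s ≤ 1) {f : F → ℝ}
    {K : ℝ} (hK : 0 ≤ K) (ef : Est e b K f) (n : ℕ) (y : F) :
    (Top e b s)^[n] f y ≤ f y + n * s ^ 2 * Lop e b f y + (K * n * s ^ 3
      + K * (n * s ^ 2) ^ 2) := by
  induction n generalizing y with
  | zero => simp
  | succ n ih =>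
    rw [Function.iterate_succ_apply']
    have a1 := Top_mono e b s ih y
    rw [Top_add] at a1; beta_reduce at a1
    rw [Top_lin, Top_const] at a1
    have a2 := (abs_le.1 (ef s h0 h1 y).1).2
    have a3 := (abs_le.1 (ef s h0 h1 y).2.1).2
    have a4 : n * s ^ 2 * (Top e b s (Lop e b f) y - Lop e b f y) ≤ n * s ^ 2 * (K * s ^ 2) := by
      gcongr
    have a5 : 0 ≤ K * s ^ 4 * (n + 1) := by positivity
    push_cast
    nlinarith

end Walk2

section Walk3

open Metric Topology MeasureTheory
open scoped ContDiff Convolution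

variable {F : Type*} [NormedAddCommGroup F] [NormedSpace ℝ F] [FiniteDimensional ℝ F]
  {ι : Type*} [Fintype ι]

lemma walk_step (e : ι → F) (b : F) {W χ w g : F → ℝ} {y0 : F} {R c om B M G1 K1 K2 T0 : ℝ}
    (hR : 0 < R) (hWc : Continuous W)
    (hχ : ContDiff ℝ ∞ χ) (hw : ContDiff ℝ ∞ w) (hg : ContDiff ℝ ∞ g)
    (hv : ∀ φ : F → ℝ, ContDiff ℝ 2 φ → ∀ y ∈ ball y0 R,
      IsLocalMax (fun z => W z - φ z) y → -c ≤ Lop e b φ y)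
    (hgχ : ∀ y, g y = c + Lop e b χ y)
    (ew : Est e b K1 w) (eg : Est e b K2 g) (hK2 : 0 ≤ K2)
    (hG1 : ∀ y, |Lop e b g y| ≤ G1)
    (hWB : ∀ y, |W y| ≤ B) (hM : M = 4 * B + 10)
    (hχ0 : ∀ y, 0 ≤ χ y) (hχy : χ y0 = 0) (hχR : ∀ y, dist y y0 = R → χ y = M)
    (hwW : ∀ y, |W y - w y| ≤ om)
    {s : ℝ} (h0 : 0 ≤ s) (h1 : s ≤ 1) (n : ℕ)
    (hhB : ∀ k ≤ n, ∀ y, |hseq e b s w g k y| ≤ B + 2) (hn : n * s ^ 2 ≤ T0)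
    (y : F) (hy : y ∈ closedBall y0 R) :
    W y - χ y - hseq e b s w g n y ≤ om + n * (2 * (K1 + T0 * K2) + G1) * s ^ 3 := by
  induction n generalizing y with
  | zero =>
    have := (abs_le.1 (hwW y)).2
    simp only [hseq]
    have := hχ0 y
    norm_num
    linarith
  | succ k ih =>
    have hkn : k * s ^ 2 ≤ T0 := by
      push_cast at hn
      nlinarith [sq_nonneg s]
    have hC : ContDiff ℝ 2 (hseq e b s w g k) := (hseq_contDiff e b s hw hg k).of_le (by norm_cast)
    have hC1 : ContDiff ℝ 2 (hseq e b s w g (k+1)) :=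
      (hseq_contDiff e b s hw hg (k+1)).of_le (by norm_cast)
    have hg2 : ContDiff ℝ 2 g := hg.of_le (by norm_cast)
    have hχ2 : ContDiff ℝ 2 χ := hχ.of_le (by norm_cast)
    obtain ⟨y', hy', hmax⟩ := (isCompact_closedBall y0 R).exists_isMaxOn
      ⟨y0, mem_closedBall_self hR.le⟩
      (f := fun y => W y - χ y - hseq e b s w g (k+1) y)
      ((hWc.sub hχ.continuous).sub hC1.continuous).continuousOn
    have m0 : W y0 - χ y0 - hseq e b s w g (k+1) y0 ≤ W y' - χ y' - hseq e b s w g (k+1) y' :=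
      hmax (mem_closedBall_self hR.le)
    have hb : y' ∈ ball y0 R := by
      rcases lt_or_eq_of_le (mem_closedBall.1 hy') with h | h
      · exact mem_ball.2 h
      · exfalso
        rw [hχR y' h, hχy] at m0
        have a1 := abs_le.1 (hWB y0)
        have a2 := abs_le.1 (hWB y')
        have a3 := abs_le.1 (hhB (k+1) le_rfl y0)
        have a4 := abs_le.1 (hhB (k+1) le_rfl y')
        linarith [a1.1, a1.2, a2.1, a2.2, a3.1, a3.2, a4.1, a4.2]
    have hloc : IsLocalMax (fun z => W z - (χ z + hseq e b s w g (k+1) z)) y' := by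
      filter_upwards [isOpen_ball.mem_nhds hb] with z hz
      have : W z - χ z - hseq e b s w g (k+1) z ≤ W y' - χ y' - hseq e b s w g (k+1) y' :=
        hmax (ball_subset_closedBall hz)
      linarith
    have hL := hv _ (hχ2.add hC1) y' hb hloc
    have e3 : Lop e b (hseq e b s w g (k + 1)) y'
        = Top e b s (Lop e b (hseq e b s w g k)) y' + s ^ 2 * Lop e b g y' := by
      change Lop e b (fun z => Top e b s (hseq e b s w g k) z + s ^ 2 * g z) y' = _
      rw [Lop_add e b (Top_contDiff e b s hC) (contDiff_const.mul hg2),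
      Lop_smul e b _ hg2, Lop_Top e b s hC]
    rw [Lop_add e b hχ2 hC1, e3] at hL
    have er1 := (abs_le.1 (hseq_err1 e b h0 h1 hw hg ew eg k y')).1
    have er2 := (abs_le.1 (hseq_err2 e b h0 h1 hw hg ew eg k y')).2
    have g1 := (abs_le.1 (hG1 y')).2
    have hgy := hgχ y'
    have e4 : hseq e b s w g (k+1) y' = Top e b s (hseq e b s w g k) y' + s ^ 2 * g y' := rfl
    have hk := ih (fun j hj => hhB j (hj.trans (Nat.le_succ k))) hkn y' hy'
    have hmy : W y - χ y - hseq e b s w g (k+1) y ≤ W y' - χ y' - hseq e b s w g (k+1) y' :=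
      hmax hy
    set a := Lop e b (hseq e b s w g k) y'
    set Ta := Top e b s (Lop e b (hseq e b s w g k)) y'
    have KK : K1 + k * s ^ 2 * K2 ≤ K1 + T0 * K2 := by gcongr
    have s2 := sq_nonneg s
    have s3 : 0 ≤ s ^ 3 := by positivity
    have er1' : -((K1 + T0 * K2) * s ^ 3) ≤ Top e b s (hseq e b s w g k) y' - hseq e b s w g k y'
        - s ^ 2 * a := by
      have := mul_le_mul_of_nonneg_right KK s3
      linarith
    have er2' : Ta - a ≤ (K1 + T0 * K2) * s ^ 2 := by
      have := mul_le_mul_of_nonneg_right KK s2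
      linarith
    -- lower bound for a
    have la : -g y' - (K1 + T0 * K2 + G1) * s ^ 2 ≤ a := by
      have := mul_le_mul_of_nonneg_left g1 s2
      linarith
    have la2 := mul_le_mul_of_nonneg_left la s2
    have K1' : 0 ≤ (K1 + T0 * K2 + G1) * s ^ 2 := by
      have i1 : 0 ≤ G1 := (abs_nonneg _).trans (hG1 y')
      have i2 : 0 ≤ (K1 + k * s ^ 2 * K2) * s ^ 2 :=
        (abs_nonneg _).trans (hseq_err2 e b h0 h1 hw hg ew eg k y')
      have := mul_le_mul_of_nonneg_right KK s2
      have := mul_nonneg i1 s2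
      linarith
    have s43 : (K1 + T0 * K2 + G1) * s ^ 2 * s ^ 2 ≤ (K1 + T0 * K2 + G1) * s ^ 2 * s := by
      apply mul_le_mul_of_nonneg_left _ K1'
      nlinarith
    have key : - ((2 * (K1 + T0 * K2) + G1) * s ^ 3)
       ≤ hseq e b s w g (k+1) y' - hseq e b s w g k y' := by
      rw [e4]
      nlinarith
    push_cast
    linarith

lemma walk_compare (e : ι → F) (b : F) {W : F → ℝ} {y0 : F} {R c : ℝ}
    (hR : 0 < R) (hWc : Continuous W) (hWs : HasCompactSupport W)
    (hv : ∀ φ : F → ℝ, ContDiff ℝ 2 φ → ∀ y ∈ ball y0 R,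
      IsLocalMax (fun z => W z - φ z) y → -c ≤ Lop e b φ y) :
    ∃ K3 T0 : ℝ, 0 ≤ K3 ∧ 0 < T0 ∧ ∀ om : ℝ, 0 < om → om ≤ 1 → ∃ Ko : ℝ, 0 ≤ Ko ∧
      ∀ s : ℝ, 0 ≤ s → s ≤ 1 → ∀ n : ℕ, n * s ^ 2 ≤ T0 → ∀ y ∈ ball y0 (R / 2),
        W y ≤ (Top e b s)^[n] W y + 2 * om + n * s ^ 2 * c + K3 * (n * s ^ 2) ^ 2
          + Ko * (n * s ^ 3) := by
  obtain ⟨B, hB⟩ := hWs.exists_bound_of_continuous hWc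
  have hB' : ∀ y, |W y| ≤ B := fun y => (Real.norm_eq_abs _).symm.le.trans (hB y)
  have hB0 : 0 ≤ B := (norm_nonneg _).trans (hB 0)
  let f : ContDiffBump y0 := ⟨R / 2, R, by linarith, by linarith⟩
  set M : ℝ := 4 * B + 10 with hM
  have hM0 : 0 ≤ M := by positivity
  have hf : ContDiff ℝ ∞ (fun y => (-M) * f y) := contDiff_const.mul f.contDiff
  have hfc : HasCompactSupport (fun y => (-M) * f y) := f.hasCompactSupport.mul_left
  have hf2 : ContDiff ℝ 2 (fun y => (-M) * f y) := hf.of_le (by norm_cast)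
  let χ : F → ℝ := fun y => M + (-M) * f y
  have hχ : ContDiff ℝ ∞ χ := contDiff_const.add hf
  set g0 : F → ℝ := Lop e b (fun y => (-M) * f y) with hg0
  have hg0C : ContDiff ℝ ∞ g0 := Lop_contDiff e b hf
  have hg0c : HasCompactSupport g0 := Lop_compact e b hfc
  have hg02 : ContDiff ℝ 2 g0 := hg0C.of_le (by norm_cast)
  have hLχ : ∀ y, Lop e b χ y = g0 y := fun y => by
    change Lop e b (fun y => M + (-M) * f y) y = _
    rw [Lop_add e b contDiff_const hf2, Lop_const, zero_add]
  obtain ⟨G0, hG0⟩ := hg0c.exists_bound_of_continuous hg0C.continuous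
  have hG00 : 0 ≤ G0 := (norm_nonneg _).trans (hG0 0)
  obtain ⟨G1, hG1⟩ := (Lop_compact e b hg0c).exists_bound_of_continuous
    (Lop_contDiff e b hg0C).continuous
  obtain ⟨K2, hK2, eg0⟩ := est_compact e b hg0C hg0c
  have eg := est_const_add e b hg02 c K2 eg0
  set g : F → ℝ := fun y => c + g0 y with hg
  have hgC : ContDiff ℝ ∞ g := contDiff_const.add hg0C
  have hLg : ∀ y, |Lop e b g y| ≤ G1 := fun y => by
    change |Lop e b (fun y => c + g0 y) y| ≤ _
    rw [Lop_add e b contDiff_const hg02, Lop_const, zero_add]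
    exact (Real.norm_eq_abs _).symm.le.trans (hG1 y)
  set G : ℝ := |c| + G0 with hG
  have hGb : ∀ y, |g y| ≤ G := fun y =>
    (abs_add_le _ _).trans (add_le_add le_rfl ((Real.norm_eq_abs _).symm.le.trans (hG0 y)))
  have hGn : 0 ≤ G := by positivity
  refine ⟨K2, 1 / (G + 1), hK2, by positivity, fun om ho ho1 => ?_⟩
  obtain ⟨w, hw, hwd, hws⟩ := hWc.exists_contDiff_approx ⊤ (ε := fun _ => om) continuous_const
    (fun _ => ho)
  have hw' : ContDiff ℝ ∞ w := hw
  have hwc : HasCompactSupport w := hWs.mono hws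
  obtain ⟨K1, hK1, ew⟩ := est_compact e b hw' hwc
  have hwW : ∀ y, |W y - w y| ≤ om := fun y => by
    have := (hwd y).le
    rwa [Real.dist_eq, abs_sub_comm] at this
  set T0 := 1 / (G + 1) with hT0
  have hT0p : 0 < T0 := by positivity
  have hG1n : 0 ≤ G1 := (abs_nonneg _).trans (hLg 0)
  refine ⟨2 * (K1 + T0 * K2) + G1, by positivity, fun s h0 h1 n hn y hy => ?_⟩
  have hwB : ∀ y, |w y| ≤ B + 1 := fun y => by
    have a1 := abs_le.1 (hwW y); have a2 := abs_le.1 (hB' y)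
    exact abs_le.2 ⟨by linarith [a1.2, a2.1], by linarith [a1.1, a2.2]⟩
  have hTG : T0 * G ≤ 1 := by
    rw [hT0, div_mul_eq_mul_div, one_mul, div_le_one (by positivity)]; linarith
  have hhB : ∀ k ≤ n, ∀ y, |hseq e b s w g k y| ≤ B + 2 := fun k hk y => by
    have := hseq_bound e b s hwB hGb k y
    have hk' : (k : ℝ) * s ^ 2 * G ≤ n * s ^ 2 * G := by gcongr
    have : (n:ℝ) * s ^ 2 * G ≤ T0 * G := by gcongr
    linarith
  have hyc : y ∈ closedBall y0 R := by
    rw [mem_ball] at hy; rw [mem_closedBall]; linarith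
  have st := walk_step e b (W := W) (χ := χ) (w := w) (g := g) (y0 := y0) (R := R) (c := c)
    (om := om) (B := B) (M := M) (G1 := G1) (K1 := K1) (K2 := K2) (T0 := T0) hR hWc hχ hw' hgC
    hv (fun y => by rw [hLχ]) ew eg hK2 hLg hB' hM
    (fun y => by
      have : f y ≤ 1 := f.le_one
      change 0 ≤ M + (-M) * f y
      nlinarith)
    (by
      have : f y0 = 1 := f.one_of_mem_closedBall (mem_closedBall_self (by change 0 ≤ R/2; linarith))
      change M + (-M) * f y0 = 0
      rw [this]; ring)
    (fun y hy => by
      have : f y = 0 := f.zero_of_le_dist (by change R ≤ _; exact hy.ge)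
      change M + (-M) * f y = M
      rw [this]; ring) hwW h0 h1 n hhB hn y hyc
  have hf1 : f =ᶠ[𝓝 y] 1 := f.eventuallyEq_one_of_mem_ball hy
  have hχy : χ y = 0 := by
    change M + (-M) * f y = 0
    rw [hf1.self_of_nhds]; simp
  have hgy : g y = c := by
    have l1 : (fun y => (-M) * f y) =ᶠ[𝓝 y] fun _ => -M := by
      filter_upwards [hf1] with z hz
      rw [hz]; simp
    have l2 : fderiv ℝ (fun y => (-M) * f y) =ᶠ[𝓝 y] fun _ => 0 := by
      refine (l1.fderiv (𝕜 := ℝ)).trans (Eventually.of_forall fun y => by simp)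
    have l3 : fderiv ℝ (fderiv ℝ (fun y => (-M) * f y)) y = 0 := by
      rw [l2.fderiv_eq]; simp
    have : g0 y = 0 := by
      rw [hg0]
      simp only [Lop, l3, l2.self_of_nhds]
      simp
    simp [hg, this]
  have hle := hseq_le e b h0 h1 (w := w) (g := g) (W := W) (K := K2) (om := om) hK2 eg
    (fun y => by linarith [(abs_le.1 (hwW y)).1]) n y
  rw [hgy] at hle
  rw [hχy] at st
  nlinarith

end Walk3

section Walk4

open Metric Topology MeasureTheory
open scoped ContDiff Convolution

variable {F : Type*} [NormedAddCommGroup F] [NormedSpace ℝ F] [FiniteDimensional ℝ F]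
  {ι : Type*} [Fintype ι] [MeasurableSpace F] [BorelSpace F]

/-- Convolution. -/
def cv (μ : Measure F) (r W : F → ℝ) (y : F) : ℝ := ∫ t, r t * W (y - t) ∂μ

lemma cv_int (μ : Measure F) [μ.IsAddHaarMeasure] {r W : F → ℝ} (hr : Continuous r)
    (hrc : HasCompactSupport r) (hW : Continuous W) (y : F) :
    Integrable (fun t => r t * W (y - t)) μ :=
  Continuous.integrable_of_hasCompactSupport (by fun_prop) hrc.mul_right

lemma cv_Top (μ : Measure F) [μ.IsAddHaarMeasure] (e : ι → F) (b : F) (s : ℝ) {r W : F → ℝ}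
    (hr : Continuous r) (hrc : HasCompactSupport r) (hW : Continuous W) :
    Top e b s (cv μ r W) = cv μ r (Top e b s W) := by
  ext y
  have hi : ∀ a : F, Integrable (fun t => r t * W (y + a - t)) μ := fun a => cv_int μ hr hrc hW _
  unfold Top cv
  have : ∀ t, r t * ((W (y - t + (s ^ 2 * (Fintype.card ι + 1)) • b)
    + ∑ i, (W (y - t + (s * √(2 * (Fintype.card ι + 1))) • e i)
      + W (y - t + (-(s * √(2 * (Fintype.card ι + 1)))) • e i)) / 2) / (Fintype.card ι + 1))
      = (r t * W (y + (s ^ 2 * (Fintype.card ι + 1)) • b - t)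
    + ∑ i, (r t * W (y + (s * √(2 * (Fintype.card ι + 1))) • e i - t)
      + r t * W (y + (-(s * √(2 * (Fintype.card ι + 1)))) • e i - t)) / 2)
        / (Fintype.card ι + 1) := by
    intro t
    rw [mul_div_assoc', mul_add, Finset.mul_sum]
    simp only [sub_add_eq_add_sub, mul_add, mul_div_assoc']
  simp_rw [this]
  rw [integral_div, integral_add (hi _), integral_finsetSum]
  · congr 2
    refine Finset.sum_congr rfl fun i _ => ?_
    rw [integral_div, integral_add (hi _) (hi _)]
  · exact fun i _ => ((hi _).add (hi _)).div_const _
  · exact integrable_finsetSum _ fun i _ => ((hi _).add (hi _)).div_const _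

lemma Top_iter_continuous (e : ι → F) (b : F) (s : ℝ) {W : F → ℝ} (hW : Continuous W) (n : ℕ) :
    Continuous ((Top e b s)^[n] W) := by
  induction n with
  | zero => exact hW
  | succ n ih => rw [Function.iterate_succ_apply']; exact Top_continuous e b s ih

lemma cv_iter (μ : Measure F) [μ.IsAddHaarMeasure] (e : ι → F) (b : F) (s : ℝ) {r W : F → ℝ}
    (hr : Continuous r) (hrc : HasCompactSupport r) (hW : Continuous W) (n : ℕ) :
    (Top e b s)^[n] (cv μ r W) = cv μ r ((Top e b s)^[n] W) := by
  induction n with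
  | zero => rfl
  | succ n ih =>
    rw [Function.iterate_succ_apply', Function.iterate_succ_apply', ih,
      cv_Top μ e b s hr hrc (Top_iter_continuous e b s hW n)]

lemma cv_eq (μ : Measure F) (r W : F → ℝ) :
    cv μ r W = (r ⋆[ContinuousLinearMap.lsmul ℝ ℝ, μ] W : F → ℝ) := by
  ext y; simp [cv, convolution]

lemma cv_contDiff (μ : Measure F) [μ.IsAddHaarMeasure] {r W : F → ℝ} (hr : ContDiff ℝ ∞ r)
    (hrc : HasCompactSupport r) (hW : Continuous W) : ContDiff ℝ ∞ (cv μ r W) := by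
  rw [cv_eq]
  exact hrc.contDiff_convolution_left _ hr hW.locallyIntegrable

lemma cv_compact (μ : Measure F) [μ.IsAddHaarMeasure] {r W : F → ℝ}
    (hrc : HasCompactSupport r) (hWc : HasCompactSupport W) : HasCompactSupport (cv μ r W) := by
  rw [cv_eq]
  exact hrc.convolution _ hWc

/-- Mollification of viscosity subsolutions of a linear constant-coefficient inequality. -/
lemma moll_linear (μ : Measure F) [μ.IsAddHaarMeasure] (e : ι → F) (b : F) {W : F → ℝ} {y0 : F}
    {R c : ℝ} (hR : 0 < R) (hWc : Continuous W) (hWs : HasCompactSupport W)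
    (hv : ∀ φ : F → ℝ, ContDiff ℝ 2 φ → ∀ y ∈ ball y0 R,
      IsLocalMax (fun z => W z - φ z) y → -c ≤ Lop e b φ y)
    (r : F → ℝ) (hr : ContDiff ℝ ∞ r) (hr0 : ∀ t, 0 ≤ r t) (hri : ∫ t, r t ∂μ = 1)
    (hrs : HasCompactSupport r) (hrR : ∀ t, R / 2 ≤ ‖t‖ → r t = 0) :
    -c ≤ Lop e b (cv μ r W) y0 := by
  obtain ⟨K3, T0, hK3, hT0, hcomp⟩ := walk_compare e b hR hWc hWs hv
  obtain ⟨K, hK, eK⟩ := est_compact e b (cv_contDiff μ hr hrs hWc) (cv_compact μ hrs hWs)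
  set L := Lop e b (cv μ r W) y0 with hL
  have key : ∀ τ, 0 < τ → τ ≤ T0 → τ ≤ 1 → ∀ om, 0 < om → om ≤ 1 →
      0 ≤ τ * (L + c) + (K3 + K) * τ ^ 2 + 2 * om := by
    intro τ hτ hτ0 hτ1 om ho ho1
    obtain ⟨Ko, hKo, h⟩ := hcomp om ho ho1
    have lim : Tendsto (fun n : ℕ => τ * (L + c) + (K3 + K) * τ ^ 2 + 2 * om
        + (K + Ko) * (τ * √(τ / n))) atTop (𝓝 (τ * (L + c) + (K3 + K) * τ ^ 2 + 2 * om
        + (K + Ko) * (τ * √0))) := by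
      refine Tendsto.const_add _ (Tendsto.const_mul _ (Tendsto.const_mul _ ?_))
      exact (tendsto_const_div_atTop_nhds_zero_nat τ).sqrt
    rw [Real.sqrt_zero, mul_zero, mul_zero, add_zero] at lim
    refine ge_of_tendsto lim ?_
    filter_upwards [eventually_ge_atTop 1] with n hn
    have hn' : (1:ℝ) ≤ n := by exact_mod_cast hn
    set s := √(τ / n) with hs
    have hs0 : 0 ≤ s := Real.sqrt_nonneg _
    have hs2 : s ^ 2 = τ / n := Real.sq_sqrt (by positivity)
    have hns : n * s ^ 2 = τ := by rw [hs2]; field_simp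
    have hns3 : n * s ^ 3 = τ * s := by rw [← hns]; ring
    have hs1 : s ≤ 1 := by
      rw [hs, Real.sqrt_le_one]
      rw [div_le_one (by positivity)]; linarith
    have h1 := h s hs0 hs1 n (by rw [hns]; exact hτ0)
    have h2 := iter_le e b hs0 hs1 hK eK n y0
    rw [cv_iter μ e b s hr.continuous hrs hWc] at h2
    rw [hns, ← hL] at h2
    rw [hns, hns3] at h1
    set Q := (Top e b s)^[n] W with hQ
    have hQc : Continuous Q := Top_iter_continuous e b s hWc n
    set k := 2 * om + τ * c + K3 * τ ^ 2 + Ko * (τ * s) with hk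
    have h3 : cv μ r W y0 ≤ cv μ r Q y0 + k := by
      have ik : Integrable (fun t => r t * k) μ :=
        (hr.continuous.integrable_of_hasCompactSupport hrs).mul_const k
      have : ∫ t, r t * k ∂μ = k := by rw [integral_mul_const, hri, one_mul]
      rw [← this, cv, cv, ← integral_add (cv_int μ hr.continuous hrs hQc y0) ik]
      refine integral_mono (cv_int μ hr.continuous hrs hWc y0)
        ((cv_int μ hr.continuous hrs hQc y0).add ik) fun t => ?_
      change r t * W (y0 - t) ≤ r t * Q (y0 - t) + r t * k
      by_cases ht : R / 2 ≤ ‖t‖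
      · simp [hrR t ht]
      · rw [← mul_add]
        refine mul_le_mul_of_nonneg_left ?_ (hr0 t)
        have := h1 (y0 - t) (by rw [mem_ball, dist_eq_norm]; simpa using ht)
        linarith
    have e3 : K * n * s ^ 3 = K * (τ * s) := by rw [← hns3]; ring
    rw [e3] at h2
    nlinarith
  have key2 : ∀ τ, 0 < τ → τ ≤ T0 → τ ≤ 1 → 0 ≤ (L + c) + (K3 + K) * τ := by
    intro τ hτ hτ0 hτ1
    have : 0 ≤ τ * (L + c) + (K3 + K) * τ ^ 2 := by
      refine le_of_forall_pos_le_add fun ε hε => ?_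
      have := key τ hτ hτ0 hτ1 (min (ε / 2) 1) (by positivity) (min_le_right _ _)
      have := min_le_left (ε / 2) 1
      linarith
    by_contra hneg
    push Not at hneg
    nlinarith
  have : 0 ≤ L + c := by
    refine le_of_forall_pos_le_add fun ε hε => ?_
    set τ := min (min T0 1) (ε / (K3 + K + 1)) with hτ
    have h1 := key2 τ (by positivity) ((min_le_left _ _).trans (min_le_left _ _))
      ((min_le_left _ _).trans (min_le_right _ _))
    have h2 : τ ≤ ε / (K3 + K + 1) := min_le_right _ _
    have h3 : (K3 + K + 1) * τ ≤ ε := by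
      rw [le_div_iff₀ (by positivity)] at h2; linarith
    have : 0 < τ := by positivity
    linarith
  linarith

end Walk4

section Calc5

open Metric Topology MeasureTheory
open scoped ContDiff

lemma line_deriv2 {G : Type*} [NormedAddCommGroup G] [NormedSpace ℝ G] {ψ : G → ℝ}
    (h : ContDiff ℝ 2 ψ) (q v : G) (s : ℝ) :
    HasDerivAt (fun s : ℝ => fderiv ℝ ψ (q + s • v) v)
      (fderiv ℝ (fderiv ℝ ψ) (q + s • v) v v) s := by
  have h1 : Differentiable ℝ (fderiv ℝ ψ) :=
    (h.fderiv_right (m := 1) (by norm_num)).differentiable (by norm_num)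
  have hline : HasDerivAt (fun s : ℝ => q + s • v) v s := by
    simpa using ((hasDerivAt_id s).smul_const v).const_add q
  have h2 := (h1 (q + s • v)).hasFDerivAt.comp_hasDerivAt s hline
  have h3 := h2.clm_apply (hasDerivAt_const s v)
  simpa using h3

lemma poly_deriv (a b c s : ℝ) : HasDerivAt (fun s : ℝ => a + b * s + c * s ^ 2)
    (b + 2 * c * s) s := by
  have h1 : HasDerivAt (fun s : ℝ => a + b * s) b s := by
    simpa using ((hasDerivAt_id s).const_mul b).const_add a
  have h2 := (hasDerivAt_pow 2 s).const_mul c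
  refine (h1.fun_add h2).congr_deriv ?_
  norm_num; ring

lemma line_full {G : Type*} [NormedAddCommGroup G] [NormedSpace ℝ G] {ψ : G → ℝ}
    (h : ContDiff ℝ 2 ψ) (q v : G) (a b c : ℝ) :
    deriv (fun s : ℝ => ψ (q + s • v) + (a + b * s + c * s ^ 2)) 0 = fderiv ℝ ψ q v + b ∧
    deriv (deriv (fun s : ℝ => ψ (q + s • v) + (a + b * s + c * s ^ 2))) 0
      = fderiv ℝ (fderiv ℝ ψ) q v v + 2 * c := by
  have h1 : ∀ s : ℝ, HasDerivAt (fun s : ℝ => ψ (q + s • v) + (a + b * s + c * s ^ 2))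
      (fderiv ℝ ψ (q + s • v) v + (b + 2 * c * s)) s := fun s =>
    (lineDeriv' (h.differentiable (by norm_num)) q v s).add (poly_deriv a b c s)
  have h2 : deriv (fun s : ℝ => ψ (q + s • v) + (a + b * s + c * s ^ 2))
    = fun s => fderiv ℝ ψ (q + s • v) v + (b + 2 * c * s) := funext fun s => (h1 s).deriv
  refine ⟨by rw [h2]; simp, ?_⟩
  rw [h2]
  have h3 : HasDerivAt (fun s : ℝ => b + 2 * c * s) (2 * c) 0 := by
    simpa using ((hasDerivAt_id (0:ℝ)).const_mul (2 * c)).const_add b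
  have := (line_deriv2 h q v 0).fun_add h3
  simpa using this.deriv

lemma line_poly {G G' : Type*} [NormedAddCommGroup G] [NormedSpace ℝ G]
    [NormedAddCommGroup G'] [NormedSpace ℝ G'] {ψ : G → ℝ} {Ψ : G' → ℝ}
    (h : ContDiff ℝ 2 ψ) (h' : ContDiff ℝ 2 Ψ) (q v : G) (q' v' : G') (a b c : ℝ)
    (heq : ∀ s : ℝ, Ψ (q' + s • v') = ψ (q + s • v) + (a + b * s + c * s ^ 2)) :
    fderiv ℝ Ψ q' v' = fderiv ℝ ψ q v + b ∧
    fderiv ℝ (fderiv ℝ Ψ) q' v' v' = fderiv ℝ (fderiv ℝ ψ) q v v + 2 * c := by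
  obtain ⟨a1, a2⟩ := line_full h q v a b c
  obtain ⟨b1, b2⟩ := line_full h' q' v' 0 0 0
  have : (fun s : ℝ => Ψ (q' + s • v') + (0 + 0 * s + 0 * s ^ 2))
    = fun s : ℝ => ψ (q + s • v) + (a + b * s + c * s ^ 2) := by
    ext s; rw [heq]; ring
  rw [this] at b1 b2
  constructor
  · rw [← a1, b1]; ring
  · rw [← a2, b2]; ring

lemma second_order {G : Type*} [NormedAddCommGroup G] [NormedSpace ℝ G] {ψ : G → ℝ}
    (h : ContDiff ℝ 2 ψ) (q v : G) (a b c : ℝ)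
    (hm : IsLocalMin (fun s : ℝ => ψ (q + s • v) + (a + b * s + c * s ^ 2)) 0) :
    fderiv ℝ ψ q v + b = 0 ∧ 0 ≤ fderiv ℝ (fderiv ℝ ψ) q v v + 2 * c := by
  obtain ⟨a1, a2⟩ := line_full h q v a b c
  have hd := hm.deriv_eq_zero
  refine ⟨a1.symm.trans hd, ?_⟩
  by_contra hneg
  push Not at hneg
  rw [← a2] at hneg
  have hcont : Continuous (fun s : ℝ => ψ (q + s • v) + (a + b * s + c * s ^ 2)) := by
    have := h.continuous
    fun_prop
  have hmax := isLocalMax_of_deriv_deriv_neg hneg hd hcont.continuousAt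
  have hconst : (fun s : ℝ => ψ (q + s • v) + (a + b * s + c * s ^ 2)) =ᶠ[𝓝 0]
      fun _ => ψ (q + (0:ℝ) • v) + (a + b * 0 + c * 0 ^ 2) := by
    filter_upwards [hm, hmax] with s h1 h2
    exact le_antisymm h2 h1
  have h3 := hconst.deriv.deriv_eq
  simp at h3
  rw [h3] at hneg
  exact lt_irrefl _ hneg

variable {V : Type*} [NormedAddCommGroup V] [InnerProductSpace ℝ V] [FiniteDimensional ℝ V]
  [CompleteSpace V]

/-- spatial gradient -/
def gx (φ : V × ℝ → ℝ) (q : V × ℝ) : V :=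
  (InnerProductSpace.toDual ℝ V).symm ((fderiv ℝ φ q).comp (ContinuousLinearMap.inl ℝ V ℝ))

lemma gx_inner (φ : V × ℝ → ℝ) (q : V × ℝ) (z : V) : inner ℝ (gx φ q) z = fderiv ℝ φ q (z, 0) := by
  unfold gx
  rw [InnerProductSpace.toDual_symm_apply]
  simp

/-- time derivative -/
def Dt (φ : V × ℝ → ℝ) (q : V × ℝ) : ℝ := fderiv ℝ φ q (0, 1)

/-- second derivative in space -/
def D2 (φ : V × ℝ → ℝ) (q : V × ℝ) (z : V) : ℝ := fderiv ℝ (fderiv ℝ φ) q (z, 0) (z, 0)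

variable {Θ : Type*} {ι : Type*} [Fintype ι]

/-- subsolution in product form -/
def VSub (S : Θ → V → ι → V) (H : Θ → V → V → ℝ) (w : V × ℝ → ℝ) : Prop :=
  ∀ φ : V × ℝ → ℝ, ContDiff ℝ 2 φ → ∀ q : V × ℝ, 0 < q.2 → IsLocalMax (fun z => w z - φ z) q →
    ∀ θ, Dt φ q - ∑ i, D2 φ q (S θ q.1 i) + H θ q.1 (gx φ q) ≤ 0

lemma optM {ε β : ℝ} (hε : 0 < ε) (hβ : 0 < β) (Y : V →L[ℝ] V →L[ℝ] ℝ)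
    (hsym : ∀ a b, Y a b = Y b a) (hco : ∀ z, β * ‖z‖ ^ 2 ≤ ‖z‖ ^ 2 / ε + Y z z) :
    ∃ M : V →ₗ[ℝ] V, ∀ ξ ζ, Y (M ξ) (M ξ) + ‖ξ - M ξ‖ ^ 2 / ε ≤ Y ζ ζ + ‖ξ - ζ‖ ^ 2 / ε := by
  let T : V →ₗ[ℝ] V := (1 / ε) • LinearMap.id +
    ((InnerProductSpace.toDual ℝ V).symm.toLinearEquiv.toLinearMap).comp Y.toLinearMap
  have hT : ∀ a b, inner ℝ (T a) b = inner ℝ a b / ε + Y a b := fun a b => by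
    simp [T, inner_add_left, inner_smul_left]
    ring
  have hinj : Function.Injective T := by
    rw [injective_iff_map_eq_zero]
    intro a ha
    have := hT a a
    rw [ha, inner_zero_left, real_inner_self_eq_norm_sq] at this
    have h2 := hco a
    rw [← this] at h2
    have : ‖a‖ ^ 2 ≤ 0 := by nlinarith
    simpa using this
  let Te := LinearEquiv.ofInjectiveEndo T hinj
  refine ⟨(1 / ε) • Te.symm.toLinearMap, fun ξ ζ => ?_⟩
  set m : V := ((1 / ε) • Te.symm.toLinearMap) ξ with hm
  have hTm : T m = (1 / ε) • ξ := by
    have : m = (1 / ε) • Te.symm ξ := rfl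
    rw [this, map_smul]
    congr 1
    exact Te.apply_symm_apply ξ
  have hmd : ∀ d, inner ℝ m d / ε + Y m d = inner ℝ ξ d / ε := fun d => by
    rw [← hT, hTm, inner_smul_left]; simp; ring
  obtain ⟨d, rfl⟩ : ∃ d, ζ = m + d := ⟨ζ - m, by simp⟩
  have e1 : Y (m + d) (m + d) = Y m m + 2 * Y m d + Y d d := by
    simp only [map_add, add_apply]; rw [hsym d m]; ring
  have e2 : ‖ξ - (m + d)‖ ^ 2 = ‖ξ - m‖ ^ 2 - 2 * (inner ℝ ξ d - inner ℝ m d) + ‖d‖ ^ 2 := by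
    rw [← sub_sub, norm_sub_sq_real, inner_sub_left]
  have h3 := hco d
  have h4 := hmd d
  rw [e1, e2]
  have h5 : 0 ≤ β * ‖d‖ ^ 2 := by positivity
  have e3 : (‖ξ - m‖ ^ 2 - 2 * (inner ℝ ξ d - inner ℝ m d) + ‖d‖ ^ 2) / ε
     = ‖ξ - m‖ ^ 2 / ε - 2 * (inner ℝ ξ d / ε - inner ℝ m d / ε) + ‖d‖ ^ 2 / ε := by
    field_simp
  rw [e3]
  linarith

end Calc5

section Calc6

open Metric Topology MeasureTheory
open scoped ContDiff

variable {V : Type*} [NormedAddCommGroup V] [InnerProductSpace ℝ V] [FiniteDimensional ℝ V]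
  [CompleteSpace V] {Θ : Type*} {ι : Type*} [Fintype ι]

lemma nsq_line (d z : V) (s k : ℝ) :
    ‖d - s • z‖ ^ 2 / k = ‖d‖ ^ 2 / k + (-(2 * inner ℝ d z / k)) * s + (‖z‖ ^ 2 / k) * s ^ 2 := by
  rw [norm_sub_sq_real, inner_smul_right, norm_smul, mul_pow, Real.norm_eq_abs, sq_abs]
  ring

lemma doubling_beta (S : Θ → V → ι → V) (H : Θ → V → V → ℝ) {w ψ : V × ℝ → ℝ}
    (hw : VSub S H w) (hψ : ContDiff ℝ 2 ψ) {ε : ℝ} (hε : 0 < ε) {xs y1 : V} {t1 : ℝ}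
    (ht : 0 < t1)
    (hm : IsLocalMax (fun p : V × V × ℝ => w (p.1, p.2.2) - ‖p.1 - p.2.1‖ ^ 2 / (2 * ε)
      - ψ p.2) (xs, y1, t1)) :
    gx ψ (y1, t1) = (1 / ε) • (xs - y1) ∧ ∀ β : ℝ, 0 < β → ∀ θ, ∀ ζ : ι → V,
      Dt ψ (y1, t1) - ∑ i, (D2 ψ (y1, t1) (ζ i) + β * ‖ζ i‖ ^ 2)
        + H θ xs ((1 / ε) • (xs - y1)) ≤ ∑ i, ‖S θ xs i - ζ i‖ ^ 2 / ε := by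
  have hA : ∀ z : V, fderiv ℝ ψ (y1, t1) (z, 0) + (-(2 * inner ℝ (xs - y1) z / (2 * ε))) = 0 ∧
      0 ≤ fderiv ℝ (fderiv ℝ ψ) (y1, t1) (z, 0) (z, 0) + 2 * (‖z‖ ^ 2 / (2 * ε)) := by
    intro z
    refine second_order hψ (y1, t1) (z, 0) (‖xs - y1‖ ^ 2 / (2 * ε)) _ _ ?_
    have hc : Continuous (fun s : ℝ => ((xs, y1 + s • z, t1) : V × V × ℝ)) := by fun_prop
    have hc0 : Tendsto (fun s : ℝ => ((xs, y1 + s • z, t1) : V × V × ℝ)) (𝓝 0)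
        (𝓝 (xs, y1, t1)) := by
      have := hc.tendsto 0; simpa using this
    filter_upwards [hc0.eventually hm] with s hs
    rw [← nsq_line, ← nsq_line]
    have e1 : xs - y1 - s • z = xs - (y1 + s • z) := by abel
    have e2 : ((y1, t1) : V × ℝ) + s • ((z, 0) : V × ℝ) = (y1 + s • z, t1) := by simp
    rw [e1, e2]
    simp only [zero_smul, add_zero, sub_zero]
    linarith
  have hg : gx ψ (y1, t1) = (1 / ε) • (xs - y1) := by
    refine ext_inner_right ℝ fun z => ?_
    rw [gx_inner, inner_smul_left]
    have := (hA z).1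
    have e : 2 * inner ℝ (xs - y1) z / (2 * ε) = 1 / ε * inner ℝ (xs - y1) z := by field_simp
    rw [e] at this
    simp; simp at this; linarith
  refine ⟨hg, fun β hβ θ ζ => ?_⟩
  set ψb : V × ℝ → ℝ := fun q => ψ q + β / 2 * ‖q.1 - y1‖ ^ 2 with hψb
  have hψbC : ContDiff ℝ 2 ψb := by
    refine hψ.add (contDiff_const.mul ?_)
    exact ContDiff.norm_sq ℝ (contDiff_fst.sub contDiff_const)
  have hD2 : ∀ z : V, fderiv ℝ ψb (y1, t1) (z, 0) = fderiv ℝ ψ (y1, t1) (z, 0) + 0 ∧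
      fderiv ℝ (fderiv ℝ ψb) (y1, t1) (z, 0) (z, 0)
        = fderiv ℝ (fderiv ℝ ψ) (y1, t1) (z, 0) (z, 0) + 2 * (β / 2 * ‖z‖ ^ 2) := fun z => by
    refine line_poly hψ hψbC (y1, t1) (z, 0) (y1, t1) (z, 0) 0 0 _ fun s => ?_
    simp only [hψb]
    congr 1
    simp only [Prod.fst_add, Prod.smul_fst, add_sub_cancel_left, norm_smul, mul_pow,
      Real.norm_eq_abs, sq_abs]
    ring
  have hDt : fderiv ℝ ψb (y1, t1) (0, 1) = fderiv ℝ ψ (y1, t1) (0, 1) + 0 := by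
    refine (line_poly hψ hψbC (y1, t1) (0, 1) (y1, t1) (0, 1) 0 0 0 fun s => ?_).1
    simp [hψb]
  let Y : V →L[ℝ] V →L[ℝ] ℝ := (fderiv ℝ (fderiv ℝ ψb) (y1, t1)).bilinearComp
    (ContinuousLinearMap.inl ℝ V ℝ) (ContinuousLinearMap.inl ℝ V ℝ)
  have hY : ∀ a b, Y a b = fderiv ℝ (fderiv ℝ ψb) (y1, t1) (a, 0) (b, 0) := fun a b => by
    simp [Y]
  have hYs : ∀ a b, Y a b = Y b a := fun a b => by
    rw [hY, hY]
    exact (hψbC.contDiffAt.isSymmSndFDerivAt (by simp)) _ _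
  have hco : ∀ z, β * ‖z‖ ^ 2 ≤ ‖z‖ ^ 2 / ε + Y z z := fun z => by
    rw [hY, (hD2 z).2]
    have := (hA z).2
    have e : 2 * (‖z‖ ^ 2 / (2 * ε)) = ‖z‖ ^ 2 / ε := by field_simp
    linarith
  obtain ⟨M, hM⟩ := optM hε hβ Y hYs hco
  let Mc : V →L[ℝ] V := LinearMap.toContinuousLinearMap M
  have hMc : ∀ z, Mc z = M z := fun z => rfl
  set Ψ : V × ℝ → ℝ := fun q => ψb (y1 + Mc (q.1 - xs), q.2)
    + ‖q.1 - (y1 + Mc (q.1 - xs))‖ ^ 2 / (2 * ε) with hΨ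
  have hΨC : ContDiff ℝ 2 Ψ := by
    refine ContDiff.add (hψbC.comp ?_) (ContDiff.div_const (ContDiff.norm_sq ℝ ?_) _)
    · fun_prop
    · fun_prop
  have hmax : IsLocalMax (fun q => w q - Ψ q) (xs, t1) := by
    have hc : Continuous (fun q : V × ℝ => ((q.1, y1 + Mc (q.1 - xs), q.2) : V × V × ℝ)) := by
      fun_prop
    have hc0 : Tendsto (fun q : V × ℝ => ((q.1, y1 + Mc (q.1 - xs), q.2) : V × V × ℝ))
        (𝓝 (xs, t1)) (𝓝 (xs, y1, t1)) := by
      have := hc.tendsto (xs, t1); simpa using this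
    filter_upwards [hc0.eventually hm] with q hq
    simp only [hΨ, hψb]
    have : 0 ≤ β / 2 * ‖y1 + Mc (q.1 - xs) - y1‖ ^ 2 := by positivity
    simp only [sub_self, map_zero, add_zero, norm_zero]
    have e0 : β / 2 * (0:ℝ) ^ 2 = 0 := by norm_num
    rw [e0, add_zero]
    have e1 : w (q.1, q.2) = w q := rfl
    rw [e1] at hq
    linarith
  have hsub := hw Ψ hΨC (xs, t1) ht hmax θ
  have hlin : ∀ z : V, fderiv ℝ Ψ (xs, t1) (z, 0) = fderiv ℝ ψb (y1, t1) (Mc z, 0)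
        + (-(2 * inner ℝ (xs - y1) (Mc z - z) / (2 * ε))) ∧
      fderiv ℝ (fderiv ℝ Ψ) (xs, t1) (z, 0) (z, 0)
        = fderiv ℝ (fderiv ℝ ψb) (y1, t1) (Mc z, 0) (Mc z, 0)
          + 2 * (‖Mc z - z‖ ^ 2 / (2 * ε)) := fun z => by
    refine line_poly hψbC hΨC (y1, t1) (Mc z, 0) (xs, t1) (z, 0) (‖xs - y1‖ ^ 2 / (2 * ε)) _ _
      fun s => ?_
    rw [← nsq_line]
    simp only [hΨ]
    have e1 : xs + s • z - xs = s • z := by abel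
    simp only [Prod.fst_add, Prod.smul_fst, Prod.snd_add, Prod.smul_snd, e1, map_smul]
    have e2 : xs + s • z - (y1 + s • Mc z) = xs - y1 - s • (Mc z - z) := by
      rw [smul_sub]; abel
    have e3 : ((y1, t1) : V × ℝ) + s • ((Mc z, 0) : V × ℝ) = (y1 + s • Mc z, t1 + s • 0) := rfl
    rw [e2, e3]
  have hDt2 : fderiv ℝ Ψ (xs, t1) (0, 1) = fderiv ℝ ψb (y1, t1) (0, 1) + 0 := by
    refine (line_poly hψbC hΨC (y1, t1) (0, 1) (xs, t1) (0, 1) (‖xs - y1‖ ^ 2 / (2 * ε)) 0 0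
      fun s => ?_).1
    simp [hΨ]
  have hgΨ : gx Ψ (xs, t1) = (1 / ε) • (xs - y1) := by
    refine ext_inner_right ℝ fun z => ?_
    rw [gx_inner, (hlin z).1, (hD2 (Mc z)).1, ← gx_inner, hg, inner_smul_left, inner_smul_left,
      inner_sub_right]
    simp
    field_simp
    ring
  rw [hgΨ] at hsub
  have hDtt : Dt Ψ (xs, t1) = Dt ψ (y1, t1) := by
    unfold Dt; rw [hDt2, hDt]; ring
  rw [hDtt] at hsub
  have hsum : ∑ i, D2 Ψ (xs, t1) (S θ xs i)
      ≤ ∑ i, (D2 ψ (y1, t1) (ζ i) + β * ‖ζ i‖ ^ 2) + ∑ i, ‖S θ xs i - ζ i‖ ^ 2 / ε := by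
    rw [← Finset.sum_add_distrib]
    refine Finset.sum_le_sum fun i _ => ?_
    have h1 := hM (S θ xs i) (ζ i)
    rw [hY, hY, (hD2 (ζ i)).2, ← hMc] at h1
    unfold D2
    rw [(hlin _).2]
    rw [norm_sub_rev (Mc _)]
    have e : 2 * (‖S θ xs i - Mc (S θ xs i)‖ ^ 2 / (2 * ε))
      = ‖S θ xs i - Mc (S θ xs i)‖ ^ 2 / ε := by field_simp
    rw [e]
    linarith
  linarith

lemma doubling (S : Θ → V → ι → V) (H : Θ → V → V → ℝ) {w ψ : V × ℝ → ℝ}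
    (hw : VSub S H w) (hψ : ContDiff ℝ 2 ψ) {ε : ℝ} (hε : 0 < ε) {xs y1 : V} {t1 : ℝ}
    (ht : 0 < t1)
    (hm : IsLocalMax (fun p : V × V × ℝ => w (p.1, p.2.2) - ‖p.1 - p.2.1‖ ^ 2 / (2 * ε)
      - ψ p.2) (xs, y1, t1)) :
    gx ψ (y1, t1) = (1 / ε) • (xs - y1) ∧ ∀ θ, ∀ ζ : ι → V,
      Dt ψ (y1, t1) - ∑ i, D2 ψ (y1, t1) (ζ i)
        + H θ xs ((1 / ε) • (xs - y1)) ≤ ∑ i, ‖S θ xs i - ζ i‖ ^ 2 / ε := by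
  obtain ⟨h1, h2⟩ := doubling_beta S H hw hψ hε ht hm
  refine ⟨h1, fun θ ζ => le_of_forall_pos_le_add fun a ha => ?_⟩
  set Z := ∑ i, ‖ζ i‖ ^ 2 with hZ
  have hZ0 : 0 ≤ Z := Finset.sum_nonneg fun i _ => by positivity
  have h3 := h2 (a / (Z + 1)) (by positivity) θ ζ
  rw [Finset.sum_add_distrib, ← Finset.mul_sum, ← hZ] at h3
  have : a / (Z + 1) * Z ≤ a := by
    rw [div_mul_eq_mul_div, div_le_iff₀ (by positivity)]; nlinarith
  linarith

end Calc6

section Sup7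

open Metric Topology MeasureTheory
open scoped ContDiff

variable {V : Type*} [NormedAddCommGroup V] [InnerProductSpace ℝ V] [FiniteDimensional ℝ V]
  [CompleteSpace V] {Θ : Type*} {ι : Type*} [Fintype ι]

lemma supconv (S : Θ → V → ι → V) (H : Θ → V → V → ℝ) {w : V × ℝ → ℝ} {L : ℝ} (hL : 0 ≤ L)
    (hwc : Continuous w) (hwL : ∀ x y t, w (x, t) ≤ w (y, t) + L * ‖x - y‖)
    (hw : VSub S H w) {ε : ℝ} (hε : 0 < ε) :
    ∃ W : V × ℝ → ℝ, Continuous W ∧ (∀ x y t, W (x, t) ≤ W (y, t) + L * ‖x - y‖) ∧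
      (∀ q, w q ≤ W q ∧ W q ≤ w q + 2 * L ^ 2 * ε) ∧
      ∀ φ : V × ℝ → ℝ, ContDiff ℝ 2 φ → ∀ q : V × ℝ, 0 < q.2 → IsLocalMax (fun z => W z - φ z) q →
        ∃ xs : V, ‖xs - q.1‖ ≤ 2 * L * ε ∧ ‖gx φ q‖ ≤ 2 * L ∧ ∀ θ, ∀ ζ : ι → V,
          Dt φ q - ∑ i, D2 φ q (ζ i) + H θ xs (gx φ q) ≤ ∑ i, ‖S θ xs i - ζ i‖ ^ 2 / ε := by
  set r : ℝ := (2 * L + 1) * ε with hr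
  have hr0 : 0 < r := by positivity
  let f : V × ℝ → V → ℝ := fun q z => w (q.1 + z, q.2) - ‖z‖ ^ 2 / (2 * ε)
  have hf : Continuous (fun p : (V × ℝ) × V => f p.1 p.2) := by fun_prop
  set W : V × ℝ → ℝ := fun q => sSup (f q '' closedBall (0:V) r) with hW
  have hK := isCompact_closedBall (0:V) r
  have hne : (closedBall (0:V) r).Nonempty := ⟨0, mem_closedBall_self hr0.le⟩
  have hfq : ∀ q, Continuous (f q) := fun q => hf.comp (Continuous.prodMk_right q)
  have hWc : Continuous W := hK.continuous_sSup hf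
  have hle : ∀ q z, ‖z‖ ≤ r → f q z ≤ W q := fun q z hz =>
    le_csSup (hK.bddAbove_image (hfq q).continuousOn) ⟨z, by simpa using hz, rfl⟩
  have hat : ∀ q, ∃ z, ‖z‖ ≤ 2 * L * ε ∧ W q = f q z := fun q => by
    obtain ⟨z, hz, hzW⟩ := hK.exists_sSup_image_eq hne (hfq q).continuousOn
    refine ⟨z, ?_, hzW⟩
    have h1 := hle q 0 (by simpa using hr0.le)
    rw [show W q = f q z from hzW] at h1
    simp only [f, norm_zero, add_zero] at h1
    have h2 := hwL (q.1 + z) q.1 q.2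
    rw [add_sub_cancel_left] at h2
    have h3 : ‖z‖ ^ 2 / (2 * ε) ≤ L * ‖z‖ := by norm_num at h1; linarith
    rw [div_le_iff₀ (by positivity)] at h3
    by_contra hlt
    push Not at hlt
    have : 0 ≤ 2 * L * ε := by positivity
    nlinarith
  have h2r : 2 * L * ε < r := by rw [hr]; linarith
  refine ⟨W, hWc, fun x y t => ?_, fun q => ⟨?_, ?_⟩, fun φ hφ q hq hm => ?_⟩
  · obtain ⟨z, hz, e⟩ := hat (x, t)
    have h1 := hle (y, t) z (hz.trans h2r.le)
    rw [e]
    simp only [f] at h1 ⊢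
    have h2 := hwL (x + z) (y + z) t
    rw [add_sub_add_right_eq_sub] at h2
    linarith
  · have h1 := hle q 0 (by simpa using hr0.le)
    simpa [f] using h1
  · obtain ⟨z, hz, e⟩ := hat q
    rw [e]
    simp only [f]
    have h2 := hwL (q.1 + z) q.1 q.2
    rw [add_sub_cancel_left] at h2
    have : 0 ≤ ‖z‖ ^ 2 / (2 * ε) := by positivity
    have : L * ‖z‖ ≤ L * (2 * L * ε) := by gcongr
    have e1 : w (q.1, q.2) = w q := rfl
    nlinarith
  · obtain ⟨z, hz, e⟩ := hat q
    obtain ⟨y1, t1⟩ := q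
    have hmax : IsLocalMax (fun p : V × V × ℝ => w (p.1, p.2.2) - ‖p.1 - p.2.1‖ ^ 2 / (2 * ε)
        - φ p.2) (y1 + z, y1, t1) := by
      have t1' : Tendsto (fun p : V × V × ℝ => p.2) (𝓝 (y1 + z, y1, t1)) (𝓝 (y1, t1)) :=
        continuous_snd.tendsto _
      have hc : Continuous (fun p : V × V × ℝ => ‖p.1 - p.2.1‖) := by fun_prop
      have t2 : ∀ᶠ p : V × V × ℝ in 𝓝 (y1 + z, y1, t1), ‖p.1 - p.2.1‖ < r := by
        refine hc.continuousAt.eventually_lt continuousAt_const ?_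
        simpa using hz.trans_lt h2r
      filter_upwards [t1'.eventually hm, t2] with p h1 h2
      have h3 := hle p.2 (p.1 - p.2.1) h2.le
      simp only [f, add_sub_cancel] at h3
      rw [e] at h1
      simp only [f] at h1
      simp only [add_sub_cancel_left]
      linarith
    obtain ⟨h1, h2⟩ := doubling S H hw hφ hε hq hmax
    refine ⟨y1 + z, by simpa using hz, ?_, ?_⟩
    · rw [h1, add_sub_cancel_left, norm_smul, Real.norm_eq_abs, abs_of_pos (by positivity)]
      rw [one_div, inv_mul_le_iff₀ hε]
      linarith
    · intro θ ζ
      rw [h1]; exact h2 θ ζ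

end Sup7

section Smooth8

open Metric Topology MeasureTheory
open scoped ContDiff

variable {V : Type*} [NormedAddCommGroup V] [InnerProductSpace ℝ V] [FiniteDimensional ℝ V]
  [CompleteSpace V] {Θ : Type*} {ι : Type*} [Fintype ι]

lemma gx_le {U : V × ℝ → ℝ} {q : V × ℝ} (hU : DifferentiableAt ℝ U q) {L : ℝ}
    (h : ∀ z : V, ∀ᶠ s in 𝓝[>] (0:ℝ), U (q + s • (z, (0:ℝ))) - U q ≤ L * ‖z‖ * s) :
    ‖gx U q‖ ≤ L ∨ gx U q = 0 := by
  set g := gx U q with hg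
  by_cases h0 : g = 0
  · exact Or.inr h0
  left
  have h1 : HasDerivAt (fun s : ℝ => U (q + s • (g, (0:ℝ)))) (fderiv ℝ U q (g, 0)) 0 :=
    hU.hasFDerivAt.hasLineDerivAt (g, (0:ℝ))
  have h2 := h1.tendsto_slope_zero_right
  have h3 : fderiv ℝ U q (g, 0) ≤ L * ‖g‖ := by
    refine le_of_tendsto h2 ?_
    filter_upwards [h g, self_mem_nhdsWithin] with s hs hs0
    have hs0 : 0 < s := hs0
    simp only [zero_add, zero_smul, add_zero, smul_eq_mul]
    rw [inv_mul_le_iff₀ hs0]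
    linarith
  rw [← gx_inner, ← hg, real_inner_self_eq_norm_sq] at h3
  have : 0 < ‖g‖ := norm_pos_iff.2 h0
  nlinarith

lemma smooth_sub (S : Θ → V → ι → V) (H : Θ → V → V → ℝ) {w : V × ℝ → ℝ} {L : ℝ} (hL : 0 ≤ L)
    (hwc : Continuous w) (hwL : ∀ x y t, w (x, t) ≤ w (y, t) + L * ‖x - y‖)
    (hw : VSub S H w) {KS : ℝ} (hKS : 0 ≤ KS)
    (hS : ∀ θ x y, ∑ i, ‖S θ x i - S θ y i‖ ^ 2 ≤ KS * ‖x - y‖ ^ 2)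
    (hH : ∀ R : ℝ, 0 < R → ∃ CR : ℝ, 0 < CR ∧ ∀ θ x y p q, ‖p‖ ≤ R → ‖q‖ ≤ R →
      |H θ x p - H θ y q| ≤ CR * (‖x - y‖ + ‖p - q‖))
    (hconv : ∀ θ x, ConvexOn ℝ Set.univ (H θ x)) {q0 : V × ℝ} (hq0 : 0 < q0.2) {e : ℝ} (he : 0 < e) :
    ∃ U : V × ℝ → ℝ, ContDiff ℝ ∞ U ∧ ∀ q ∈ ball q0 (q0.2 / 4), |U q - w q| ≤ e ∧ ‖gx U q‖ ≤ L ∧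
      ∀ θ, Dt U q - ∑ i, D2 U q (S θ q.1 i) + H θ q.1 (gx U q) ≤ e := by
  obtain ⟨CR, hCR, hCRl⟩ := hH (2 * L + 1) (by positivity)
  set ρ0 := q0.2 / 4 with hρ0
  have hρ : 0 < ρ0 := by positivity
  set K5 := KS * (2 * L + 1) ^ 2 + CR * (2 * L + 1) with hK5
  have hK50 : 0 ≤ K5 := by positivity
  set ε := min ρ0 (e / (2 * (K5 + 2 * L ^ 2 + 1))) with hεd
  have hε : 0 < ε := by positivity
  have hερ : ε ≤ ρ0 := min_le_left _ _
  have hεe : (K5 + 2 * L ^ 2 + 1) * ε ≤ e / 2 := by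
    have : ε ≤ e / (2 * (K5 + 2 * L ^ 2 + 1)) := min_le_right _ _
    rw [le_div_iff₀ (by positivity)] at this
    linarith
  obtain ⟨W, hWc, hWL, hWw, hWv⟩ := supconv S H hL hwc hwL hw hε
  let f : ContDiffBump q0 := ⟨2 * ρ0, 3 * ρ0, by linarith, by linarith⟩
  set Wt : V × ℝ → ℝ := fun q => f q * W q with hWt
  have hWtc : Continuous Wt := f.continuous.mul hWc
  have hWts : HasCompactSupport Wt := f.hasCompactSupport.mul_right
  have hWteq : ∀ q ∈ ball q0 (2 * ρ0), Wt q = W q := fun q hq => by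
    simp only [hWt]
    rw [f.one_of_mem_closedBall (ball_subset_closedBall hq), one_mul]
  have huc := hWts.uniformContinuous_of_continuous hWtc
  rw [Metric.uniformContinuous_iff] at huc
  obtain ⟨δ0, hδ0, hδ0e⟩ := huc (e / 2) (by positivity)
  set δ := min δ0 (ε / 2) with hδd
  have hδ : 0 < δ := by positivity
  let ρ : ContDiffBump (0 : V × ℝ) := ⟨δ / 2, δ, by positivity, by linarith⟩
  have hδε : δ ≤ ε / 2 := min_le_right _ _
  borelize (V × ℝ)
  let μ : Measure (V × ℝ) := Measure.addHaar
  set r : V × ℝ → ℝ := ρ.normed μ with hr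
  have hrs : ContDiff ℝ ∞ r := ρ.contDiff_normed
  have hr0 : ∀ t, 0 ≤ r t := ρ.nonneg_normed
  have hri : ∫ t, r t ∂μ = 1 := ρ.integral_normed
  have hrc : HasCompactSupport r := ρ.hasCompactSupport_normed
  have hrz : ∀ t, δ ≤ ‖t‖ → r t = 0 := fun t ht => by
    by_contra hne
    have : t ∈ Function.support r := hne
    rw [hr, ρ.support_normed_eq, mem_ball_zero_iff] at this
    exact absurd this (not_lt.2 ht)
  have hUs : ContDiff ℝ ∞ (cv μ r Wt) := cv_contDiff μ hrs hrc hWtc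
  refine ⟨cv μ r Wt, hUs, fun q hq => ?_⟩
  have hqd : dist q q0 < ρ0 := hq
  have hqball : ∀ y, dist y q < ρ0 → y ∈ ball q0 (2 * ρ0) := fun y hy => by
    rw [mem_ball]
    linarith [dist_triangle y q q0]
  have hgx : ‖gx (cv μ r Wt) q‖ ≤ L := by
    have : ‖gx (cv μ r Wt) q‖ ≤ L ∨ gx (cv μ r Wt) q = 0 := by
      refine gx_le ((hUs.differentiable (by simp)) q) fun z => ?_
      have hsm : ∀ᶠ s in 𝓝[>] (0:ℝ), ‖s • (z, (0:ℝ))‖ < ρ0 / 2 := by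
        have : Tendsto (fun s : ℝ => ‖s • (z, (0:ℝ))‖) (𝓝[>] 0) (𝓝 ‖(0:ℝ) • (z, (0:ℝ))‖) :=
          Continuous.tendsto' (by fun_prop) _ _ rfl |>.mono_left nhdsWithin_le_nhds
        refine this.eventually_lt_const ?_
        rw [zero_smul, norm_zero]; positivity
      filter_upwards [hsm, self_mem_nhdsWithin] with s hs hs0
      have hs0 : 0 < s := hs0
      have i1 := cv_int μ hrs.continuous hrc hWtc (q + s • (z, (0:ℝ)))
      have i2 := cv_int μ hrs.continuous hrc hWtc q
      have i3 : Integrable r μ := hrs.continuous.integrable_of_hasCompactSupport hrc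
      simp only [cv]
      rw [← integral_sub i1 i2]
      calc _ ≤ ∫ t, r t * (L * ‖z‖ * s) ∂μ := by
            refine integral_mono (i1.sub i2) (i3.mul_const _) fun t => ?_
            simp only
            by_cases ht : δ ≤ ‖t‖
            · simp [hrz t ht]
            push Not at ht
            rw [← mul_sub]
            refine mul_le_mul_of_nonneg_left ?_ (hr0 t)
            rw [hWteq, hWteq]
            · have := hWL (q + s • (z, (0:ℝ)) - t).1 (q - t).1 (q - t).2
              have e1 : q + s • (z, (0:ℝ)) - t = ((q + s • (z, (0:ℝ)) - t).1, (q - t).2) := by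
                ext <;> simp
              rw [← e1] at this
              have e2 : (q + s • (z, (0:ℝ)) - t).1 - (q - t).1 = s • z := by
                simp
              rw [e2, norm_smul, Real.norm_eq_abs, abs_of_pos hs0] at this
              simp only [Prod.mk.eta] at this
              linarith
            · apply hqball
              rw [dist_eq_norm]
              have : ‖q - t - q‖ = ‖t‖ := by rw [sub_sub_cancel_left, norm_neg]
              linarith
            · apply hqball
              rw [dist_eq_norm]
              have : ‖q + s • (z, (0:ℝ)) - t - q‖ ≤ ‖s • (z, (0:ℝ))‖ + ‖t‖ := by
                rw [show q + s • (z, (0:ℝ)) - t - q = s • (z, (0:ℝ)) - t by abel]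
                exact norm_sub_le _ _
              linarith
        _ = L * ‖z‖ * s := by rw [integral_mul_const, hri, one_mul]
    rcases this with h | h
    · exact h
    · rw [h, norm_zero]; exact hL
  refine ⟨?_, hgx, fun θ => ?_⟩
  · have h1 : dist (cv μ r Wt q) (Wt q) ≤ e / 2 := by
      rw [cv_eq]
      refine ρ.dist_normed_convolution_le hWtc.aestronglyMeasurable fun x hx => ?_
      refine (hδ0e (lt_of_lt_of_le hx ?_)).le
      exact min_le_left _ _
    rw [hWteq q (hqball q (by simpa using hρ)), Real.dist_eq] at h1
    obtain ⟨h2, h3⟩ := hWw q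
    rw [abs_le] at h1 ⊢
    have h4 : 0 ≤ (K5 + 1) * ε := by positivity
    constructor <;> nlinarith
  · set g := gx (cv μ r Wt) q with hg
    have hHc : Continuous (H θ q.1) := by
      rw [continuous_iff_continuousAt]
      intro p
      obtain ⟨CR', h1, h2⟩ := hH (‖p‖ + 1) (by positivity)
      have h4 : ∀ᶠ x in 𝓝 p, dist (H θ q.1 x) (H θ q.1 p) ≤ CR' * ‖x - p‖ := by
        filter_upwards [ball_mem_nhds p one_pos] with x hx
        have hx' : ‖x - p‖ < 1 := by simpa [dist_eq_norm] using hx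
        have : ‖x‖ ≤ ‖p‖ + 1 := by
          have := norm_add_le p (x - p)
          rw [add_sub_cancel] at this
          linarith
        have := h2 θ q.1 q.1 x p this (by linarith)
        simpa [Real.dist_eq] using this
      have h5 : Tendsto (fun x => CR' * ‖x - p‖) (𝓝 p) (𝓝 0) :=
        Continuous.tendsto' (by fun_prop) _ _ (by simp)
      rw [ContinuousAt, tendsto_iff_dist_tendsto_zero]
      exact squeeze_zero' (Eventually.of_forall fun x => dist_nonneg) h4 h5
    obtain ⟨l, k, hlk, hlkx⟩ := ConvexOn.exists_affine_le_of_lt (𝕜 := ℝ) (Set.mem_univ g)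
      (show H θ q.1 g - e / 2 < H θ q.1 g by linarith) isClosed_univ
      (hHc.lowerSemicontinuous.lowerSemicontinuousOn _) (hconv θ q.1)
    have hlk' : ∀ p, l p + k ≤ H θ q.1 p := fun p => by
      simpa using hlk ⟨p, Set.mem_univ p⟩
    have hlkx' : l g + k = H θ q.1 g - e / 2 := by simpa using hlkx
    set ξ : V := (InnerProductSpace.toDual ℝ V).symm l with hξ
    have hlξ : ∀ p, inner ℝ p ξ = l p := fun p => by
      rw [real_inner_comm, hξ, InnerProductSpace.toDual_symm_apply]
    have hLop : ∀ (ψ : V × ℝ → ℝ) y, Lop (fun i => ((S θ q.1 i, (0:ℝ)) : V × ℝ)) (-ξ, -1) ψ y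
        = ∑ i, D2 ψ y (S θ q.1 i) - l (gx ψ y) - Dt ψ y := fun ψ y => by
      have e1 : ((-ξ, -1) : V × ℝ) = -(ξ, (0:ℝ)) - ((0:V), (1:ℝ)) := by ext <;> simp
      simp only [Lop, D2, Dt]
      rw [e1, map_sub, map_neg, ← hlξ, gx_inner]
      ring
    have key := moll_linear μ (fun i => ((S θ q.1 i, (0:ℝ)) : V × ℝ)) (-ξ, -1) (W := Wt) (y0 := q)
      (R := ε) (c := K5 * ε - k) hε hWtc hWts ?_ r hrs hr0 hri hrc
      (fun t ht => hrz t (hδε.trans ht))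
    · rw [hLop, ← hg] at key
      have : 0 ≤ (2 * L ^ 2 + 1) * ε := by positivity
      nlinarith
    · intro φ hφ y hy hm
      rw [hLop]
      have hyb : y ∈ ball q0 (2 * ρ0) := hqball y (lt_of_lt_of_le hy hερ)
      have hm' : IsLocalMax (fun z => W z - φ z) y := by
        filter_upwards [hm, isOpen_ball.mem_nhds hyb] with z hz hzb
        beta_reduce at hz
        rwa [hWteq z hzb, hWteq y hyb] at hz
      have hy2 : 0 < y.2 := by
        have h1 : |y.2 - q0.2| ≤ dist y q0 := by
          rw [← Real.dist_eq, Prod.dist_eq]; exact le_max_right _ _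
        have h2 : dist y q0 < 2 * ρ0 := hyb
        have := neg_abs_le (y.2 - q0.2)
        linarith
      obtain ⟨xs, h1, h2, h3⟩ := hWv φ hφ y hy2 hm'
      have h4 := h3 θ (fun i => S θ q.1 i)
      have hy1 : ‖y.1 - q.1‖ ≤ ε := by
        rw [← dist_eq_norm]
        exact (le_max_left _ _).trans (le_of_lt hy)
      have hxq : ‖xs - q.1‖ ≤ (2 * L + 1) * ε := by
        have := norm_add_le (xs - y.1) (y.1 - q.1)
        rw [sub_add_sub_cancel] at this
        linarith
      have h5 : ∑ i, ‖S θ xs i - S θ q.1 i‖ ^ 2 / ε ≤ KS * (2 * L + 1) ^ 2 * ε := by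
        rw [← Finset.sum_div, div_le_iff₀ hε]
        calc _ ≤ KS * ‖xs - q.1‖ ^ 2 := hS θ xs q.1
          _ ≤ KS * ((2 * L + 1) * ε) ^ 2 := by gcongr
          _ = _ := by ring
      have h6 := (abs_le.1 (hCRl θ xs q.1 (gx φ y) (gx φ y) (by linarith) (by linarith))).1
      rw [sub_self, norm_zero, add_zero] at h6
      have h7 : CR * ‖xs - q.1‖ ≤ CR * ((2 * L + 1) * ε) := by gcongr
      have h8 := hlk' (gx φ y)
      have h9 : K5 * ε = KS * (2 * L + 1) ^ 2 * ε + CR * ((2 * L + 1) * ε) := by rw [hK5]; ring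
      linarith

end Smooth8

section Cross9

open Metric Topology MeasureTheory
open scoped ContDiff

variable {V : Type*} [NormedAddCommGroup V] [InnerProductSpace ℝ V] [FiniteDimensional ℝ V]
  [CompleteSpace V] {Θ : Type*} {ι : Type*} [Fintype ι]

lemma fd2_lin {F : Type*} [NormedAddCommGroup F] [NormedSpace ℝ F] {f g : F → ℝ}
    (hf : ContDiff ℝ 2 f) (hg : ContDiff ℝ 2 g) (a b : ℝ) (q : F) :
    fderiv ℝ (fun p => a • fderiv ℝ f p + b • fderiv ℝ g p) q
      = a • fderiv ℝ (fderiv ℝ f) q + b • fderiv ℝ (fderiv ℝ g) q := by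
  have df2 : Differentiable ℝ (fderiv ℝ f) :=
    (hf.fderiv_right (m := 1) (by norm_num)).differentiable (by norm_num)
  have dg2 : Differentiable ℝ (fderiv ℝ g) :=
    (hg.fderiv_right (m := 1) (by norm_num)).differentiable (by norm_num)
  have k1 : DifferentiableAt ℝ (fun p => a • fderiv ℝ f p) q := (df2 q).fun_const_smul a
  have k2 : DifferentiableAt ℝ (fun p => b • fderiv ℝ g p) q := (dg2 q).fun_const_smul b
  rw [fderiv_fun_add k1 k2,
      fderiv_fun_const_smul (df2 q), fderiv_fun_const_smul (dg2 q)]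

lemma jet_lin {f g : V × ℝ → ℝ} (hf : ContDiff ℝ 2 f) (hg : ContDiff ℝ 2 g) (a b : ℝ) (q : V × ℝ) :
    gx (fun p => a * f p + b * g p) q = a • gx f q + b • gx g q ∧
    Dt (fun p => a * f p + b * g p) q = a * Dt f q + b * Dt g q ∧
    ∀ z, D2 (fun p => a * f p + b * g p) q z = a * D2 f q z + b * D2 g q z := by
  have df : Differentiable ℝ f := hf.differentiable (by norm_num)
  have dg : Differentiable ℝ g := hg.differentiable (by norm_num)
  have h1 : fderiv ℝ (fun p => a * f p + b * g p) = fun p => a • fderiv ℝ f p + b • fderiv ℝ g p := by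
    ext1 p
    exact (((df p).hasFDerivAt.const_mul a).add ((dg p).hasFDerivAt.const_mul b)).fderiv
  have h2 : fderiv ℝ (fun p => a • fderiv ℝ f p + b • fderiv ℝ g p) q
      = a • fderiv ℝ (fderiv ℝ f) q + b • fderiv ℝ (fderiv ℝ g) q :=  fd2_lin hf hg a b q
  refine ⟨?_, ?_, fun z => ?_⟩
  · refine ext_inner_right ℝ fun z => ?_
    rw [gx_inner, h1, inner_add_left, inner_smul_left, inner_smul_left, gx_inner, gx_inner]
    simp
  · simp only [Dt, h1]; simp
  · simp only [D2, h1, h2]; simp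

lemma jet_freeze {f : V × ℝ → ℝ} (hf : ContDiff ℝ 2 f) (t : ℝ) (q : V × ℝ) :
    gx (fun p : V × ℝ => f (p.1, t)) q = gx f (q.1, t) ∧ Dt (fun p : V × ℝ => f (p.1, t)) q = 0 ∧
    ∀ z, D2 (fun p : V × ℝ => f (p.1, t)) q z = D2 f (q.1, t) z := by
  have hF : ContDiff ℝ 2 (fun p : V × ℝ => f (p.1, t)) := by fun_prop
  have h1 : ∀ z : V, _ := fun z => line_poly hf hF (q.1, t) (z, (0:ℝ)) q (z, (0:ℝ)) 0 0 0
    (fun s => by simp)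
  have h2 := line_poly hf hF (q.1, t) 0 q ((0:V), (1:ℝ)) 0 0 0 (fun s => by simp)
  refine ⟨?_, ?_, fun z => ?_⟩
  · refine ext_inner_right ℝ fun z => ?_
    rw [gx_inner, gx_inner, (h1 z).1, add_zero]
  · simpa [Dt] using h2.1
  · simpa [D2] using (h1 z).2

/-- supersolution in product form -/
def VSuper (S : Θ → V → ι → V) (H : Θ → V → V → ℝ) (w : V × ℝ → ℝ) : Prop :=
  ∀ φ : V × ℝ → ℝ, ContDiff ℝ 2 φ → ∀ q : V × ℝ, 0 < q.2 → IsLocalMin (fun z => w z - φ z) q →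
    ∀ e : ℝ, 0 < e → ∃ θ, -e ≤ Dt φ q - ∑ i, D2 φ q (S θ q.1 i) + H θ q.1 (gx φ q)

/-- smooth approximate subsolutions near a point -/
def Apx (S : Θ → V → ι → V) (H : Θ → V → V → ℝ) (L : ℝ) (w : V × ℝ → ℝ) (q0 : V × ℝ) (ρ : ℝ) : Prop :=
  ∀ e : ℝ, 0 < e → ∃ U : V × ℝ → ℝ, ContDiff ℝ ∞ U ∧ ∀ q ∈ ball q0 ρ, |U q - w q| ≤ e ∧
    ‖gx U q‖ ≤ L ∧ ∀ θ, Dt U q - ∑ i, D2 U q (S θ q.1 i) + H θ q.1 (gx U q) ≤ e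

lemma Apx_comb {S : Θ → V → ι → V} {H : Θ → V → V → ℝ} {L1 L2 : ℝ} {w1 w2 : V × ℝ → ℝ} {q0 : V × ℝ}
    {ρ : ℝ} (h1 : Apx S H L1 w1 q0 ρ) (h2 : Apx S H L2 w2 q0 ρ) (hL1 : 0 ≤ L1) (hL2 : 0 ≤ L2)
    (hconv : ∀ θ x, ConvexOn ℝ Set.univ (H θ x)) {a b : ℝ} (ha : 0 ≤ a) (hb : 0 ≤ b) (hab : a + b = 1) :
    Apx S H (L1 + L2) (fun q => a * w1 q + b * w2 q) q0 ρ := by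
  intro e he
  obtain ⟨U1, hU1, k1⟩ := h1 e he
  obtain ⟨U2, hU2, k2⟩ := h2 e he
  refine ⟨fun q => a * U1 q + b * U2 q, by fun_prop, fun q hq => ?_⟩
  obtain ⟨j1, j2, j3⟩ := jet_lin (hU1.of_le (by norm_cast)) (hU2.of_le (by norm_cast)) a b q
  obtain ⟨a1, a2, a3⟩ := k1 q hq
  obtain ⟨b1, b2, b3⟩ := k2 q hq
  refine ⟨?_, ?_, fun θ => ?_⟩
  · rw [abs_le] at *
    constructor <;> nlinarith
  · rw [j1]
    have := norm_add_le (a • gx U1 q) (b • gx U2 q)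
    rw [norm_smul, norm_smul, Real.norm_of_nonneg ha, Real.norm_of_nonneg hb] at this
    nlinarith [norm_nonneg (gx U1 q), norm_nonneg (gx U2 q)]
  · rw [j1, j2]
    simp only [j3]
    rw [Finset.sum_add_distrib, ← Finset.mul_sum, ← Finset.mul_sum]
    have hc := (hconv θ q.1).2 (Set.mem_univ (gx U1 q)) (Set.mem_univ (gx U2 q)) ha hb hab
    simp only [smul_eq_mul] at hc
    nlinarith [mul_le_mul_of_nonneg_left (a3 θ) ha, mul_le_mul_of_nonneg_left (b3 θ) hb]

lemma F_core {S : Θ → V → ι → V} {H : Θ → V → V → ℝ} {om w φ1 φ2 : V × ℝ → ℝ} {L C L' C₀ ρ κ r : ℝ}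
    {x0 : V} {t0 s0 : ℝ} (hφ1 : ContDiff ℝ 2 φ1) (hφ2 : ContDiff ℝ 2 φ2)
    (hwc : Continuous w) (hwL : ∀ x y t, w (x, t) ≤ w (y, t) + C * ‖x - y‖) (hw : VSuper S H w)
    (hZ : Apx S H L om (x0, t0) ρ)
    (hC₀ : ∀ θ x p q, ‖p‖ ≤ L' → ‖q‖ ≤ L' → |H θ x p - H θ x q| ≤ C₀ * ‖p - q‖)
    (hC0 : 0 ≤ C) (hCL : C ≤ L') (hLL : L ≤ L') (hκ : 0 < κ) (hr : 0 < r) (hrs : r < s0) (hrρ : r < ρ)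
    (hmax : ∀ p ∈ closedBall (x0, t0, s0) r,
      om (p.1, p.2.1) - w (p.1, p.2.2) - φ1 (p.1, p.2.1) - φ2 (p.1, p.2.2)
        + κ * (‖p.1 - x0‖ ^ 2 + (p.2.1 - t0) ^ 2 + (p.2.2 - s0) ^ 2)
      ≤ om (x0, t0) - w (x0, s0) - φ1 (x0, t0) - φ2 (x0, s0)) {e : ℝ} (he : 0 < e) :
    ∃ p ∈ ball (x0, t0, s0) r, ∃ θ, Dt φ1 (p.1, p.2.1) + Dt φ2 (p.1, p.2.2)
      - ∑ i, (D2 φ1 (p.1, p.2.1) (S θ p.1 i) + D2 φ2 (p.1, p.2.2) (S θ p.1 i))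
      - C₀ * ‖gx φ1 (p.1, p.2.1) + gx φ2 (p.1, p.2.2)‖ ≤ e := by
  set e1 := min (e / 2) (κ * r ^ 2 / 4) with he1
  have he1p : 0 < e1 := by positivity
  have he1e : e1 ≤ e / 2 := min_le_left _ _
  have he1k : e1 ≤ κ * r ^ 2 / 4 := min_le_right _ _
  obtain ⟨Z, hZs, hZq⟩ := hZ e1 he1p
  have hZ2 : ContDiff ℝ 2 Z := hZs.of_le (by norm_cast)
  set G : V × ℝ × ℝ → ℝ := fun p => Z (p.1, p.2.1) - w (p.1, p.2.2) - φ1 (p.1, p.2.1) - φ2 (p.1, p.2.2)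
    with hG
  have hGc : Continuous G := by
    have := hZs.continuous
    have := hφ1.continuous
    have := hφ2.continuous
    fun_prop
  obtain ⟨p, hpK, hpm⟩ := (isCompact_closedBall (x0, t0, s0) r).exists_isMaxOn
    ⟨_, mem_closedBall_self hr.le⟩ hGc.continuousOn
  have hsub : ∀ p' ∈ closedBall (x0, t0, s0) r, (p'.1, p'.2.1) ∈ ball (x0, t0) ρ := fun p' hp' => by
    rw [mem_closedBall, Prod.dist_eq, Prod.dist_eq] at hp'
    rw [mem_ball, Prod.dist_eq]
    have h1 := (le_max_left _ _).trans hp'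
    have h2 := ((le_max_left _ _).trans (le_max_right _ _)).trans hp'
    exact max_lt (lt_of_le_of_lt h1 hrρ) (lt_of_le_of_lt h2 hrρ)
  have hpb : p ∈ ball (x0, t0, s0) r := by
    by_contra hnb
    have hd : dist p (x0, t0, s0) = r :=
      le_antisymm hpK (not_lt.1 hnb)
    have hsq : r ^ 2 ≤ ‖p.1 - x0‖ ^ 2 + (p.2.1 - t0) ^ 2 + (p.2.2 - s0) ^ 2 := by
      rw [Prod.dist_eq, Prod.dist_eq, dist_eq_norm, Real.dist_eq, Real.dist_eq] at hd
      simp only at hd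
      rw [← sq_abs (p.2.1 - t0), ← sq_abs (p.2.2 - s0)]
      rcases max_choice ‖p.1 - x0‖ (max |p.2.1 - t0| |p.2.2 - s0|) with h | h
      · rw [h] at hd; rw [hd]; nlinarith [sq_nonneg |p.2.1 - t0|, sq_nonneg |p.2.2 - s0|]
      · rw [h] at hd
        rcases max_choice |p.2.1 - t0| |p.2.2 - s0| with h | h
        · rw [h] at hd; rw [hd]; nlinarith [sq_nonneg ‖p.1 - x0‖, sq_nonneg |p.2.2 - s0|]
        · rw [h] at hd; rw [hd]; nlinarith [sq_nonneg ‖p.1 - x0‖, sq_nonneg |p.2.1 - t0|]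
    have h1 := hmax p hpK
    have h2 : G (x0, t0, s0) ≤ G p := hpm (mem_closedBall_self hr.le)
    have h3 := (abs_le.1 (hZq _ (hsub p hpK)).1).2
    have h4 := (abs_le.1 (hZq _ (hsub (x0, t0, s0) (mem_closedBall_self hr.le))).1).1
    simp only [hG] at h2 h4
    have h5 := mul_le_mul_of_nonneg_left hsq hκ.le
    have h6 : 0 < κ * r ^ 2 := by positivity
    linarith
  have hloc : ∀ᶠ p' in 𝓝 p, G p' ≤ G p := by
    filter_upwards [isOpen_ball.mem_nhds hpb] with p' hp'
    exact hpm (ball_subset_closedBall hp')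
  refine ⟨p, hpb, ?_⟩
  obtain ⟨y, t, s⟩ := p
  simp only [hG] at hloc
  have hZy := hZq _ (hsub _ hpK)
  simp only at hZy ⊢
  obtain ⟨-, hZg, hZi⟩ := hZy
  have hs : 0 < s := by
    have : dist s s0 < r := by
      have h := hpb
      rw [mem_ball, Prod.dist_eq, Prod.dist_eq] at h
      exact lt_of_le_of_lt ((le_max_right _ _).trans (le_max_right _ _)) h
    rw [Real.dist_eq] at this
    have := neg_abs_le (s - s0)
    linarith
  have hdt : Dt Z (y, t) = Dt φ1 (y, t) := by
    have hf : ContDiff ℝ 2 (fun q => (-1) * Z q + 1 * φ1 q) := by fun_prop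
    have := second_order hf (y, t) ((0:V), (1:ℝ)) 0 0 0 (by
      have hc : Tendsto (fun τ : ℝ => (y, t + τ, s)) (𝓝 0) (𝓝 (y, t, s)) :=
        Continuous.tendsto' (by fun_prop) _ _ (by simp)
      filter_upwards [hc.eventually hloc] with τ hτ
      simp
      linarith)
    have h2 := this.1
    have h3 := (jet_lin hZ2 hφ1 (-1) 1 (y, t)).2.1
    simp only [Dt] at h3 ⊢
    rw [h3] at h2
    linarith
  have hf1 : ContDiff ℝ 2 (fun q => 1 * Z q + (-1) * φ1 q) := by fun_prop
  have hf2 : ContDiff ℝ 2 (fun q : V × ℝ => 1 * Z (q.1, t) + (-1) * φ1 (q.1, t)) := by fun_prop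
  set ψ : V × ℝ → ℝ := fun q => 1 * (1 * Z (q.1, t) + (-1) * φ1 (q.1, t)) + (-1) * φ2 q with hψ
  have hψs : ContDiff ℝ 2 ψ := by fun_prop
  obtain ⟨a1, a2, a3⟩ := jet_lin hZ2 hφ1 1 (-1) (y, t)
  obtain ⟨b1, b2, b3⟩ := jet_freeze hf1 t (y, s)
  obtain ⟨c1, c2, c3⟩ := jet_lin hf2 hφ2 1 (-1) (y, s)
  have hmin : IsLocalMin (fun z => w z - ψ z) (y, s) := by
    have hc : Tendsto (fun q : V × ℝ => (q.1, t, q.2)) (𝓝 (y, s)) (𝓝 (y, t, s)) :=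
      Continuous.tendsto' (by fun_prop) _ _ (by simp)
    filter_upwards [hc.eventually hloc] with q hq
    simp only [hψ]
    simp only [Prod.mk.eta] at hq
    linarith
  obtain ⟨θ, hθ⟩ := hw ψ hψs (y, s) hs hmin (e / 2) (by positivity)
  have hgψ : ‖gx ψ (y, s)‖ ≤ C := by
    have : ‖gx ψ (y, s)‖ ≤ C ∨ gx ψ (y, s) = 0 := by
      refine gx_le ((hψs.differentiable (by norm_num)) _) fun z => ?_
      have hc : Tendsto (fun τ : ℝ => (y, s) + τ • (z, (0:ℝ))) (𝓝[>] 0) (𝓝 (y, s)) :=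
        (Continuous.tendsto' (by fun_prop) _ _ (by simp)).mono_left nhdsWithin_le_nhds
      filter_upwards [hc.eventually hmin, self_mem_nhdsWithin] with τ hτ hτ0
      have hτ0 : 0 < τ := hτ0
      have := hwL (y + τ • z) y s
      rw [add_sub_cancel_left, norm_smul, Real.norm_of_nonneg hτ0.le] at this
      simp only [Prod.smul_mk, Prod.mk_add_mk, smul_zero, add_zero] at hτ ⊢
      linarith
    rcases this with h | h
    · exact h
    · rw [h, norm_zero]; exact hC0
  refine ⟨θ, ?_⟩
  have hZθ := hZi θ
  simp only at hθ
  have hgeq : gx ψ (y, s) = gx Z (y, t) - (gx φ1 (y, t) + gx φ2 (y, s)) := by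
    rw [c1, b1, a1]; simp only [one_smul, neg_smul]; abel
  have hDteq : Dt ψ (y, s) = - Dt φ2 (y, s) := by
    rw [c2, b2]; ring
  have hD2eq : ∀ z, D2 ψ (y, s) z = D2 Z (y, t) z - (D2 φ1 (y, t) z + D2 φ2 (y, s) z) := fun z => by
    rw [c3, b3, a3]; ring
  have hHd := (abs_le.1 (hC₀ θ y (gx ψ (y, s)) (gx Z (y, t)) (hgψ.trans hCL) (hZg.trans hLL))).2
  have hn : ‖gx ψ (y, s) - gx Z (y, t)‖ = ‖gx φ1 (y, t) + gx φ2 (y, s)‖ := by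
    rw [hgeq, sub_sub_cancel_left, norm_neg]
  rw [hn] at hHd
  rw [hDteq] at hθ
  simp only [hD2eq] at hθ
  rw [Finset.sum_sub_distrib] at hθ
  rw [← hdt]
  linarith

end Cross9

section Lim10

open Metric Topology MeasureTheory
open scoped ContDiff

variable {V : Type*} [NormedAddCommGroup V] [InnerProductSpace ℝ V] [FiniteDimensional ℝ V]
  [CompleteSpace V] {Θ : Type*} {ι : Type*} [Fintype ι]

lemma gx_cont {φ : V × ℝ → ℝ} (h : ContDiff ℝ 2 φ) : Continuous (gx φ) := by
  have h1 : Continuous (fderiv ℝ φ) := h.continuous_fderiv (by norm_num)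
  unfold gx
  exact (InnerProductSpace.toDual ℝ V).symm.continuous.comp
    (h1.clm_comp continuous_const)

lemma Dt_cont {φ : V × ℝ → ℝ} (h : ContDiff ℝ 2 φ) : Continuous (Dt φ) := by
  have h1 : Continuous (fderiv ℝ φ) := h.continuous_fderiv (by norm_num)
  unfold Dt
  exact h1.clm_apply continuous_const

lemma fd2_cont {F : Type*} [NormedAddCommGroup F] [NormedSpace ℝ F] {φ : F → ℝ} (h : ContDiff ℝ 2 φ) :
    Continuous (fderiv ℝ (fderiv ℝ φ)) :=
  (h.fderiv_right (m := 1) (by norm_num)).continuous_fderiv (by norm_num)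

lemma bil_est {F : Type*} [NormedAddCommGroup F] [NormedSpace ℝ F] (B B0 : F →L[ℝ] F →L[ℝ] ℝ)
    (z z0 : F) {K : ℝ} (hz : ‖z‖ ≤ K) (hz0 : ‖z0‖ ≤ K) :
    |B z z - B0 z0 z0| ≤ ‖B - B0‖ * K ^ 2 + ‖B0‖ * (2 * K) * ‖z - z0‖ := by
  have hK : 0 ≤ K := (norm_nonneg z).trans hz
  have e1 : B z z - B0 z0 z0 = (B - B0) z z + (B0 z (z - z0) + B0 (z - z0) z0) := by
    simp only [sub_apply, map_sub]; ring
  have h1 : ‖(B - B0) z z‖ ≤ ‖B - B0‖ * K ^ 2 := by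
    refine ((B - B0).le_opNorm₂ z z).trans ?_
    rw [mul_assoc, ← sq]; gcongr
  have h2 : ‖B0 z (z - z0)‖ ≤ ‖B0‖ * K * ‖z - z0‖ := by
    refine (B0.le_opNorm₂ _ _).trans ?_
    gcongr
  have h3 : ‖B0 (z - z0) z0‖ ≤ ‖B0‖ * ‖z - z0‖ * K := by
    refine (B0.le_opNorm₂ _ _).trans ?_
    gcongr
  rw [e1, ← Real.norm_eq_abs]
  refine (norm_add_le _ _).trans ?_
  have := norm_add_le (B0 z (z - z0)) (B0 (z - z0) z0)
  linarith

lemma tendsto_nsub {X W : Type*} [TopologicalSpace X] [NormedAddCommGroup W] {B : X → W}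
    (hB : Continuous B) (p0 : X) : Tendsto (fun p => ‖B p - B p0‖) (𝓝 p0) (𝓝 0) :=
  tendsto_iff_norm_sub_tendsto_zero.1 (hB.tendsto p0)

lemma tendsto_nsub2 {X F : Type*} [TopologicalSpace X] [NormedAddCommGroup F] [NormedSpace ℝ F]
    (B : X → F →L[ℝ] F →L[ℝ] ℝ) (hB : Continuous B) (p0 : X) :
    Tendsto (fun p => ‖B p - B p0‖) (𝓝 p0) (𝓝 0) := by
  have := tendsto_nsub (W := F →L[ℝ] F →L[ℝ] ℝ) (by convert hB) p0
  convert this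

lemma bil_unif {X F : Type*} [TopologicalSpace X] [NormedAddCommGroup F] [NormedSpace ℝ F]
    (B : X → F →L[ℝ] F →L[ℝ] ℝ) (hB : Continuous B) (p0 : X) {K : ℝ} (hK : 0 ≤ K) {e : ℝ} (he : 0 < e) :
    ∃ δ : ℝ, 0 < δ ∧ ∀ᶠ p in 𝓝 p0, ∀ z z0 : F, ‖z‖ ≤ K → ‖z0‖ ≤ K → ‖z - z0‖ ≤ δ →
      |B p z z - B p0 z0 z0| ≤ e := by
  set δ := e / (2 * (‖B p0‖ * (2 * K) + 1)) with hδ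
  have hδp : 0 < δ := by positivity
  have hδe : ‖B p0‖ * (2 * K) * δ ≤ e / 2 := by
    have : δ * (2 * (‖B p0‖ * (2 * K) + 1)) = e := by rw [hδ]; field_simp
    nlinarith
  refine ⟨δ, hδp, ?_⟩
  have hc : Tendsto (fun p => ‖B p - B p0‖ * K ^ 2) (𝓝 p0) (𝓝 0) := by
    have h0 : Tendsto (fun p => ‖B p - B p0‖) (𝓝 p0) (𝓝 0) :=
      tendsto_nsub2 B hB p0
    simpa using h0.mul_const (K ^ 2)
  filter_upwards [hc.eventually_lt_const (show 0 < e / 2 by positivity)] with p hp z z0 hz hz0 hzz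
  have := bil_est (B p) (B p0) z z0 hz hz0
  have h2 : ‖B p0‖ * (2 * K) * ‖z - z0‖ ≤ ‖B p0‖ * (2 * K) * δ := by gcongr
  linarith

lemma F_lim {S : Θ → V → ι → V} {H : Θ → V → V → ℝ} {om w φ1 φ2 : V × ℝ → ℝ} {L C L' C₀ ρ κ r1 : ℝ}
    {x0 : V} {t0 s0 : ℝ} (hφ1 : ContDiff ℝ 2 φ1) (hφ2 : ContDiff ℝ 2 φ2)
    (hwc : Continuous w) (hwL : ∀ x y t, w (x, t) ≤ w (y, t) + C * ‖x - y‖) (hw : VSuper S H w)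
    (hZ : Apx S H L om (x0, t0) ρ)
    (hC₀ : ∀ θ x p q, ‖p‖ ≤ L' → ‖q‖ ≤ L' → |H θ x p - H θ x q| ≤ C₀ * ‖p - q‖)
    (hC0 : 0 ≤ C) (hCL : C ≤ L') (hLL : L ≤ L') (hκ : 0 < κ) (hr1 : 0 < r1) (hs0 : 0 < s0) (hρ : 0 < ρ)
    {KB KL : ℝ} (hKB : ∀ θ x i, ‖S θ x i‖ ≤ KB) (hKL : ∀ θ x y i, ‖S θ x i - S θ y i‖ ≤ KL * ‖x - y‖)
    (hmax : ∀ p ∈ closedBall (x0, t0, s0) r1,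
      om (p.1, p.2.1) - w (p.1, p.2.2) - φ1 (p.1, p.2.1) - φ2 (p.1, p.2.2)
        + κ * (‖p.1 - x0‖ ^ 2 + (p.2.1 - t0) ^ 2 + (p.2.2 - s0) ^ 2)
      ≤ om (x0, t0) - w (x0, s0) - φ1 (x0, t0) - φ2 (x0, s0)) {e : ℝ} (he : 0 < e) :
    ∃ θ, Dt φ1 (x0, t0) + Dt φ2 (x0, s0)
      - ∑ i, (D2 φ1 (x0, t0) (S θ x0 i) + D2 φ2 (x0, s0) (S θ x0 i))
      - C₀ * ‖gx φ1 (x0, t0) + gx φ2 (x0, s0)‖ ≤ e := by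
  set p0 : V × ℝ × ℝ := (x0, t0, s0) with hp0
  set T : V × ℝ × ℝ → ℝ := fun p => Dt φ1 (p.1, p.2.1) + Dt φ2 (p.1, p.2.2)
    - C₀ * ‖gx φ1 (p.1, p.2.1) + gx φ2 (p.1, p.2.2)‖ with hT
  set B : V × ℝ × ℝ → (V × ℝ →L[ℝ] V × ℝ →L[ℝ] ℝ) := fun p =>
    fderiv ℝ (fderiv ℝ φ1) (p.1, p.2.1) + fderiv ℝ (fderiv ℝ φ2) (p.1, p.2.2) with hB
  have hTc : Continuous T := by
    have := gx_cont hφ1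
    have := gx_cont hφ2
    have := Dt_cont hφ1
    have := Dt_cont hφ2
    fun_prop
  have hBc : Continuous B := by
    have k1 := fd2_cont hφ1
    have k2 := fd2_cont hφ2
    exact (k1.comp (by fun_prop)).add (k2.comp (by fun_prop))
  set e1 := e / (3 * ((Fintype.card ι : ℝ) + 1)) with he1
  have he1p : 0 < e1 := by positivity
  have he1c : (Fintype.card ι : ℝ) * e1 ≤ e / 3 := by
    have : e1 * (3 * ((Fintype.card ι : ℝ) + 1)) = e := by rw [he1]; field_simp
    nlinarith
  obtain ⟨δ, hδ, hδB⟩ := bil_unif B hBc p0 (K := max KB 0) (le_max_right _ _) he1p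
  have ev0 : ∀ᶠ p in 𝓝 p0, KL * ‖p.1 - p0.1‖ < δ := by
    have hc : Tendsto (fun p : V × ℝ × ℝ => KL * ‖p.1 - p0.1‖) (𝓝 p0) (𝓝 0) :=
      Continuous.tendsto' (by fun_prop) _ _ (by simp)
    exact hc.eventually_lt_const hδ
  have ev2 : ∀ᶠ p in 𝓝 p0, T p0 - e / 3 < T p :=
    (hTc.tendsto p0).eventually_const_lt (by linarith)
  obtain ⟨r2, hr2, hr2b⟩ := Metric.eventually_nhds_iff_ball.1 ((hδB.and ev0).and ev2)
  set r := min (min r1 r2) (min (s0 / 2) (ρ / 2)) with hr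
  have hrp : 0 < r := by positivity
  have k1 : r ≤ r1 := (min_le_left _ _).trans (min_le_left _ _)
  have k2 : r ≤ r2 := (min_le_left _ _).trans (min_le_right _ _)
  have k3 : r ≤ s0 / 2 := (min_le_right _ _).trans (min_le_left _ _)
  have k4 : r ≤ ρ / 2 := (min_le_right _ _).trans (min_le_right _ _)
  obtain ⟨p, hp, θ, hθ⟩ := F_core hφ1 hφ2 hwc hwL hw hZ hC₀ hC0 hCL hLL hκ hrp (by linarith)
    (by linarith) (fun p hp => hmax p (closedBall_subset_closedBall k1 hp)) (e := e / 3) (by positivity)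
  refine ⟨θ, ?_⟩
  obtain ⟨⟨m1, m0⟩, m2⟩ := hr2b p (ball_subset_ball k2 hp)
  have hsum : ∑ i, (D2 φ1 (p.1, p.2.1) (S θ p.1 i) + D2 φ2 (p.1, p.2.2) (S θ p.1 i))
      ≤ ∑ i, (D2 φ1 (x0, t0) (S θ x0 i) + D2 φ2 (x0, s0) (S θ x0 i)) + Fintype.card ι * e1 := by
    have hcs : (Fintype.card ι : ℝ) * e1 = ∑ _i : ι, e1 := by simp
    rw [hcs, ← Finset.sum_add_distrib]
    refine Finset.sum_le_sum fun i _ => ?_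
    have hn : ∀ z : V, ‖(z, (0:ℝ))‖ = ‖z‖ := fun z => by simp [Prod.norm_def]
    have h := m1 (S θ p.1 i, (0:ℝ)) (S θ x0 i, (0:ℝ))
      (by rw [hn]; exact (hKB _ _ _).trans (le_max_left _ _))
      (by rw [hn]; exact (hKB _ _ _).trans (le_max_left _ _))
      (by rw [Prod.mk_sub_mk, sub_zero, hn]; exact (hKL θ p.1 x0 i).trans m0.le)
    have h2 := (abs_le.1 h).2
    have e1 : B p (S θ p.1 i, (0:ℝ)) (S θ p.1 i, (0:ℝ))
      = D2 φ1 (p.1, p.2.1) (S θ p.1 i) + D2 φ2 (p.1, p.2.2) (S θ p.1 i) := by simp [hB, D2]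
    have e2 : B p0 (S θ x0 i, (0:ℝ)) (S θ x0 i, (0:ℝ))
      = D2 φ1 (x0, t0) (S θ x0 i) + D2 φ2 (x0, s0) (S θ x0 i) := by simp [hB, hp0, D2]
    rw [e1, e2] at h2
    linarith
  simp only [hT, hp0] at m2
  linarith

lemma F_final {S : Θ → V → ι → V} {H : Θ → V → V → ℝ} {om w φ1 φ2 : V × ℝ → ℝ} {L C L' C₀ ρ : ℝ}
    {x0 : V} {t0 s0 : ℝ} (hφ1 : ContDiff ℝ 2 φ1) (hφ2 : ContDiff ℝ 2 φ2)
    (hwc : Continuous w) (hwL : ∀ x y t, w (x, t) ≤ w (y, t) + C * ‖x - y‖) (hw : VSuper S H w)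
    (hZ : Apx S H L om (x0, t0) ρ)
    (hC₀ : ∀ θ x p q, ‖p‖ ≤ L' → ‖q‖ ≤ L' → |H θ x p - H θ x q| ≤ C₀ * ‖p - q‖)
    (hC0 : 0 ≤ C) (hCL : C ≤ L') (hLL : L ≤ L') (hs0 : 0 < s0) (hρ : 0 < ρ)
    {KB KL : ℝ} (hKB : ∀ θ x i, ‖S θ x i‖ ≤ KB) (hKL : ∀ θ x y i, ‖S θ x i - S θ y i‖ ≤ KL * ‖x - y‖)
    (hmax : ∀ᶠ p : V × ℝ × ℝ in 𝓝 (x0, t0, s0),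
      om (p.1, p.2.1) - w (p.1, p.2.2) - φ1 (p.1, p.2.1) - φ2 (p.1, p.2.2)
      ≤ om (x0, t0) - w (x0, s0) - φ1 (x0, t0) - φ2 (x0, s0)) {e : ℝ} (he : 0 < e) :
    ∃ θ, Dt φ1 (x0, t0) + Dt φ2 (x0, s0)
      - ∑ i, (D2 φ1 (x0, t0) (S θ x0 i) + D2 φ2 (x0, s0) (S θ x0 i))
      - C₀ * ‖gx φ1 (x0, t0) + gx φ2 (x0, s0)‖ ≤ e := by
  obtain ⟨r1, hr1, hr1b⟩ := Metric.nhds_basis_closedBall.eventually_iff.1 hmax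
  set M : ℝ := ∑ _i : ι, KB ^ 2 with hM
  have hM0 : 0 ≤ M := by positivity
  set κ := e / (4 * (M + 1)) with hκd
  have hκ : 0 < κ := by positivity
  have hκM : κ * (2 * M) ≤ e / 2 := by
    have : κ * (4 * (M + 1)) = e := by rw [hκd]; field_simp
    nlinarith
  set a : V × ℝ → ℝ := fun q => ‖q.1 - x0‖ ^ 2 + (q.2 - t0) ^ 2 with ha
  set b : V × ℝ → ℝ := fun q => (q.2 - s0) ^ 2 with hb
  have has : ContDiff ℝ 2 a := by
    have : ContDiff ℝ 2 (fun q : V × ℝ => ‖q.1 - x0‖ ^ 2) := ContDiff.norm_sq ℝ (by fun_prop)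
    fun_prop
  have hbs : ContDiff ℝ 2 b := by fun_prop
  have hz : ContDiff ℝ 2 (fun _ : V × ℝ => (0:ℝ)) := contDiff_const
  have a1 : ∀ z : V, _ := fun z => line_poly hz has (0 : V × ℝ) 0 (x0, t0) (z, (0:ℝ)) 0 0 (‖z‖ ^ 2)
    (fun s => by simp [ha, norm_smul, mul_pow]; ring)
  have a2 := line_poly hz has (0 : V × ℝ) 0 (x0, t0) ((0:V), (1:ℝ)) 0 0 1
    (fun s => by simp [ha])
  have b1 : ∀ z : V, _ := fun z => line_poly hz hbs (0 : V × ℝ) 0 (x0, s0) (z, (0:ℝ)) 0 0 0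
    (fun s => by simp [hb])
  have b2 := line_poly hz hbs (0 : V × ℝ) 0 (x0, s0) ((0:V), (1:ℝ)) 0 0 1
    (fun s => by simp [hb])
  have ga : gx a (x0, t0) = 0 := ext_inner_right ℝ fun z => by
    rw [gx_inner, (a1 z).1]; simp
  have gb : gx b (x0, s0) = 0 := ext_inner_right ℝ fun z => by
    rw [gx_inner, (b1 z).1]; simp
  have ta : Dt a (x0, t0) = 0 := by rw [Dt, a2.1]; simp
  have tb : Dt b (x0, s0) = 0 := by rw [Dt, b2.1]; simp
  have da : ∀ z, D2 a (x0, t0) z = 2 * ‖z‖ ^ 2 := fun z => by rw [D2, (a1 z).2]; simp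
  have db : ∀ z, D2 b (x0, s0) z = 0 := fun z => by rw [D2, (b1 z).2]; simp
  obtain ⟨j1, j2, j3⟩ := jet_lin hφ1 has 1 κ (x0, t0)
  obtain ⟨l1, l2, l3⟩ := jet_lin hφ2 hbs 1 κ (x0, s0)
  obtain ⟨θ, hθ⟩ := F_lim (φ1 := fun p => 1 * φ1 p + κ * a p) (φ2 := fun p => 1 * φ2 p + κ * b p)
    (κ := κ) (e := e / 2) (by fun_prop) (by fun_prop) hwc hwL hw hZ hC₀ hC0 hCL hLL hκ hr1 hs0 hρ hKB hKL
    (fun p hp => by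
      have := hr1b hp
      simp only [ha, hb, sub_self, norm_zero]
      linarith) (by positivity)
  refine ⟨θ, ?_⟩
  rw [j1, j2, l1, l2, ga, gb, ta, tb] at hθ
  simp only [j3, l3, da, db] at hθ
  simp only [one_smul, smul_zero, add_zero, one_mul, mul_zero] at hθ
  have hsum : ∑ i, (D2 φ1 (x0, t0) (S θ x0 i) + κ * (2 * ‖S θ x0 i‖ ^ 2) + D2 φ2 (x0, s0) (S θ x0 i))
      ≤ ∑ i, (D2 φ1 (x0, t0) (S θ x0 i) + D2 φ2 (x0, s0) (S θ x0 i)) + κ * (2 * M) := by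
    rw [hM, Finset.mul_sum, Finset.mul_sum, ← Finset.sum_add_distrib]
    refine Finset.sum_le_sum fun i _ => ?_
    have : κ * (2 * ‖S θ x0 i‖ ^ 2) ≤ κ * (2 * KB ^ 2) := by
      gcongr
      exact hKB θ x0 i
    linarith
  linarith

end Lim10

section Conv11

open Metric Topology MeasureTheory
open scoped ContDiff

/-- columns of the diffusion matrix -/
def colS {N : ℕ} {Θ : Type*} (σm : Θ → E N → Matrix (Fin N) (Fin N) ℝ) (θ : Θ) (x : E N) (i : Fin N) : E N :=
  WithLp.toLp 2 (fun j => σm θ x j i)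

lemma slice_fderiv {N : ℕ} {φ : E N × ℝ → ℝ} (h : Differentiable ℝ φ) (x : E N) (t : ℝ) :
    fderiv ℝ (fun y => φ (y, t)) x = (fderiv ℝ φ (x, t)).comp (ContinuousLinearMap.inl ℝ (E N) ℝ) :=
  ((h (x, t)).hasFDerivAt.comp x (hasFDerivAt_prodMk_left x t)).fderiv

lemma slice_grad {N : ℕ} {φ : E N × ℝ → ℝ} (h : ContDiff ℝ 2 φ) (x : E N) (t : ℝ) :
    gradient (fun y => φ (y, t)) x = gx φ (x, t) := by
  rw [gradient, slice_fderiv (h.differentiable (by norm_num))]; rfl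

lemma slice_dt {N : ℕ} {φ : E N × ℝ → ℝ} (h : ContDiff ℝ 2 φ) (x : E N) (t : ℝ) :
    deriv (fun s => φ (x, s)) t = Dt φ (x, t) := by
  have hd : Differentiable ℝ φ := h.differentiable (by norm_num)
  have h1 : HasDerivAt (fun s : ℝ => (x, s)) ((0 : E N), (1:ℝ)) t :=
    (hasDerivAt_const t x).prodMk (hasDerivAt_id t)
  exact ((hd (x, t)).hasFDerivAt.comp_hasDerivAt t h1).deriv

lemma fd2_diff {F : Type*} [NormedAddCommGroup F] [NormedSpace ℝ F] {φ : F → ℝ} (h : ContDiff ℝ 2 φ)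
    (z : F) : Differentiable ℝ (fun q => fderiv ℝ φ q z) := by
  have h1 : ContDiff ℝ 1 (fderiv ℝ φ) := h.fderiv_right (m := 1) (by norm_num)
  exact (h1.clm_apply contDiff_const).differentiable (by norm_num)

lemma fd2_apply {F : Type*} [NormedAddCommGroup F] [NormedSpace ℝ F] {φ : F → ℝ} (h : ContDiff ℝ 2 φ)
    (q y z : F) : fderiv ℝ (fun p => fderiv ℝ φ p z) q y = fderiv ℝ (fderiv ℝ φ) q y z := by
  have h1 : Differentiable ℝ (fderiv ℝ φ) :=
    (h.fderiv_right (m := 1) (by norm_num)).differentiable (by norm_num)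
  have h2 := (h1 q).hasFDerivAt.clm_apply (hasFDerivAt_const z q)
  rw [h2.fderiv]
  simp

lemma slice_hess {N : ℕ} {φ : E N × ℝ → ℝ} (h : ContDiff ℝ 2 φ) (x : E N) (t : ℝ) (i j : Fin N) :
    hessMatrix (fun y => φ (y, t)) x i j = fderiv ℝ (fderiv ℝ φ) (x, t)
      (EuclideanSpace.single i 1, (0:ℝ)) (EuclideanSpace.single j 1, (0:ℝ)) := by
  have hd : Differentiable ℝ φ := h.differentiable (by norm_num)
  have e1 : (fun y => fderiv ℝ (fun y => φ (y, t)) y (EuclideanSpace.single j 1))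
      = fun y => (fun p => fderiv ℝ φ p (EuclideanSpace.single j 1, (0:ℝ))) (y, t) := by
    ext y
    rw [slice_fderiv hd]; simp
  simp only [hessMatrix, Matrix.of_apply]
  rw [e1, slice_fderiv (fd2_diff h _)]
  simp [fd2_apply h]

lemma bil_sum {F : Type*} [NormedAddCommGroup F] [NormedSpace ℝ F] {n : ℕ} (B : F →L[ℝ] F →L[ℝ] ℝ)
    (e : Fin n → F) (M : Matrix (Fin n) (Fin n) ℝ) :
    Matrix.trace ((M * Mᵀ) * Matrix.of fun i j => B (e i) (e j))
      = ∑ k, B (∑ a, M a k • e a) (∑ a, M a k • e a) := by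
  simp only [Matrix.trace, Matrix.diag, Matrix.mul_apply, Matrix.transpose_apply, Matrix.of_apply,
    map_sum, map_smul, sum_apply, smul_apply, smul_eq_mul, Finset.sum_mul, Finset.mul_sum]
  rw [Finset.sum_congr rfl fun i _ => Finset.sum_comm, Finset.sum_comm]
  refine Finset.sum_congr rfl fun k _ => Finset.sum_congr rfl fun i _ =>
    Finset.sum_congr rfl fun j _ => by ring

lemma slice_trace {N : ℕ} {Θ : Type*} {φ : E N × ℝ → ℝ} (h : ContDiff ℝ 2 φ) (x : E N) (t : ℝ)
    (σm A : Θ → E N → Matrix (Fin N) (Fin N) ℝ) (hA : ∀ θ x, A θ x = σm θ x * (σm θ x)ᵀ) (θ : Θ) :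
    Matrix.trace (A θ x * hessMatrix (fun y => φ (y, t)) x) = ∑ i, D2 φ (x, t) (colS σm θ x i) := by
  have e1 : hessMatrix (fun y => φ (y, t)) x = Matrix.of fun i j => fderiv ℝ (fderiv ℝ φ) (x, t)
      (EuclideanSpace.single i 1, (0:ℝ)) (EuclideanSpace.single j 1, (0:ℝ)) := by
    ext i j; rw [slice_hess h]; rfl
  rw [e1, hA, bil_sum _ (fun i => ((EuclideanSpace.single i 1, (0:ℝ)) : E N × ℝ))]
  refine Finset.sum_congr rfl fun k _ => ?_
  have e2 : ∑ a, σm θ x a k • ((EuclideanSpace.single a 1, (0:ℝ)) : E N × ℝ) = (colS σm θ x k, 0) := by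
    ext b
    · simp [Prod.fst_sum, colS, Pi.single_apply]
    · simp [Prod.snd_sum]
  rw [e2, D2]

lemma bil_bdd {F : Type*} [NormedAddCommGroup F] [NormedSpace ℝ F] (B : F →L[ℝ] F →L[ℝ] ℝ) :
    ∃ M : ℝ, 0 ≤ M ∧ ∀ z, |B z z| ≤ M * ‖z‖ ^ 2 :=
  ⟨‖B‖, by positivity, fun z => by
    have := B.le_opNorm₂ z z
    rw [Real.norm_eq_abs] at this
    linarith⟩

lemma colS_bd {N : ℕ} {Θ : Type*} {σm : Θ → E N → Matrix (Fin N) (Fin N) ℝ} {C : ℝ} (hC : 0 < C)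
    (hσbd : ∀ (θ : Θ) (x : E N) (i j : Fin N), |σm θ x i j| ≤ C) (θ : Θ) (x : E N) (i : Fin N) :
    ‖colS σm θ x i‖ ≤ N * C := by
  have h : ‖colS σm θ x i‖ ^ 2 ≤ (N * C) ^ 2 := by
    rw [EuclideanSpace.norm_sq_eq]
    calc ∑ j, ‖colS σm θ x i j‖ ^ 2 ≤ ∑ _j : Fin N, C ^ 2 := by
          refine Finset.sum_le_sum fun j _ => ?_
          have := hσbd θ x j i
          rw [Real.norm_eq_abs]
          exact pow_le_pow_left₀ (abs_nonneg _) this 2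
      _ = N * C ^ 2 := by simp
      _ ≤ (N * C) ^ 2 := by
          rw [mul_pow]
          gcongr
          have : (N:ℝ) ≤ (N:ℝ) ^ 2 := by
            exact_mod_cast Nat.le_self_pow (by norm_num) N
          exact this
  exact (abs_le_of_sq_le_sq' h (by positivity)).2

lemma colS_lip {N : ℕ} {Θ : Type*} {σm : Θ → E N → Matrix (Fin N) (Fin N) ℝ} {C : ℝ} (hC : 0 < C)
    (hσlip : ∀ (θ : Θ) (i j : Fin N), LipschitzWith C.toNNReal fun x : E N => σm θ x i j)
    (θ : Θ) (x y : E N) (i : Fin N) :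
    ‖colS σm θ x i - colS σm θ y i‖ ≤ N * C * ‖x - y‖ := by
  have h : ‖colS σm θ x i - colS σm θ y i‖ ^ 2 ≤ (N * C * ‖x - y‖) ^ 2 := by
    rw [EuclideanSpace.norm_sq_eq]
    calc ∑ j, ‖(colS σm θ x i - colS σm θ y i) j‖ ^ 2 ≤ ∑ _j : Fin N, (C * ‖x - y‖) ^ 2 := by
          refine Finset.sum_le_sum fun j _ => ?_
          have := (hσlip θ j i).dist_le_mul x y
          rw [Real.dist_eq, dist_eq_norm, Real.coe_toNNReal _ hC.le] at this
          rw [Real.norm_eq_abs]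
          exact pow_le_pow_left₀ (abs_nonneg _) this 2
      _ = N * (C * ‖x - y‖) ^ 2 := by simp
      _ ≤ (N * C * ‖x - y‖) ^ 2 := by
          rw [mul_assoc, mul_pow (N:ℝ)]
          gcongr
          have : (N:ℝ) ≤ (N:ℝ) ^ 2 := by
            exact_mod_cast Nat.le_self_pow (by norm_num) N
          exact this
  exact (abs_le_of_sq_le_sq' h (by positivity)).2

end Conv11

section Conv12

open Metric Topology MeasureTheory
open scoped ContDiff

variable {N : ℕ} {Θ : Type*}

lemma opVal_eq {φ : E N × ℝ → ℝ} (h : ContDiff ℝ 2 φ) (x : E N) (t : ℝ)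
    {σm A : Θ → E N → Matrix (Fin N) (Fin N) ℝ} (hA : ∀ θ x, A θ x = σm θ x * (σm θ x)ᵀ)
    (H : Θ → E N → E N → ℝ) (θ : Θ) :
    opVal A H θ x (fun y => φ (y, t))
      = - ∑ i, D2 φ (x, t) (colS σm θ x i) + H θ x (gx φ (x, t)) := by
  rw [opVal, slice_trace h x t σm A hA, slice_grad h]

lemma D2_bdd {φ : E N × ℝ → ℝ} (x : E N) (t : ℝ)
    {σm : Θ → E N → Matrix (Fin N) (Fin N) ℝ} {C : ℝ} (hC : 0 < C)
    (hσbd : ∀ (θ : Θ) (x : E N) (i j : Fin N), |σm θ x i j| ≤ C) :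
    ∃ M, ∀ θ, |∑ i, D2 φ (x, t) (colS σm θ x i)| ≤ M := by
  obtain ⟨M, hM0, hM⟩ := bil_bdd (fderiv ℝ (fderiv ℝ φ) (x, t))
  refine ⟨∑ _i : Fin N, M * (N * C) ^ 2, fun θ => ?_⟩
  refine (Finset.abs_sum_le_sum_abs _ _).trans (Finset.sum_le_sum fun i _ => ?_)
  have h1 := hM (colS σm θ x i, 0)
  have h2 : ‖((colS σm θ x i, 0) : E N × ℝ)‖ = ‖colS σm θ x i‖ := by simp [Prod.norm_def]
  rw [h2] at h1
  refine h1.trans ?_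
  gcongr
  exact colS_bd hC hσbd θ x i

lemma H_bdd {H : Θ → E N → E N → ℝ} {C : ℝ} (hH0 : ∀ (θ : Θ) (x : E N), |H θ x 0| ≤ C)
    (hHlip : ∀ R > (0:ℝ), ∃ CR > (0:ℝ), ∀ (θ : Θ) (x y p q : E N),
      ‖p‖ ≤ R → ‖q‖ ≤ R → |H θ x p - H θ y q| ≤ CR * (‖x - y‖ + ‖p - q‖)) (x p : E N) :
    ∃ M, ∀ θ, |H θ x p| ≤ M := by
  obtain ⟨CR, hCR, h⟩ := hHlip (‖p‖ + 1) (by positivity)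
  refine ⟨C + CR * ‖p‖, fun θ => ?_⟩
  have h1 := h θ x x p 0 (by linarith) (by simp; positivity)
  have h2 := hH0 θ x
  simp only [sub_self, norm_zero, sub_zero, zero_add] at h1
  rw [abs_le] at *
  constructor <;> linarith

lemma op_bdd {φ : E N × ℝ → ℝ} (hφ : ContDiff ℝ 2 φ) (x : E N) (t : ℝ)
    {σm A : Θ → E N → Matrix (Fin N) (Fin N) ℝ} (hA : ∀ θ x, A θ x = σm θ x * (σm θ x)ᵀ)
    {C : ℝ} (hC : 0 < C)
    (hσbd : ∀ (θ : Θ) (x : E N) (i j : Fin N), |σm θ x i j| ≤ C)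
    {H : Θ → E N → E N → ℝ} (hH0 : ∀ (θ : Θ) (x : E N), |H θ x 0| ≤ C)
    (hHlip : ∀ R > (0:ℝ), ∃ CR > (0:ℝ), ∀ (θ : Θ) (x y p q : E N),
      ‖p‖ ≤ R → ‖q‖ ≤ R → |H θ x p - H θ y q| ≤ CR * (‖x - y‖ + ‖p - q‖)) :
    BddAbove (Set.range fun θ => opVal A H θ x (fun y => φ (y, t))) := by
  obtain ⟨M1, h1⟩ := D2_bdd (φ := φ) x t hC hσbd
  obtain ⟨M2, h2⟩ := H_bdd hH0 hHlip x (gx φ (x, t))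
  refine ⟨M1 + M2, ?_⟩
  rintro _ ⟨θ, rfl⟩
  beta_reduce
  rw [opVal_eq hφ x t hA H]
  have a := abs_le.1 (h1 θ)
  have b := abs_le.1 (h2 θ)
  linarith

lemma ext_eq (u : E N → ℝ → ℝ) (φ : E N × ℝ → ℝ) {q : E N × ℝ} (hq : 0 < q.2) :
    (fun z : E N × ℝ => u z.1 (max z.2 0) - φ z) =ᶠ[𝓝 q] fun z => u z.1 z.2 - φ z := by
  have : ∀ᶠ z : E N × ℝ in 𝓝 q, 0 < z.2 := continuous_snd.continuousAt.eventually_const_lt hq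
  filter_upwards [this] with z hz
  rw [max_eq_left hz.le]

lemma vsub_u {σm A : Θ → E N → Matrix (Fin N) (Fin N) ℝ} (hA : ∀ θ x, A θ x = σm θ x * (σm θ x)ᵀ)
    {C : ℝ} (hC : 0 < C)
    (hσbd : ∀ (θ : Θ) (x : E N) (i j : Fin N), |σm θ x i j| ≤ C)
    {H : Θ → E N → E N → ℝ} (hH0 : ∀ (θ : Θ) (x : E N), |H θ x 0| ≤ C)
    (hHlip : ∀ R > (0:ℝ), ∃ CR > (0:ℝ), ∀ (θ : Θ) (x y p q : E N),
      ‖p‖ ≤ R → ‖q‖ ≤ R → |H θ x p - H θ y q| ≤ CR * (‖x - y‖ + ‖p - q‖))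
    {u : E N → ℝ → ℝ} (hu : IsSubSolCP A H u) :
    VSub (colS σm) H (fun q : E N × ℝ => u q.1 (max q.2 0)) := by
  intro φ hφ q hq hmax θ
  have h1 : IsLocalMax (fun z : E N × ℝ => u z.1 z.2 - φ z) q :=
    (ext_eq u φ hq).isLocalMax_iff.1 hmax
  have h2 := hu (fun x t => φ (x, t)) hφ q.1 q.2 hq h1
  have h3 := le_ciSup (op_bdd hφ q.1 q.2 hA hC hσbd hH0 hHlip) θ
  beta_reduce at h3
  rw [opVal_eq hφ q.1 q.2 hA H] at h3
  have h4 := slice_dt hφ q.1 q.2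
  simp only [Prod.mk.eta] at h2 h3 h4
  linarith

lemma vsuper_u [Nonempty Θ] {σm A : Θ → E N → Matrix (Fin N) (Fin N) ℝ}
    (hA : ∀ θ x, A θ x = σm θ x * (σm θ x)ᵀ)
    {H : Θ → E N → E N → ℝ} {u : E N → ℝ → ℝ} (hu : IsSuperSolCP A H u) :
    VSuper (colS σm) H (fun q : E N × ℝ => u q.1 (max q.2 0)) := by
  intro φ hφ q hq hmax e he
  have h1 : IsLocalMin (fun z : E N × ℝ => u z.1 z.2 - φ z) q :=
    (ext_eq u φ hq).isLocalMin_iff.1 hmax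
  have h2 := hu (fun x t => φ (x, t)) hφ q.1 q.2 hq h1
  have h4 := slice_dt hφ q.1 q.2
  obtain ⟨θ, h3⟩ := exists_lt_of_lt_ciSup
    (show -Dt φ q - e < ⨆ θ, opVal A H θ q.1 fun y => φ (y, q.2) by
      simp only [Prod.mk.eta] at h2 h4; linarith)
  refine ⟨θ, ?_⟩
  rw [opVal_eq hφ q.1 q.2 hA H] at h3
  simp only [Prod.mk.eta] at h3
  linarith

lemma vsub_v {σm A : Θ → E N → Matrix (Fin N) (Fin N) ℝ} (hA : ∀ θ x, A θ x = σm θ x * (σm θ x)ᵀ)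
    {C : ℝ} (hC : 0 < C)
    (hσbd : ∀ (θ : Θ) (x : E N) (i j : Fin N), |σm θ x i j| ≤ C)
    {H : Θ → E N → E N → ℝ} (hH0 : ∀ (θ : Θ) (x : E N), |H θ x 0| ≤ C)
    (hHlip : ∀ R > (0:ℝ), ∃ CR > (0:ℝ), ∀ (θ : Θ) (x y p q : E N),
      ‖p‖ ≤ R → ‖q‖ ≤ R → |H θ x p - H θ y q| ≤ CR * (‖x - y‖ + ‖p - q‖))
    {v : E N → ℝ} (hv : IsSubSolErg A H 0 v) :
    VSub (colS σm) H (fun q : E N × ℝ => v q.1) := by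
  intro φ hφ q hq hmax θ
  have h1 : IsLocalMax (fun x : E N => v x - φ (x, q.2)) q.1 := by
    have hc : Tendsto (fun x : E N => (x, q.2)) (𝓝 q.1) (𝓝 q) :=
      Continuous.tendsto' (by fun_prop) _ _ (by simp)
    exact hc.eventually hmax
  have h2 := hv (fun x => φ (x, q.2)) (by fun_prop) q.1 h1
  have h3 := le_ciSup (op_bdd hφ q.1 q.2 hA hC hσbd hH0 hHlip) θ
  beta_reduce at h3
  rw [opVal_eq hφ q.1 q.2 hA H] at h3
  have h4 := slice_dt hφ q.1 q.2
  have h5 : deriv (fun s => φ (q.1, s)) q.2 = 0 := by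
    have : IsLocalMin (fun s => φ (q.1, s)) q.2 := by
      have hc : Tendsto (fun s : ℝ => (q.1, s)) (𝓝 q.2) (𝓝 q) :=
        Continuous.tendsto' (by fun_prop) _ _ (by simp)
      filter_upwards [hc.eventually hmax] with s hs
      simp only [Prod.mk.eta] at hs ⊢
      linarith
    exact this.deriv_eq_zero
  simp only [Prod.mk.eta] at h2 h3 h4
  linarith

lemma lip_le {L : NNReal} {f : E N → ℝ} (h : LipschitzWith L f) (x y : E N) :
    f x ≤ f y + L * ‖x - y‖ := by
  have := h.dist_le_mul x y
  rw [Real.dist_eq, dist_eq_norm] at this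
  linarith [le_abs_self (f x - f y)]

lemma colS_lip2 {σm : Θ → E N → Matrix (Fin N) (Fin N) ℝ} {C : ℝ} (hC : 0 < C)
    (hσlip : ∀ (θ : Θ) (i j : Fin N), LipschitzWith C.toNNReal fun x : E N => σm θ x i j)
    (θ : Θ) (x y : E N) :
    ∑ i, ‖colS σm θ x i - colS σm θ y i‖ ^ 2 ≤ (N * (N * C) ^ 2) * ‖x - y‖ ^ 2 := by
  calc ∑ i, ‖colS σm θ x i - colS σm θ y i‖ ^ 2 ≤ ∑ _i : Fin N, (N * C * ‖x - y‖) ^ 2 :=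
        Finset.sum_le_sum fun i _ => pow_le_pow_left₀ (norm_nonneg _) (colS_lip hC hσlip θ x y i) 2
    _ = _ := by simp; ring

/-- upper bound property of the supremum -/
lemma P_bdd {u : E N → ℝ → ℝ} {v : E N → ℝ} {η μ : ℝ} (hη : 0 < η) (hμ : 1 < μ)
    (hubd : ∃ Cb : ℝ, ∀ (x : E N) (t : ℝ), |u x t| ≤ Cb) (x : E N) (t : ℝ) :
    BddAbove ((fun s => u x t - v x - μ * (u x s - v x) - μ * η * (s - t)) '' Set.Ici t) := by
  obtain ⟨B, hB⟩ := hubd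
  refine ⟨u x t - v x + μ * (B + v x), ?_⟩
  rintro _ ⟨s, hs, rfl⟩
  have h1 := abs_le.1 (hB x s)
  have h2 : 0 ≤ μ * η * (s - t) := by
    have : 0 ≤ s - t := sub_nonneg.2 hs
    positivity
  have h3 : μ * (-B) ≤ μ * u x s := mul_le_mul_of_nonneg_left h1.1 (by linarith)
  beta_reduce
  nlinarith

lemma P_ge {u : E N → ℝ → ℝ} {v : E N → ℝ} {η μ : ℝ} (hη : 0 < η) (hμ : 1 < μ)
    (hubd : ∃ Cb : ℝ, ∀ (x : E N) (t : ℝ), |u x t| ≤ Cb) (x : E N) {t s : ℝ} (hs : t ≤ s) :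
    u x t - v x - μ * (u x s - v x) - μ * η * (s - t) ≤ Pfun u v η μ x t :=
  le_csSup (P_bdd hη hμ hubd x t) ⟨s, hs, rfl⟩

lemma P_att {u : E N → ℝ → ℝ} {v : E N → ℝ} {η μ : ℝ} (hη : 0 < η) (hμ : 1 < μ)
    (hubd : ∃ Cb : ℝ, ∀ (x : E N) (t : ℝ), |u x t| ≤ Cb)
    (hucont : ContinuousOn (fun q : E N × ℝ => u q.1 q.2) (Set.univ ×ˢ Set.Ici 0))
    (x : E N) {t : ℝ} (ht : 0 < t) :
    ∃ s, t ≤ s ∧ Pfun u v η μ x t = u x t - v x - μ * (u x s - v x) - μ * η * (s - t) := by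
  have hc : ContinuousOn (fun s => u x s) (Set.Ici t) := by
    refine hucont.comp (f := fun s => (x, s)) (by fun_prop) fun s hs => ⟨trivial, ?_⟩
    exact ht.le.trans hs
  obtain ⟨B, hB⟩ := hubd
  set f : ℝ → ℝ := fun s => u x t - v x - μ * (u x s - v x) - μ * η * (s - t) with hf
  have hfc : ContinuousOn f (Set.Ici t) := by
    apply ContinuousOn.sub
    · apply ContinuousOn.sub continuousOn_const
      exact continuousOn_const.mul (hc.sub continuousOn_const)
    · fun_prop
  set T := t + 2 * B / η with hT
  have hB0 : 0 ≤ B := (abs_nonneg _).trans (hB x t)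
  have hTt : t ≤ T := by
    have : 0 ≤ 2 * B / η := by positivity
    linarith
  obtain ⟨s, hs, hmax⟩ := (isCompact_Icc (a := t) (b := T)).exists_isMaxOn ⟨t, le_refl _, hTt⟩
    (hfc.mono Set.Icc_subset_Ici_self)
  refine ⟨s, hs.1, ?_⟩
  refine le_antisymm (csSup_le ⟨f t, t, Set.mem_Ici.2 (le_refl _), rfl⟩ ?_) (P_ge hη hμ ⟨B, hB⟩ x hs.1)
  rintro _ ⟨r, hr, rfl⟩
  change f r ≤ f s
  rcases le_total r T with h | h
  · exact hmax ⟨hr, h⟩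
  · refine le_trans ?_ (hmax (show t ∈ Set.Icc t T from ⟨le_refl _, hTt⟩))
    have h1 := abs_le.1 (hB x r)
    have h2 := abs_le.1 (hB x t)
    have h3 : 2 * B ≤ η * (r - t) := by
      have : 2 * B / η ≤ r - t := by linarith
      rw [div_le_iff₀ hη] at this
      linarith
    have h4 : u x t ≤ u x r + η * (r - t) := by linarith
    have h5 := mul_le_mul_of_nonneg_left h4 (show 0 ≤ μ by linarith)
    simp only [hf]
    nlinarith

lemma cont_ext {u : E N → ℝ → ℝ}
    (hucont : ContinuousOn (fun q : E N × ℝ => u q.1 q.2) (Set.univ ×ˢ Set.Ici 0)) :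
    Continuous (fun q : E N × ℝ => u q.1 (max q.2 0)) := by
  have h : Continuous fun q : E N × ℝ => (q.1, max q.2 0) := by fun_prop
  exact hucont.comp_continuous h fun q => ⟨trivial, Set.mem_Ici.2 (le_max_right _ _)⟩

lemma jet_snd (q : E N × ℝ) : gx (fun q : E N × ℝ => q.2) q = 0 ∧ Dt (fun q : E N × ℝ => q.2) q = 1 ∧
    ∀ z, D2 (fun q : E N × ℝ => q.2) q z = 0 := by
  have hs : ContDiff ℝ 2 (fun q : E N × ℝ => q.2) := contDiff_snd
  have h0 : ContDiff ℝ 2 (fun _ : E N × ℝ => (0:ℝ)) := contDiff_const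
  have h1 : ∀ z : E N, _ := fun z => line_poly h0 hs q (z, (0:ℝ)) q (z, (0:ℝ)) q.2 0 0
    (fun s => by simp)
  have h2 := line_poly h0 hs q 0 q ((0:E N), (1:ℝ)) q.2 1 0 (fun s => by simp)
  refine ⟨?_, ?_, fun z => ?_⟩
  · refine ext_inner_right ℝ fun z => ?_
    rw [gx_inner, (h1 z).1]; simp
  · rw [Dt, h2.1]; simp
  · rw [D2, (h1 z).2]; simp

end Conv12

theorem statement6
    {N : ℕ} {Θ : Type*} [MetricSpace Θ] [Nonempty Θ]
    (C : ℝ) (hC : 0 < C)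
    (σm : Θ → E N → Matrix (Fin N) (Fin N) ℝ)
    (A : Θ → E N → Matrix (Fin N) (Fin N) ℝ)
    -- (H1)
    (hA : ∀ (θ : Θ) (x : E N), A θ x = σm θ x * (σm θ x)ᵀ)
    (hσper : ∀ θ : Θ, ZPeriodic (σm θ))
    (hσbd : ∀ (θ : Θ) (x : E N) (i j : Fin N), |σm θ x i j| ≤ C)
    (hσlip : ∀ (θ : Θ) (i j : Fin N), LipschitzWith C.toNNReal fun x : E N => σm θ x i j)
    (H : Θ → E N → E N → ℝ)
    -- (H2)
    (hHper : ∀ (θ : Θ) (p : E N), ZPeriodic fun x => H θ x p)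
    (hH0 : ∀ (θ : Θ) (x : E N), |H θ x 0| ≤ C)
    (hHlip : ∀ R > (0:ℝ), ∃ CR > (0:ℝ), ∀ (θ : Θ) (x y p q : E N),
      ‖p‖ ≤ R → ‖q‖ ≤ R → |H θ x p - H θ y q| ≤ CR * (‖x - y‖ + ‖p - q‖))
    -- convexity of H_θ(x,·)
    (hconv : ∀ (θ : Θ) (x : E N), ConvexOn ℝ Set.univ (H θ x))
    -- u : bounded solution of (CP), Lipschitz in x with constant C uniformly in t,
    -- normalization c = 0
    (u : E N → ℝ → ℝ)
    (huper : ∀ t : ℝ, ZPeriodic fun x => u x t)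
    (hucont : ContinuousOn (fun q : E N × ℝ => u q.1 q.2) (Set.univ ×ˢ Set.Ici 0))
    (hubd : ∃ Cb : ℝ, ∀ (x : E N) (t : ℝ), |u x t| ≤ Cb)
    (husol : IsSolCP A H u)
    (hulip : ∀ t : ℝ, 0 ≤ t → LipschitzWith C.toNNReal fun x => u x t)
    (hdisc : ∀ lam > (0:ℝ), ∃ w : E N → ℝ, ZPeriodic w ∧ Continuous w ∧
      IsSolDisc A H lam w ∧ LipschitzWith C.toNNReal w)
    -- v : bounded Lipschitz solution of the ergodic equation with c = 0
    (v : E N → ℝ) (hvper : ZPeriodic v)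
    (hvbd : ∃ Cb : ℝ, ∀ x : E N, |v x| ≤ Cb)
    (Lv : NNReal) (hvlip : LipschitzWith Lv v)
    (hverg : IsSolErg A H 0 v)
    -- C₀ = sup_θ ‖D_pH_θ‖ on 𝕋^N × B(0,R), R = sup_t Lip(u(·,t)) + Lip(v),
    -- expressed as: C₀ is a Lipschitz bound for H_θ(x,·) on B(0, C + Lv)
    (C₀ : ℝ)
    (hC₀ : ∀ (θ : Θ) (x p q : E N), ‖p‖ ≤ C + (Lv : ℝ) → ‖q‖ ≤ C + (Lv : ℝ) →
      |H θ x p - H θ x q| ≤ C₀ * ‖p - q‖)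
    (η μ : ℝ) (hη : 0 < η) (hμ : 1 < μ) :
    IsSubSolMinIneq A C₀ (Pfun u v η μ) := by
  intro φ hφ x₀ t₀ ht₀ hmax
  right
  set Φ : E N × ℝ → ℝ := fun q => φ q.1 q.2 with hΦ
  set w : E N × ℝ → ℝ := fun q => u q.1 (max q.2 0) with hw
  have hLv : (0:ℝ) ≤ Lv := Lv.2
  have hwc : Continuous w := cont_ext hucont
  have hwL : ∀ x y t, w (x, t) ≤ w (y, t) + C * ‖x - y‖ := fun x y t => by
    have := lip_le (hulip (max t 0) (le_max_right _ _)) x y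
    rwa [Real.coe_toNNReal _ hC.le] at this
  have hvc : Continuous fun q : E N × ℝ => v q.1 := hvlip.continuous.comp continuous_fst
  have hH' : ∀ R : ℝ, 0 < R → ∃ CR : ℝ, 0 < CR ∧ ∀ (θ : Θ) (x y p q : E N), ‖p‖ ≤ R → ‖q‖ ≤ R →
      |H θ x p - H θ y q| ≤ CR * (‖x - y‖ + ‖p - q‖) := fun R hR => hHlip R hR
  have hKS : (0:ℝ) ≤ N * (N * C) ^ 2 := by positivity
  have hAu : Apx (colS σm) H C w (x₀, t₀) (t₀ / 4) := fun e he =>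
    smooth_sub (colS σm) H hC.le hwc hwL (vsub_u hA hC hσbd hH0 hHlip husol.1) hKS
      (colS_lip2 hC hσlip) hH' hconv (q0 := (x₀, t₀)) ht₀ he
  have hAv : Apx (colS σm) H Lv (fun q : E N × ℝ => v q.1) (x₀, t₀) (t₀ / 4) := fun e he =>
    smooth_sub (colS σm) H hLv hvc (fun x y t => lip_le hvlip x y)
      (vsub_v hA hC hσbd hH0 hHlip hverg.1) hKS
      (colS_lip2 hC hσlip) hH' hconv (q0 := (x₀, t₀)) ht₀ he
  have hsup : VSuper (colS σm) H w := vsuper_u hA husol.2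
  have hwpos : ∀ y s, 0 < s → w (y, s) = u y s := fun y s hs => by
    simp only [hw]; rw [max_eq_left hs.le]
  have htr : ∀ θ, Matrix.trace (A θ x₀ * hessMatrix (fun y => φ y t₀) x₀)
      = ∑ i, D2 Φ (x₀, t₀) (colS σm θ x₀ i) := fun θ => slice_trace hφ x₀ t₀ σm A hA θ
  have hdt : deriv (φ x₀) t₀ = Dt Φ (x₀, t₀) := slice_dt hφ x₀ t₀
  have hgr : gradient (fun y => φ y t₀) x₀ = gx Φ (x₀, t₀) := slice_grad hφ x₀ t₀
  have hbdd : BddBelow (Set.range fun θ => -Matrix.trace (A θ x₀ * hessMatrix (fun y => φ y t₀) x₀)) := by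
    obtain ⟨M, hM⟩ := D2_bdd (φ := Φ) x₀ t₀ hC hσbd
    refine ⟨-M, ?_⟩
    rintro _ ⟨θ, rfl⟩
    beta_reduce
    rw [htr]
    linarith [(abs_le.1 (hM θ)).2]
  suffices hk : ∃ k : ℝ, 0 < k ∧ ∀ e : ℝ, 0 < e → ∃ θ, Dt Φ (x₀, t₀)
      - ∑ i, D2 Φ (x₀, t₀) (colS σm θ x₀ i) - C₀ * ‖gx Φ (x₀, t₀)‖ ≤ k * e by
    obtain ⟨k, hk0, hk⟩ := hk
    refine le_of_forall_pos_le_add fun e he => ?_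
    obtain ⟨θ, hθ⟩ := hk (e / k) (by positivity)
    rw [mul_div_cancel₀ _ hk0.ne'] at hθ
    have h1 := ciInf_le hbdd θ
    beta_reduce at h1
    rw [htr θ] at h1
    rw [hdt, hgr]
    linarith
  have hlin : ContDiff ℝ 2 (fun q : E N × ℝ => q.2) := contDiff_snd
  have hmax' : ∀ᶠ q : E N × ℝ in nhds (x₀, t₀),
      Pfun u v η μ q.1 q.2 - Φ q ≤ Pfun u v η μ x₀ t₀ - Φ (x₀, t₀) := hmax
  obtain ⟨s₀, hs₀, hatt⟩ := P_att (v := v) hη hμ hubd hucont x₀ ht₀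
  have hμ0 : 0 < μ := by linarith
  have hμ1 : 0 < μ - 1 := by linarith
  have hKB := colS_bd hC hσbd
  have hKL := colS_lip hC hσlip
  rcases hs₀.lt_or_eq with hlt | heq
  · have hs00 : 0 < s₀ := ht₀.trans hlt
    refine ⟨μ, hμ0, fun e he => ?_⟩
    have hAom := Apx_comb hAu hAv hC.le hLv hconv (a := 1 / μ) (b := 1 - 1 / μ) (by positivity)
      (by rw [sub_nonneg, div_le_one hμ0]; exact hμ.le) (by ring)
    have hm : ∀ᶠ p : E N × ℝ × ℝ in nhds (x₀, t₀, s₀),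
        (fun q : E N × ℝ => 1 / μ * w q + (1 - 1 / μ) * v q.1) (p.1, p.2.1) - w (p.1, p.2.2)
          - (fun q => 1 / μ * Φ q + (-η) * q.2) (p.1, p.2.1) - (fun q => η * q.2 + 0 * q.2) (p.1, p.2.2)
        ≤ (fun q : E N × ℝ => 1 / μ * w q + (1 - 1 / μ) * v q.1) (x₀, t₀) - w (x₀, s₀)
          - (fun q => 1 / μ * Φ q + (-η) * q.2) (x₀, t₀) - (fun q => η * q.2 + 0 * q.2) (x₀, s₀) := by
      have c1 : Tendsto (fun p : E N × ℝ × ℝ => (p.1, p.2.1)) (nhds (x₀, t₀, s₀)) (nhds (x₀, t₀)) :=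
        Continuous.tendsto' (by fun_prop) _ _ rfl
      have c2 : ∀ᶠ p : E N × ℝ × ℝ in nhds (x₀, t₀, s₀), p.2.1 < p.2.2 :=
        (continuous_snd.fst).continuousAt.eventually_lt (continuous_snd.snd).continuousAt hlt
      have c3 : ∀ᶠ p : E N × ℝ × ℝ in nhds (x₀, t₀, s₀), 0 < p.2.1 :=
        (continuous_snd.fst).continuousAt.eventually_const_lt ht₀
      filter_upwards [c1.eventually hmax', c2, c3] with p h1 h2 h3
      obtain ⟨y, t, s⟩ := p
      simp only at h1 h2 h3 ⊢
      rw [hwpos y t h3, hwpos y s (h3.trans h2), hwpos x₀ t₀ ht₀, hwpos x₀ s₀ hs00]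
      have h4 := P_ge (v := v) hη hμ hubd y h2.le
      have h5 : u y t - v y - μ * (u y s - v y) - μ * η * (s - t) - Φ (y, t) ≤
          u x₀ t₀ - v x₀ - μ * (u x₀ s₀ - v x₀) - μ * η * (s₀ - t₀) - Φ (x₀, t₀) := by
        rw [← hatt]; linarith
      have h6 := div_le_div_of_nonneg_right h5 hμ0.le
      have e1 : ∀ a b c d g f : ℝ, (a - b - μ * (c - b) - μ * η * (d - g) - f) / μ
          = 1 / μ * a + (1 - 1 / μ) * b - c - (1 / μ * f + -η * g) - (η * d + 0 * d) := by
        intros; field_simp; ring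
      rw [e1, e1] at h6
      exact h6
    obtain ⟨θ, hθ⟩ := F_final (φ1 := fun q => 1 / μ * Φ q + (-η) * q.2)
      (φ2 := fun q => η * q.2 + 0 * q.2) (by fun_prop) (by fun_prop)
      hwc hwL hsup hAom hC₀ hC.le (by linarith)
      le_rfl hs00 (by positivity) hKB hKL hm he
    refine ⟨θ, ?_⟩
    obtain ⟨a1, a2, a3⟩ := jet_lin hφ hlin (1 / μ) (-η) (x₀, t₀)
    obtain ⟨b1, b2, b3⟩ := jet_lin hlin hlin η 0 (x₀, s₀)
    obtain ⟨d1, d2, d3⟩ := jet_snd (x₀, t₀)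
    obtain ⟨e1, e2, e3⟩ := jet_snd (x₀, s₀)
    rw [a1, a2, b1, b2, d1, d2, e1, e2] at hθ
    simp only [a3, b3, d3, e3] at hθ
    simp only [mul_zero, add_zero, smul_zero, mul_one, zero_mul] at hθ
    rw [← Finset.mul_sum, norm_smul, Real.norm_of_nonneg (by positivity)] at hθ
    have hθ' := mul_le_mul_of_nonneg_left hθ hμ0.le
    refine le_trans (le_of_eq ?_) hθ'
    field_simp
    ring
  · subst heq
    refine ⟨μ - 1, hμ1, fun e he => ?_⟩
    have hm : ∀ᶠ p : E N × ℝ × ℝ in nhds (x₀, t₀, t₀),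
        (fun q : E N × ℝ => v q.1) (p.1, p.2.1) - w (p.1, p.2.2)
          - (fun q => 0 * Φ q + 0 * Φ q) (p.1, p.2.1)
          - (fun q => 1 / (μ - 1) * Φ q + 0 * Φ q) (p.1, p.2.2)
        ≤ (fun q : E N × ℝ => v q.1) (x₀, t₀) - w (x₀, t₀)
          - (fun q => 0 * Φ q + 0 * Φ q) (x₀, t₀)
          - (fun q => 1 / (μ - 1) * Φ q + 0 * Φ q) (x₀, t₀) := by
      have c1 : Tendsto (fun p : E N × ℝ × ℝ => (p.1, p.2.2)) (nhds (x₀, t₀, t₀)) (nhds (x₀, t₀)) :=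
        Continuous.tendsto' (by fun_prop) _ _ rfl
      have c3 : ∀ᶠ p : E N × ℝ × ℝ in nhds (x₀, t₀, t₀), 0 < p.2.2 :=
        (continuous_snd.snd).continuousAt.eventually_const_lt ht₀
      filter_upwards [c1.eventually hmax', c3] with p h1 h3
      obtain ⟨y, t, s⟩ := p
      simp only at h1 h3 ⊢
      rw [hwpos y s h3, hwpos x₀ t₀ ht₀]
      have h4 := P_ge (v := v) hη hμ hubd y (le_refl s)
      have h5 : u y s - v y - μ * (u y s - v y) - μ * η * (s - s) - Φ (y, s) ≤
          u x₀ t₀ - v x₀ - μ * (u x₀ t₀ - v x₀) - μ * η * (t₀ - t₀) - Φ (x₀, t₀) := by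
        rw [← hatt]; linarith
      have h6 := div_le_div_of_nonneg_right h5 hμ1.le
      have e1 : ∀ a b g f : ℝ, (a - b - μ * (a - b) - μ * η * (g - g) - f) / (μ - 1)
          = b - a - (0 * f + 0 * f) - (1 / (μ - 1) * f + 0 * f) := by
        intros; field_simp; ring
      rw [e1, e1] at h6
      linarith
    obtain ⟨θ, hθ⟩ := F_final (φ1 := fun q => 0 * Φ q + 0 * Φ q)
      (φ2 := fun q => 1 / (μ - 1) * Φ q + 0 * Φ q) (by fun_prop) (by fun_prop)
      hwc hwL hsup hAv hC₀ hC.le (by linarith)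
      (by linarith) ht₀ (by positivity) hKB hKL hm he
    refine ⟨θ, ?_⟩
    obtain ⟨a1, a2, a3⟩ := jet_lin hφ hφ 0 0 (x₀, t₀)
    obtain ⟨b1, b2, b3⟩ := jet_lin hφ hφ (1 / (μ - 1)) 0 (x₀, t₀)
    rw [a1, a2, b1, b2] at hθ
    simp only [a3, b3] at hθ
    simp only [zero_add, add_zero, zero_smul, zero_mul] at hθ
    rw [← Finset.mul_sum, norm_smul, Real.norm_of_nonneg (by positivity)] at hθ
    have hθ' := mul_le_mul_of_nonneg_left hθ hμ1.le
    refine le_trans (le_of_eq ?_) hθ'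
    field_simp

end LargeTimeBehavior
end
end

section
/- Let M: [0,∞) → ℝ be continuous and suppose it is a viscosity subsolution of min{M(t), M'(t)} ≤ 0 on (0,∞), i.e. for every t₀>0 and every C¹ function φ such that M−φ attains a local maximum at t₀, one has min{M(t₀), φ'(t₀)} ≤ 0. Then t ↦ M⁺(t) := max{M(t),0} is nonincreasing on [0,∞); in particular M⁺(t) converges to some constant m ≥ 0 as t → +∞. -/
open Filter
open scoped RealInnerProductSpace Matrix

noncomputable section

namespace LargeTimeBehavior

variable {N : ℕ} {Θ : Type*}

theorem statement7
    (M : ℝ → ℝ) (hcont : ContinuousOn M (Set.Ici 0))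
    (hsub : ∀ t₀ > (0:ℝ), ∀ φ : ℝ → ℝ, ContDiff ℝ 1 φ →
      IsLocalMax (fun t => M t - φ t) t₀ → min (M t₀) (deriv φ t₀) ≤ 0) :
    AntitoneOn (fun t => max (M t) 0) (Set.Ici 0) ∧
    ∃ m : ℝ, 0 ≤ m ∧ Tendsto (fun t => max (M t) 0) atTop (nhds m) := by
  have hanti : AntitoneOn (fun t => max (M t) 0) (Set.Ici 0) := by
    intro a ha b hb hab
    by_contra hlt
    simp only [not_le] at hlt
    have ha0 : (0:ℝ) ≤ a := ha
    have hMb : max (M a) 0 < M b := by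
      rcases lt_max_iff.1 hlt with h | h
      · exact h
      · exact absurd h (not_lt.2 (le_max_right _ _))
    have hMa : M a < M b := lt_of_le_of_lt (le_max_left _ _) hMb
    have hMb0 : 0 < M b := lt_of_le_of_lt (le_max_right _ _) hMb
    obtain ⟨ε, hε, hε2⟩ : ∃ ε > 0, max (M a) 0 + ε < M b :=
      ⟨(M b - max (M a) 0) / 2, by linarith, by linarith⟩
    have hε3 : M a + ε < M b := by linarith [le_max_left (M a) 0]
    have hε4 : ε < M b := by linarith [le_max_right (M a) 0]
    obtain ⟨L, hL, hL2⟩ : ∃ L > 0, |M (b+1) - M b| < ε * L := by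
      refine ⟨|M (b+1) - M b| / ε + 1, by positivity, ?_⟩
      field_simp
      linarith
    set φ : ℝ → ℝ := fun t => ε * Real.exp (L * (t - b)) with hφ
    have hφc : ContDiff ℝ 1 φ := by
      rw [hφ]; fun_prop
    have hφpos : ∀ t, 0 < φ t := fun t => by rw [hφ]; positivity
    have hφb : φ b = ε := by simp [hφ]
    have hφb1 : ε * (L + 1) ≤ φ (b+1) := by
      have := Real.add_one_le_exp L
      simp only [hφ, add_sub_cancel_left, mul_one]
      gcongr
    have hd : ∀ t, 0 < deriv φ t := by
      intro t
      have h1 : HasDerivAt φ (ε * (Real.exp (L * (t - b)) * (L * 1))) t :=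
        ((((hasDerivAt_id t).sub_const b).const_mul L).exp).const_mul ε
      rw [h1.deriv]
      positivity
    have hc : ContinuousOn (fun t => M t - φ t) (Set.Icc a (b+1)) :=
      (hcont.mono (fun t ht => le_trans ha0 ht.1)).sub hφc.continuous.continuousOn
    obtain ⟨t₀, ht₀, hmax⟩ := isCompact_Icc.exists_isMaxOn
      (Set.nonempty_Icc.2 (by linarith)) hc
    have hbm : M b - φ b ≤ M t₀ - φ t₀ :=
      hmax (show b ∈ Set.Icc a (b+1) from ⟨hab, by linarith⟩)
    rw [hφb] at hbm
    have hp := hφpos t₀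
    have hne1 : t₀ ≠ a := by
      rintro rfl; linarith
    have hne2 : t₀ ≠ b + 1 := by
      rintro rfl
      have := le_abs_self (M (b+1) - M b)
      nlinarith
    have h1 : a < t₀ := lt_of_le_of_ne ht₀.1 hne1.symm
    have h2 : t₀ < b + 1 := lt_of_le_of_ne ht₀.2 hne2
    have hloc : IsLocalMax (fun t => M t - φ t) t₀ :=
      hmax.isLocalMax (Icc_mem_nhds h1 h2)
    have := hsub t₀ (lt_of_le_of_lt ha0 h1) φ hφc hloc
    exact absurd this (not_le.2 (lt_min (by linarith) (hd t₀)))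
  refine ⟨hanti, ?_⟩
  have hA : Antitone (fun t => max (M (max t 0)) 0) := by
    intro s t hst
    exact hanti (show (0:ℝ) ≤ max s 0 from le_max_right _ _)
      (show (0:ℝ) ≤ max t 0 from le_max_right _ _) (max_le_max_right 0 hst)
  have hB : BddBelow (Set.range (fun t => max (M (max t 0)) 0)) :=
    ⟨0, by rintro _ ⟨t, rfl⟩; exact le_max_right _ _⟩
  have hT := tendsto_atTop_ciInf hA hB
  refine ⟨_, le_ciInf (fun t => le_max_right _ _), hT.congr' ?_⟩
  filter_upwards [eventually_ge_atTop (0:ℝ)] with t ht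
  simp only [max_eq_left ht]

end LargeTimeBehavior
end
end
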